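/- For every integer N ≥ 1, qp_4(N) ≤ 2^(145N), i.e., the number of 4-quasi-plane graphs on any set of N points in the plane in general position is at most 2^(145N). -/

import Mathlib

open scoped Classical

noncomputable section

/-- A point in the plane. -/
abbrev Pt : Type := ℝ × ℝ

/-- `S` is in general position: no three distinct points of `S` are collinear. -/
def GenPos (S : Finset Pt) : Prop :=
  ∀ p ∈ S, ∀ q ∈ S, ∀ r ∈ S, p ≠ q → p ≠ r → q ≠ r →
    ¬ Collinear ℝ ({p, q, r} : Set Pt)

/-- Two straight edges cross if their relative interiors (open segments) meet. -/
def EdgesCross (e f : Sym2 Pt) : Prop :=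
  ∃ a b c d : Pt, e = s(a, b) ∧ f = s(c, d) ∧
    (openSegment ℝ a b ∩ openSegment ℝ c d).Nonempty

/-- `G` is a crossing-free straight-edge (plane) graph on the point set `S`:
its edges are nondegenerate straight segments between points of `S`,
and no two distinct edges cross. -/
def IsPlaneGraph (S : Finset Pt) (G : Finset (Sym2 Pt)) : Prop :=
  (∀ e ∈ G, ¬ e.IsDiag ∧ ∀ p ∈ e, p ∈ S) ∧
    ∀ e ∈ G, ∀ f ∈ G, e ≠ f → ¬ EdgesCross e f

/-- The (finite) collection of all plane graphs on `S`. -/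
def planeGraphs (S : Finset Pt) : Finset (Finset (Sym2 Pt)) :=
  S.sym2.powerset.filter (IsPlaneGraph S)

/-- The degree of the point `p` in the graph `G`. -/
def vingDeg (G : Finset (Sym2 Pt)) (p : Pt) : ℕ :=
  (G.filter fun e => p ∈ e).card

/-- The ving `(p, G)` is an x-ving: no straight edge from `p` to another point
of `S` can be added to `G` while keeping the graph plane. -/
def IsXVing (S : Finset Pt) (G : Finset (Sym2 Pt)) (p : Pt) : Prop :=
  ∀ q ∈ S, q ≠ p → s(p, q) ∉ G → ¬ IsPlaneGraph S (insert s(p, q) G)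

/-- `v_x(G)`: the number of x-vings of `G`. -/
def vx (S : Finset Pt) (G : Finset (Sym2 Pt)) : ℕ :=
  (S.filter (IsXVing S G)).card

/-- `v_i(G)`: the number of vertices of degree exactly `i` in `G`. -/
def vdeg (S : Finset Pt) (G : Finset (Sym2 Pt)) (i : ℕ) : ℕ :=
  (S.filter fun p => vingDeg G p = i).card

/-- `ĥv_x(S)`: the average of `v_x(G)` over a uniformly random plane graph on `S`. -/
def hvx (S : Finset Pt) : ℝ :=
  (∑ G ∈ planeGraphs S, (vx S G : ℝ)) / (planeGraphs S).card

/-- `ĥv_i(S)`: the average of `v_i(G)` over a uniformly random plane graph on `S`. -/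
def hvdeg (S : Finset Pt) (i : ℕ) : ℝ :=
  (∑ G ∈ planeGraphs S, (vdeg S G i : ℝ)) / (planeGraphs S).card

/-- `pg(N)`: the maximum number of plane graphs over all sets of `N` points in
general position. -/
def pgMax (N : ℕ) : ℕ :=
  sSup {n : ℕ | ∃ S : Finset Pt, S.card = N ∧ GenPos S ∧ (planeGraphs S).card = n}

/-- The plane graphs on `S` with at most `m` edges. -/
def planeGraphsLE (S : Finset Pt) (m : ℝ) : Finset (Finset (Sym2 Pt)) :=
  (planeGraphs S).filter fun G => (G.card : ℝ) ≤ m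

/-- `ĥv_{x,m}(S)`: the average of `v_x(G)` over a uniformly random plane graph
on `S` with at most `m` edges. -/
def hvxLE (S : Finset Pt) (m : ℝ) : ℝ :=
  (∑ G ∈ planeGraphsLE S m, (vx S G : ℝ)) / (planeGraphsLE S m).card

/-- `G` has no vertex (point of `S`) of degree smaller than `i`. -/
def MinDegGe (S : Finset Pt) (G : Finset (Sym2 Pt)) (i : ℕ) : Prop :=
  ∀ p ∈ S, i ≤ vingDeg G p

/-- The plane graphs on `S` with no vertex of degree smaller than `i`. -/
def planeGraphsDeg (S : Finset Pt) (i : ℕ) : Finset (Finset (Sym2 Pt)) :=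
  (planeGraphs S).filter fun G => MinDegGe S G i

/-- The plane graphs on `S` with at most `m` edges and no vertex of degree
smaller than `i`. -/
def planeGraphsLEDeg (S : Finset Pt) (m : ℝ) (i : ℕ) : Finset (Finset (Sym2 Pt)) :=
  (planeGraphs S).filter fun G => (G.card : ℝ) ≤ m ∧ MinDegGe S G i

/-- `ĥv_{x,m}(S,i)`: the average of `v_x(G)` over a uniformly random plane graph
on `S` with at most `m` edges and no vertex of degree smaller than `i`. -/
def hvxLEDeg (S : Finset Pt) (m : ℝ) (i : ℕ) : ℝ :=
  (∑ G ∈ planeGraphsLEDeg S m i, (vx S G : ℝ)) / (planeGraphsLEDeg S m i).card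

/-- `pg(N, i)`: the maximum, over sets `S` of `N` points in general position, of
the number of plane graphs on `S` with no vertex of degree smaller than `i`. -/
def pgMaxDeg (N i : ℕ) : ℕ :=
  sSup {n : ℕ | ∃ S : Finset Pt, S.card = N ∧ GenPos S ∧ (planeGraphsDeg S i).card = n}

/-- The underlying abstract graph of `G` on the vertex set `S`. -/
def abstractGraph (S : Finset Pt) (G : Finset (Sym2 Pt)) :
    SimpleGraph (S : Set Pt) :=
  SimpleGraph.induce (S : Set Pt) (SimpleGraph.fromEdgeSet (G : Set (Sym2 Pt)))

/-- The connected plane graphs on `S`. -/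
def connPlaneGraphs (S : Finset Pt) : Finset (Finset (Sym2 Pt)) :=
  (planeGraphs S).filter fun G => (abstractGraph S G).Connected

/-- The underlying abstract graph of `G` is bi-connected (2-vertex-connected):
it is connected and remains connected after deletion of any single vertex. -/
def Biconnected (S : Finset Pt) (G : Finset (Sym2 Pt)) : Prop :=
  (abstractGraph S G).Connected ∧
    ∀ v ∈ S, (SimpleGraph.induce ((S : Set Pt) \ {v})
      (SimpleGraph.fromEdgeSet (G : Set (Sym2 Pt)))).Connected

/-- The bi-connected plane graphs on `S`. -/
def biconnPlaneGraphs (S : Finset Pt) : Finset (Finset (Sym2 Pt)) :=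
  (planeGraphs S).filter (Biconnected S)

/-- `G` is a `k`-quasi-plane graph on `S`: a straight-edge graph on `S`
(crossings allowed) with no `k` pairwise crossing edges. -/
def IsQuasiPlane (k : ℕ) (S : Finset Pt) (G : Finset (Sym2 Pt)) : Prop :=
  (∀ e ∈ G, ¬ e.IsDiag ∧ ∀ p ∈ e, p ∈ S) ∧
    ¬ ∃ T ⊆ G, T.card = k ∧ ∀ e ∈ T, ∀ f ∈ T, e ≠ f → EdgesCross e f

/-- The (finite) collection of all `k`-quasi-plane graphs on `S`. -/
def qpGraphs (k : ℕ) (S : Finset Pt) : Finset (Finset (Sym2 Pt)) :=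
  S.sym2.powerset.filter (IsQuasiPlane k S)

/-- The ving `(p, G)` is an x-ving of the `k`-quasi-plane graph `G`: no straight
edge from `p` to another point of `S` can be added to `G` without violating
`k`-quasi-planarity. -/
def IsXVingQP (k : ℕ) (S : Finset Pt) (G : Finset (Sym2 Pt)) (p : Pt) : Prop :=
  ∀ q ∈ S, q ≠ p → s(p, q) ∉ G → ¬ IsQuasiPlane k S (insert s(p, q) G)

/-- `v_x(G)` for a `k`-quasi-plane graph `G`. -/
def vxQP (k : ℕ) (S : Finset Pt) (G : Finset (Sym2 Pt)) : ℕ :=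
  (S.filter (IsXVingQP k S G)).card

/-- `ĥv_x^k(S)`: the average of `v_x(G)` over a uniformly random `k`-quasi-plane
graph on `S`. -/
def hvxQP (k : ℕ) (S : Finset Pt) : ℝ :=
  (∑ G ∈ qpGraphs k S, (vxQP k S G : ℝ)) / (qpGraphs k S).card

/-- `qp_k(N)`: the maximum number of `k`-quasi-plane graphs over all sets of `N`
points in general position. -/
def qpMax (k N : ℕ) : ℕ :=
  sSup {n : ℕ | ∃ S : Finset Pt, S.card = N ∧ GenPos S ∧ (qpGraphs k S).card = n}

theorem collinear_of_openSegment_inter {p q r : Pt} (hqp : q ≠ p)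
    (h : (openSegment ℝ p q ∩ openSegment ℝ p r).Nonempty) :
    Collinear ℝ ({p, q, r} : Set Pt) := by
  obtain ⟨x, ⟨a, b, ha, hb, hab, hx⟩, ⟨c, d, hc, hd, hcd, hx'⟩⟩ := h
  rw [collinear_iff_of_mem (p₀ := p) (by simp)]
  refine ⟨q - p, ?_⟩
  have hr : r = (b / d) • (q - p) + p := by
    have ha' : a = 1 - b := by linarith
    have hc' : c = 1 - d := by linarith
    have h1 : d • (r - p) = b • (q - p) := by
      have : a • p + b • q = c • p + d • r := hx.trans hx'.symm
      rw [ha', hc'] at this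
      have h2 : b • (q - p) - d • (r - p)
          = ((1 - b) • p + b • q) - ((1 - d) • p + d • r) := by module
      rw [this, sub_self] at h2
      exact (sub_eq_zero.mp h2).symm
    have h3 : r - p = (b / d) • (q - p) := by
      rw [div_eq_inv_mul, mul_smul, ← h1, smul_smul, inv_mul_cancel₀ hd.ne', one_smul]
    rw [← h3]; abel
  intro y hy
  simp only [Set.mem_insert_iff, Set.mem_singleton_iff] at hy
  rcases hy with rfl | rfl | rfl
  · exact ⟨0, by simp⟩
  · exact ⟨1, by simp⟩
  · exact ⟨b / d, by simpa using hr⟩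

theorem not_edgesCross_of_common {S : Finset Pt} (hS : GenPos S) {p q r : Pt}
    (hp : p ∈ S) (hq : q ∈ S) (hr : r ∈ S) (hqp : q ≠ p) (hrp : r ≠ p) (hqr : q ≠ r) :
    ¬ EdgesCross s(p, q) s(p, r) := by
  rintro ⟨a, b, c, d, h1, h2, h⟩
  apply hS p hp q hq r hr hqp.symm hrp.symm hqr
  apply collinear_of_openSegment_inter hqp
  have e1 : openSegment ℝ a b = openSegment ℝ p q := by
    rcases Sym2.eq_iff.mp h1 with ⟨rfl, rfl⟩ | ⟨rfl, rfl⟩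
    · rfl
    · exact openSegment_symm ℝ _ _
  have e2 : openSegment ℝ c d = openSegment ℝ p r := by
    rcases Sym2.eq_iff.mp h2 with ⟨rfl, rfl⟩ | ⟨rfl, rfl⟩
    · rfl
    · exact openSegment_symm ℝ _ _
  rwa [e1, e2] at h

theorem mem_qpGraphs {k : ℕ} {S : Finset Pt} {G : Finset (Sym2 Pt)} :
    G ∈ qpGraphs k S ↔ IsQuasiPlane k S G := by
  simp only [qpGraphs, Finset.mem_filter, Finset.mem_powerset, and_iff_right_iff_imp]
  intro h e he
  exact Finset.mem_sym2_iff.mpr (h.1 e he).2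

theorem IsQuasiPlane.mono {k : ℕ} {S : Finset Pt} {G H : Finset (Sym2 Pt)}
    (hG : IsQuasiPlane k S G) (h : H ⊆ G) : IsQuasiPlane k S H :=
  ⟨fun e he => hG.1 e (h he), fun ⟨T, hT, hc⟩ => hG.2 ⟨T, hT.trans h, hc⟩⟩

/-- The graphs on `S` in which `p` is isolated are the graphs on `S.erase p`. -/
theorem qpGraphs_erase (k : ℕ) (S : Finset Pt) (p : Pt) :
    qpGraphs k (S.erase p) = (qpGraphs k S).filter fun G => ∀ e ∈ G, p ∉ e := by
  ext G
  simp only [mem_qpGraphs, Finset.mem_filter, IsQuasiPlane, Finset.mem_erase]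
  constructor
  · rintro ⟨h1, h2⟩
    exact ⟨⟨fun e he => ⟨(h1 e he).1, fun q hq => ((h1 e he).2 q hq).2⟩, h2⟩,
      fun e he hpe => ((h1 e he).2 p hpe).1 rfl⟩
  · rintro ⟨⟨h1, h2⟩, h3⟩
    exact ⟨fun e he => ⟨(h1 e he).1, fun q hq =>
      ⟨fun h => h3 e he (h ▸ hq), (h1 e he).2 q hq⟩⟩, h2⟩

/-- The points that can be joined to `p` in the graph `H`. -/
def joinable (k : ℕ) (S : Finset Pt) (p : Pt) (H : Finset (Sym2 Pt)) : Finset Pt :=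
  S.filter fun q => IsQuasiPlane k S (insert s(p, q) H)

theorem joinable_ne {k : ℕ} {S : Finset Pt} {p q : Pt} {H : Finset (Sym2 Pt)}
    (hq : q ∈ joinable k S p H) : q ≠ p ∧ q ∈ S := by
  simp only [joinable, Finset.mem_filter] at hq
  refine ⟨fun h => ?_, hq.1⟩
  exact (hq.2.1 _ (Finset.mem_insert_self _ _)).1 (by simp [h])

/-- Edges at a common vertex never obstruct each other. -/
theorem isQuasiPlane_union_star {k : ℕ} {S : Finset Pt} (hS : GenPos S) {p : Pt} (hp : p ∈ S)
    {H : Finset (Sym2 Pt)} (hH : IsQuasiPlane k S H) {B : Finset Pt}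
    (hB : B ⊆ joinable k S p H) :
    IsQuasiPlane k S (H ∪ B.image fun q => s(p, q)) := by
  have hB' : ∀ q ∈ B, IsQuasiPlane k S (insert s(p, q) H) := fun q hq =>
    (Finset.mem_filter.mp (hB hq)).2
  refine ⟨fun e he => ?_, ?_⟩
  · rcases Finset.mem_union.mp he with he | he
    · exact hH.1 e he
    · obtain ⟨q, hq, rfl⟩ := Finset.mem_image.mp he
      exact (hB' q hq).1 _ (Finset.mem_insert_self _ _)
  · rintro ⟨T, hT, hc, hcr⟩
    by_cases h : ∃ q ∈ B, s(p, q) ∈ T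
    · obtain ⟨q, hq, hqT⟩ := h
      refine (hB' q hq).2 ⟨T, fun e he => ?_, hc, hcr⟩
      rcases Finset.mem_union.mp (hT he) with h | h
      · exact Finset.mem_insert_of_mem h
      · obtain ⟨r, hr, rfl⟩ := Finset.mem_image.mp h
        by_cases hqr : q = r
        · subst hqr; exact Finset.mem_insert_self _ _
        · have hq' := joinable_ne (hB hq)
          have hr' := joinable_ne (hB hr)
          refine absurd (hcr _ hqT _ he fun h => hqr ?_)
            (not_edgesCross_of_common hS hp hq'.2 hr'.2 hq'.1 hr'.1 hqr)
          exact Sym2.congr_right.mp h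
    · push Not at h
      refine hH.2 ⟨T, fun e he => ?_, hc, hcr⟩
      rcases Finset.mem_union.mp (hT he) with h' | h'
      · exact h'
      · obtain ⟨r, hr, rfl⟩ := Finset.mem_image.mp h'
        exact absurd he (h r hr)

theorem filter_union_star {p : Pt} {H : Finset (Sym2 Pt)} (hH : ∀ e ∈ H, p ∉ e)
    (B : Finset Pt) : (H ∪ B.image fun q => s(p, q)).filter (fun e => p ∉ e) = H := by
  ext e
  simp only [Finset.mem_filter, Finset.mem_union, Finset.mem_image]
  constructor
  · rintro ⟨h | ⟨q, -, rfl⟩, h'⟩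
    · exact h
    · simp at h'
  · exact fun h => ⟨Or.inl h, hH e h⟩

theorem filter_mem_union_star {p : Pt} {H : Finset (Sym2 Pt)} (hH : ∀ e ∈ H, p ∉ e)
    (B : Finset Pt) :
    (H ∪ B.image fun q => s(p, q)).filter (fun e => p ∈ e) = B.image fun q => s(p, q) := by
  ext e
  simp only [Finset.mem_filter, Finset.mem_union, Finset.mem_image]
  constructor
  · rintro ⟨h | h, h'⟩
    · exact absurd h' (hH e h)
    · exact h
  · rintro ⟨q, hq, rfl⟩
    exact ⟨Or.inr ⟨q, hq, rfl⟩, by simp⟩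

theorem sym2_mk_left_injective (p : Pt) : Function.Injective fun q : Pt => s(p, q) :=
  fun _ _ h => Sym2.congr_right.mp h

/-- Removing all edges at `p` from `G` leaves `H` exactly when `G` arises from `H` by joining `p`
to some set of joinable points. -/
theorem fiber_eq_image {k : ℕ} {S : Finset Pt} (hS : GenPos S) {p : Pt} (hp : p ∈ S)
    {H : Finset (Sym2 Pt)} (hH : H ∈ qpGraphs k (S.erase p)) :
    (qpGraphs k S).filter (fun G => G.filter (fun e => p ∉ e) = H)
      = (joinable k S p H).powerset.image fun B => H ∪ B.image fun q => s(p, q) := by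
  rw [qpGraphs_erase, Finset.mem_filter, mem_qpGraphs] at hH
  ext G
  simp only [Finset.mem_filter, Finset.mem_image, Finset.mem_powerset, mem_qpGraphs]
  constructor
  · rintro ⟨hG, hGH⟩
    refine ⟨S.filter fun q => s(p, q) ∈ G, fun q hq => ?_, ?_⟩
    · rw [Finset.mem_filter] at hq
      refine Finset.mem_filter.mpr ⟨hq.1, hG.mono ?_⟩
      rw [Finset.insert_subset_iff, ← hGH]
      exact ⟨hq.2, Finset.filter_subset _ _⟩
    · ext e
      simp only [← hGH, Finset.mem_union, Finset.mem_filter, Finset.mem_image]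
      constructor
      · rintro (h | ⟨q, hq, rfl⟩)
        · exact h.1
        · exact hq.2
      · intro he
        by_cases hpe : p ∈ e
        · obtain ⟨q, rfl⟩ := hpe
          exact Or.inr ⟨q, ⟨(hG.1 _ he).2 q (by simp), he⟩, rfl⟩
        · exact Or.inl ⟨he, hpe⟩
  · rintro ⟨B, hB, rfl⟩
    exact ⟨isQuasiPlane_union_star hS hp hH.1 hB, filter_union_star hH.2 B⟩

theorem union_star_injOn {p : Pt} {H : Finset (Sym2 Pt)} (hH : ∀ e ∈ H, p ∉ e) :
    Function.Injective fun B : Finset Pt => H ∪ B.image fun q => s(p, q) := by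
  intro B C h
  have := congrArg (fun G : Finset (Sym2 Pt) => G.filter (fun e => p ∈ e)) h
  simp only [filter_mem_union_star hH] at this
  exact Finset.image_injective (sym2_mk_left_injective p) this

theorem two_mul_sum_card_powerset {α : Type*} [DecidableEq α] (A : Finset α) :
    2 * ∑ B ∈ A.powerset, B.card = A.card * 2 ^ A.card := by
  induction A using Finset.induction_on with
  | empty => simp
  | insert a A ha ih =>
    rw [Finset.sum_powerset_insert ha, Finset.card_insert_of_notMem ha]
    have h : ∑ B ∈ A.powerset, (insert a B).card = ∑ B ∈ A.powerset, (B.card + 1) :=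
      Finset.sum_congr rfl fun B hB =>
        Finset.card_insert_of_notMem fun h => ha (Finset.mem_powerset.mp hB h)
    rw [h, Finset.sum_add_distrib]
    simp only [Finset.sum_const, Finset.card_powerset, smul_eq_mul, mul_one]
    rw [pow_succ]
    nlinarith [ih]

theorem maps_to_erase {k : ℕ} {S : Finset Pt} {p : Pt} {G : Finset (Sym2 Pt)}
    (hG : G ∈ qpGraphs k S) : G.filter (fun e => p ∉ e) ∈ qpGraphs k (S.erase p) := by
  rw [qpGraphs_erase, Finset.mem_filter, mem_qpGraphs]
  rw [mem_qpGraphs] at hG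
  exact ⟨hG.mono (Finset.filter_subset _ _), fun e he => (Finset.mem_filter.mp he).2⟩

theorem card_qpGraphs_eq_sum {k : ℕ} {S : Finset Pt} (hS : GenPos S) {p : Pt} (hp : p ∈ S) :
    (qpGraphs k S).card = ∑ H ∈ qpGraphs k (S.erase p), 2 ^ (joinable k S p H).card := by
  rw [Finset.card_eq_sum_card_fiberwise
    (f := fun G : Finset (Sym2 Pt) => G.filter (fun e => p ∉ e)) (t := qpGraphs k (S.erase p))
    (fun G hG => maps_to_erase hG)]
  refine Finset.sum_congr rfl fun H hH => ?_
  have hH' := (Finset.mem_filter.mp (qpGraphs_erase k S p ▸ hH)).2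
  rw [fiber_eq_image hS hp hH, Finset.card_image_of_injective _ (union_star_injOn hH'),
    Finset.card_powerset]

theorem two_mul_sum_vingDeg {k : ℕ} {S : Finset Pt} (hS : GenPos S) {p : Pt} (hp : p ∈ S) :
    2 * ∑ G ∈ qpGraphs k S, vingDeg G p
      = ∑ H ∈ qpGraphs k (S.erase p),
          (joinable k S p H).card * 2 ^ (joinable k S p H).card := by
  rw [← Finset.sum_fiberwise_of_maps_to
    (g := fun G : Finset (Sym2 Pt) => G.filter (fun e => p ∉ e)) (t := qpGraphs k (S.erase p))
    (fun G hG => maps_to_erase hG), Finset.mul_sum]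
  refine Finset.sum_congr rfl fun H hH => ?_
  have hH' := (Finset.mem_filter.mp (qpGraphs_erase k S p ▸ hH)).2
  rw [fiber_eq_image hS hp hH,
    Finset.sum_image fun _ _ _ _ h => union_star_injOn hH' h, ← two_mul_sum_card_powerset]
  congr 1
  refine Finset.sum_congr rfl fun B _ => ?_
  rw [vingDeg, filter_mem_union_star hH',
    Finset.card_image_of_injective _ (sym2_mk_left_injective p)]

theorem sum_vingDeg {k : ℕ} {S : Finset Pt} {G : Finset (Sym2 Pt)} (hG : IsQuasiPlane k S G) :
    ∑ p ∈ S, vingDeg G p = 2 * G.card := by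
  simp only [vingDeg, Finset.card_filter]
  rw [Finset.sum_comm, mul_comm, Finset.card_eq_sum_ones, Finset.sum_mul]
  refine Finset.sum_congr rfl fun e he => ?_
  rw [← Finset.card_filter, one_mul]
  obtain ⟨h1, h2⟩ := hG.1 e he
  induction e using Sym2.ind with
  | _ a b =>
    have : S.filter (fun p => p ∈ s(a, b)) = {a, b} := by
      ext x
      simp only [Finset.mem_filter, Sym2.mem_iff, Finset.mem_insert, Finset.mem_singleton,
        and_iff_right_iff_imp]
      rintro (rfl | rfl)
      · exact h2 _ (by simp)
      · exact h2 _ (by simp)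
    rw [this, Finset.card_pair (by simpa using h1)]

theorem sub_mul_two_pow_le (d m : ℕ) : ((d : ℤ) + 1 - m) * 2 ^ m ≤ 2 ^ d := by
  rcases le_or_gt m d with h | h
  · obtain ⟨t, rfl⟩ := Nat.exists_eq_add_of_le h
    have : (t : ℤ) + 1 ≤ 2 ^ t := by exact_mod_cast Nat.lt_two_pow_self
    rw [pow_add, mul_comm]
    refine mul_le_mul_of_nonneg_left ?_ (by positivity)
    push_cast; linarith
  · refine le_trans (mul_nonpos_of_nonpos_of_nonneg ?_ (by positivity)) (by positivity)
    have : (d : ℤ) + 1 ≤ m := by exact_mod_cast h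
    linarith

/-- A linear edge bound makes some point isolated in a constant fraction of all graphs. -/
theorem exists_card_le_two_pow_mul_erase {k c : ℕ} {S : Finset Pt} (hS : GenPos S)
    (hne : S.Nonempty) (hE : ∀ G ∈ qpGraphs k S, G.card ≤ c * S.card) :
    ∃ p ∈ S, (qpGraphs k S).card ≤ 2 ^ (4 * c) * (qpGraphs k (S.erase p)).card := by
  obtain ⟨p, hp, hle⟩ : ∃ p ∈ S, ∑ G ∈ qpGraphs k S, vingDeg G p ≤ 2 * c * (qpGraphs k S).card := by
    refine Finset.exists_le_of_sum_le hne ?_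
    rw [Finset.sum_comm, Finset.sum_const, smul_eq_mul]
    calc ∑ G ∈ qpGraphs k S, ∑ p ∈ S, vingDeg G p
        ≤ ∑ G ∈ qpGraphs k S, 2 * (c * S.card) := by
          refine Finset.sum_le_sum fun G hG => ?_
          rw [sum_vingDeg (mem_qpGraphs.mp hG)]
          exact Nat.mul_le_mul_left 2 (hE G hG)
      _ = S.card * (2 * c * (qpGraphs k S).card) := by
          rw [Finset.sum_const, smul_eq_mul]; ring
  refine ⟨p, hp, ?_⟩
  have h1 := card_qpGraphs_eq_sum (k := k) hS hp
  have h2 := two_mul_sum_vingDeg (k := k) hS hp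
  have h3 : ∑ H ∈ qpGraphs k (S.erase p),
      (((4 * c : ℕ) : ℤ) + 1 - (joinable k S p H).card) * 2 ^ (joinable k S p H).card
      ≤ ∑ H ∈ qpGraphs k (S.erase p), (2 : ℤ) ^ (4 * c) :=
    Finset.sum_le_sum fun H _ => sub_mul_two_pow_le _ _
  simp only [sub_mul, Finset.sum_sub_distrib, ← Finset.mul_sum, Finset.sum_const,
    nsmul_eq_mul] at h3
  zify at h1 h2 hle ⊢
  rw [← h1, ← h2] at h3
  push_cast at h3
  linarith

theorem card_qpGraphs_le_of_edge_bound {k c : ℕ}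
    (hE : ∀ S : Finset Pt, GenPos S → ∀ G ∈ qpGraphs k S, G.card ≤ c * S.card)
    (N : ℕ) (S : Finset Pt) (hN : S.card = N) (hS : GenPos S) :
    (qpGraphs k S).card ≤ 2 ^ (4 * c * N) := by
  induction N generalizing S with
  | zero =>
    rw [Finset.card_eq_zero] at hN
    subst hN
    calc (qpGraphs k ∅).card ≤ ((∅ : Finset Pt).sym2.powerset).card :=
          Finset.card_le_card (Finset.filter_subset _ _)
      _ = 2 ^ (4 * c * 0) := by simp
  | succ N ih =>
    have hne : S.Nonempty := Finset.card_pos.mp (by omega)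
    obtain ⟨p, hp, hle⟩ := exists_card_le_two_pow_mul_erase hS hne (hE S hS)
    have := ih (S.erase p) (by rw [Finset.card_erase_of_mem hp, hN]; rfl)
      fun a ha b hb d hd => hS a (Finset.mem_of_mem_erase ha) b (Finset.mem_of_mem_erase hb) d
        (Finset.mem_of_mem_erase hd)
    calc (qpGraphs k S).card ≤ 2 ^ (4 * c) * (qpGraphs k (S.erase p)).card := hle
      _ ≤ 2 ^ (4 * c) * 2 ^ (4 * c * N) := Nat.mul_le_mul_left _ this
      _ = 2 ^ (4 * c * (N + 1)) := by rw [← pow_add]; ring_nf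

/-- The planarisation of a drawing, as a rotation system: `f` sends a dart to the next dart of the
face on its left, `b` is the inverse of `f`, `r` reverses a dart, `e` is the oriented edge
containing the dart, `cr` is the crossing relation and `isX d` says that the head of `d` is a
crossing. No four edges cross pairwise. -/
structure CrossMap (D V : Type*) where
  f : D → D
  b : D → D
  r : D → D
  e : D → V × V
  cr : V × V → V × V → Prop
  isX : D → Prop
  rank : D → ℕ
  fb : ∀ x, f (b x) = x
  bf : ∀ x, b (f x) = x
  rr : ∀ x, r (r x) = x
  e_r : ∀ x, e (r x) = (e x).swap
  e_ne : ∀ x, (e x).1 ≠ (e x).2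
  cr_symm : ∀ a c, cr a c → cr c a
  cr_swap : ∀ a c, cr a c → cr a c.swap
  clique_free : ∀ a c u v, cr a c → cr a u → cr a v → cr c u → cr c v → cr u v → False
  isX_rf : ∀ x, isX (r (f x)) ↔ isX x
  cr_f : ∀ x, isX x → cr (e x) (e (f x))
  e_straight : ∀ x, isX x → e (f (r (f x))) = e x
  rf_four : ∀ x, isX x → r (f (r (f (r (f (r (f x))))))) = x
  not_cr_f : ∀ x, ¬ isX x → ¬ cr (e x) (e (f x))
  snd_eq_fst : ∀ x, ¬ isX x → (e (f x)).1 = (e x).2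
  ne_swap : ∀ x, ¬ isX x → e (f x) ≠ (e x).swap
  eq_of_edges : ∀ x y, isX x → isX y → e x = e y →
    (e (f x) = e (f y) ∨ e (f x) = (e (f y)).swap) → x = y
  rank_lt : ∀ x, isX x → rank (f (r (f x))) < rank x

namespace CrossMap

variable {D V : Type*} (M : CrossMap D V)

/-- The dart continuing `x` straight through the crossing at its head. -/
def s (x : D) : D := M.f (M.r (M.f x))

theorem isX_r (y : D) : M.isX (M.r y) ↔ M.isX (M.b y) := by
  simpa [M.fb] using M.isX_rf (M.b y)

theorem e_s {x : D} (h : M.isX x) : M.e (M.s x) = M.e x := M.e_straight x h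

theorem b_s (x : D) : M.b (M.s x) = M.r (M.f x) := M.bf _

theorem f_r_rf {x : D} : M.f (M.r (M.f x)) = M.s x := rfl

theorem isX_r_s {x : D} (h : M.isX x) : M.isX (M.r (M.s x)) := by
  rw [s, M.isX_rf, M.isX_rf]; exact h

theorem s_r_s {x : D} (h : M.isX x) : M.s (M.r (M.s x)) = M.r x := by
  have := congrArg M.r (M.rf_four x h)
  rw [M.rr] at this
  exact this

theorem e_f_r_s {x : D} (h : M.isX x) : M.e (M.f (M.r (M.s x))) = (M.e (M.f x)).swap := by
  have := M.e_s ((M.isX_rf x).2 h)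
  rw [M.e_r] at this
  exact this

theorem e_r_b_r {x : D} (h : M.isX x) : M.e (M.b (M.r x)) = M.e (M.f x) := by
  have h4 := M.s_r_s h
  rw [← h4, M.b_s, M.e_r, M.e_f_r_s h, Prod.swap_swap]

theorem r_b_r {x : D} (h : M.isX x) : M.r (M.b (M.r x)) = M.s (M.r (M.f x)) := by
  have h4 := M.s_r_s h
  rw [← h4, M.b_s, M.rr]; rfl

theorem isX_b_r {x : D} : M.isX (M.b (M.r x)) ↔ M.isX x := by
  rw [← M.isX_r, M.rr]

theorem not_cr_self (a : V × V) : ¬ M.cr a a := fun h => M.clique_free a a a a h h h h h h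

theorem cr_b {x : D} (h : M.isX (M.b x)) : M.cr (M.e (M.b x)) (M.e x) := by
  simpa [M.fb] using M.cr_f _ h

/-- The face of `x` is a triangle all of whose corners are crossings. -/
def Tri (x : D) : Prop :=
  M.f (M.f (M.f x)) = x ∧ M.isX x ∧ M.isX (M.f x) ∧ M.isX (M.f (M.f x))

/-- The face of `x` is a quadrilateral all of whose corners are crossings. -/
def Quad (x : D) : Prop :=
  M.f (M.f (M.f (M.f x))) = x ∧
    M.isX x ∧ M.isX (M.f x) ∧ M.isX (M.f (M.f x)) ∧ M.isX (M.f (M.f (M.f x)))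

theorem Tri.next {M : CrossMap D V} {x : D} (h : M.Tri x) : M.Tri (M.f x) := by
  obtain ⟨h0, h1, h2, h3⟩ := h
  exact ⟨by rw [h0], h2, h3, by rwa [h0]⟩

theorem Quad.next {M : CrossMap D V} {x : D} (h : M.Quad x) : M.Quad (M.f x) := by
  obtain ⟨h0, h1, h2, h3, h4⟩ := h
  exact ⟨by rw [h0], h2, h3, h4, by rwa [h0]⟩

theorem Tri.prev {M : CrossMap D V} {x : D} (h : M.Tri (M.f x)) : M.Tri x := by
  have h' := h.next.next
  have : M.f (M.f (M.f x)) = x := by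
    have := congrArg M.b h.1
    simpa [M.bf] using this
  rwa [this] at h'

theorem Quad.prev {M : CrossMap D V} {x : D} (h : M.Quad (M.f x)) : M.Quad x := by
  have h' := h.next.next.next
  have : M.f (M.f (M.f (M.f x))) = x := by
    have := congrArg M.b h.1
    simpa [M.bf] using this
  rwa [this] at h'

theorem Tri.b_eq {M : CrossMap D V} {x : D} (h : M.Tri x) : M.b x = M.f (M.f x) := by
  conv_lhs => rw [← h.1]
  rw [M.bf]

theorem Quad.b_eq {M : CrossMap D V} {x : D} (h : M.Quad x) : M.b x = M.f (M.f (M.f x)) := by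
  conv_lhs => rw [← h.1]
  rw [M.bf]

theorem Quad.not_tri {M : CrossMap D V} {x : D} (h : M.Quad x) : ¬ M.Tri x := fun ht => by
  have h1 : M.f x = x := by
    have := h.1
    rw [ht.1] at this
    exact this
  have := M.cr_f x h.2.1
  rw [h1] at this
  exact M.not_cr_self _ this

/-- The side `x` of its face receives charge from the triangle at the end of the chain of
quadrilaterals starting on the other side of `x`. -/
inductive Paid : D → Prop
  | tri {x : D} : M.Tri (M.r x) → Paid x
  | quad {x : D} : M.Quad (M.r x) → Paid (M.f (M.f (M.r x))) → Paid x

theorem paid_cases {x : D} (h : M.Paid x) :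
    M.Tri (M.r x) ∨ (M.Quad (M.r x) ∧ M.Paid (M.f (M.f (M.r x)))) := by
  cases h with
  | tri h => exact Or.inl h
  | quad h h' => exact Or.inr ⟨h, h'⟩

theorem Paid.isX_b {M : CrossMap D V} {x : D} (h : M.Paid x) : M.isX (M.b x) := by
  rw [← M.isX_r]
  cases h with
  | tri h => exact h.2.1
  | quad h _ => exact h.2.1

theorem Paid.isX {M : CrossMap D V} {x : D} (h : M.Paid x) : M.isX x := by
  rw [← M.isX_b_r]
  cases h with
  | tri h => rw [h.b_eq]; exact h.2.2.2
  | quad h _ => rw [h.b_eq]; exact h.2.2.2.2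

theorem Paid.cr {M : CrossMap D V} {x : D} (h : M.Paid x) :
    M.cr (M.e (M.b x)) (M.e (M.f x)) := by
  induction h with
  | @tri x h =>
    have hb : M.isX (M.b x) := (Paid.tri h).isX_b
    have hx : M.isX x := (Paid.tri h).isX
    have h1 := M.e_r_b_r hx
    have h2 := M.e_s hb
    rw [s, M.fb] at h2
    rw [← h1, ← h2, h.b_eq]
    exact M.cr_f _ h.2.2.1
  | @quad x h h' ih =>
    have hb : M.isX (M.b x) := (Paid.quad h h').isX_b
    have hx : M.isX x := (Paid.quad h h').isX
    have h1 := M.e_r_b_r hx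
    have h2 := M.e_s hb
    rw [s, M.fb] at h2
    rw [M.bf] at ih
    rw [← h1, ← h2, h.b_eq]
    exact ih

/-- Walking along the edge of `w` from the head of `w`, the oriented edge `o` leaves to the left,
and all edges crossed before `o` cross `o`. -/
inductive Reach (o : V × V) : D → Prop
  | base {w : D} : M.isX w → M.e (M.f w) = o → Reach o w
  | step {w : D} : M.isX w → M.cr o (M.e (M.f w)) → Reach o (M.s w) → Reach o w

theorem Reach.unique {M : CrossMap D V} {o o' : V × V} {w : D} (h : M.Reach o w)
    (h' : M.Reach o' w) : o = o' ∨ M.cr o o' := by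
  induction h with
  | base hx he =>
    cases h' with
    | base hx' he' => exact Or.inl (he.symm.trans he')
    | step hx' hc _ => exact Or.inr (M.cr_symm _ _ (he ▸ hc))
  | step hx hc hr ih =>
    cases h' with
    | base hx' he' => exact Or.inr (he' ▸ hc)
    | step hx' hc' hr' => exact ih hr'

theorem Reach.exists_dart {M : CrossMap D V} {o : V × V} {w : D} (h : M.Reach o w) :
    ∃ u, M.isX u ∧ M.e u = M.e w ∧ M.e (M.f u) = o := by
  induction h with
  | @base w hx he => exact ⟨w, hx, rfl, he⟩
  | step hx hc hr ih =>
    obtain ⟨u, h1, h2, h3⟩ := ih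
    exact ⟨u, h1, h2.trans (M.e_s hx), h3⟩

theorem not_reach {d w : D} (hd : M.isX d) (hw : M.e w = M.e (M.f d)) :
    ¬ M.Reach (M.e d) w := fun h => by
  obtain ⟨u, h1, h2, h3⟩ := h.exists_dart
  have hq : M.isX (M.b (M.r d)) := M.isX_b_r.2 hd
  have he : M.e u = M.e (M.b (M.r d)) := by rw [h2, hw, M.e_r_b_r hd]
  have hs : M.e (M.f u) = (M.e (M.f (M.b (M.r d)))).swap := by
    rw [h3, M.fb, M.e_r, Prod.swap_swap]
  have := M.eq_of_edges u _ h1 hq he (Or.inr hs)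
  rw [this, M.fb, M.e_r] at h3
  exact M.e_ne d (congrArg Prod.snd h3)

theorem Paid.reach {M : CrossMap D V} {w : D} (h : M.Paid w) :
    M.Reach (M.e (M.b w)) (M.s (M.r (M.f w))) := by
  induction h with
  | @tri w h =>
    have hp := Paid.tri h
    rw [← M.r_b_r hp.isX, h.b_eq]
    refine .base ((M.isX_rf _).2 h.2.2.1) ?_
    change M.e (M.s _) = _
    rw [M.e_s h.2.2.1]
    have h2 := M.e_s hp.isX_b
    rwa [s, M.fb] at h2
  | @quad w h h' ih =>
    have hp := Paid.quad h h'
    rw [← M.r_b_r hp.isX, h.b_eq]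
    rw [M.bf] at ih
    have h2 := M.e_s hp.isX_b
    rw [s, M.fb] at h2
    rw [h2] at ih
    refine .step ((M.isX_rf _).2 h.2.2.2.1) ?_ ih
    change M.cr _ (M.e (M.s _))
    rw [M.e_s h.2.2.2.1, ← h2]
    exact M.cr_f _ h.2.2.1

theorem Tri.not_paid {M : CrossMap D V} {w : D} (h : M.Tri w) : ¬ M.Paid w := fun hp => by
  have hr := hp.reach
  have hd : M.isX (M.b (M.r (M.f w))) := M.isX_b_r.2 h.2.2.1
  have he : M.e (M.b (M.r (M.f w))) = M.e (M.b w) := by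
    rw [M.e_r_b_r h.2.2.1, h.b_eq]
  rw [← he] at hr
  refine M.not_reach hd ?_ hr
  rw [M.fb, M.e_s ((M.isX_rf _).2 hp.isX)]

end CrossMap

namespace CrossMap

variable {D V : Type*} (M : CrossMap D V)

theorem f_ne (x : D) : M.f x ≠ x := fun h => by
  by_cases hx : M.isX x
  · have := M.cr_f x hx
    rw [h] at this
    exact M.not_cr_self _ this
  · have := M.snd_eq_fst x hx
    rw [h] at this
    exact M.e_ne x this

theorem f_f_ne (x : D) : M.f (M.f x) ≠ x := fun h => by
  by_cases hx : M.isX x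
  · by_cases hy : M.isX (M.f x)
    · have h1 := M.eq_of_edges (M.f x) (M.b (M.r x)) hy (M.isX_b_r.2 hx)
        (M.e_r_b_r hx).symm (Or.inr (by rw [h, M.fb, M.e_r, Prod.swap_swap]))
      have h2 := congrArg M.f h1
      rw [h, M.fb] at h2
      have h3 := M.e_r x
      rw [← h2] at h3
      exact M.e_ne x (congrArg Prod.fst h3)
    · have := M.not_cr_f _ hy
      rw [h] at this
      exact this (M.cr_symm _ _ (M.cr_f x hx))
  · by_cases hy : M.isX (M.f x)
    · have := M.cr_f _ hy
      rw [h] at this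
      exact M.not_cr_f x hx (M.cr_symm _ _ this)
    · have h1 := M.snd_eq_fst x hx
      have h2 := M.snd_eq_fst _ hy
      rw [h] at h2
      exact M.ne_swap x hx (Prod.ext h1 h2.symm)

/-- `M.f` as a permutation of the darts. -/
def perm : Equiv.Perm D := ⟨M.f, M.b, M.bf, M.fb⟩

theorem perm_pow (n : ℕ) (x : D) : (M.perm ^ n) x = M.f^[n] x := by
  rw [Equiv.Perm.coe_pow]; rfl

variable [Fintype D]

/-- The darts of the face containing `x`. -/
def face (x : D) : Finset D := Finset.univ.filter (M.perm.SameCycle x)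

theorem period_pos (x : D) : 0 < Function.minimalPeriod M.f x :=
  Function.minimalPeriod_pos_of_mem_periodicPts
    (Function.Injective.mem_periodicPts M.perm.injective x)

theorem face_eq_image (x : D) : M.face x =
    (Finset.range (Function.minimalPeriod M.f x)).image fun i => M.f^[i] x := by
  ext y
  simp only [face, Finset.mem_filter, Finset.mem_univ, true_and, Finset.mem_image,
    Finset.mem_range]
  constructor
  · intro h
    obtain ⟨n, hn⟩ := h.exists_nat_pow_eq
    rw [M.perm_pow] at hn
    exact ⟨n % Function.minimalPeriod M.f x, Nat.mod_lt _ (M.period_pos x),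
      by rw [Function.iterate_mod_minimalPeriod_eq, hn]⟩
  · rintro ⟨n, -, rfl⟩
    exact ⟨n, by rw [zpow_natCast, M.perm_pow]⟩

theorem sum_face {R : Type*} [AddCommMonoid R] (x : D) (g : D → R) :
    ∑ y ∈ M.face x, g y = ∑ i ∈ Finset.range (M.face x).card, g (M.f^[i] x) := by
  have hinj : Set.InjOn (fun i => M.f^[i] x)
      (Finset.range (Function.minimalPeriod M.f x) : Set ℕ) := by
    intro i hi j hj h
    rw [Finset.coe_range] at hi hj
    exact Function.iterate_injOn_Iio_minimalPeriod hi hj h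
  have hcard : (M.face x).card = Function.minimalPeriod M.f x := by
    rw [face_eq_image, Finset.card_image_of_injOn hinj, Finset.card_range]
  rw [hcard, face_eq_image, Finset.sum_image hinj]

theorem iterate_card_face (x : D) : M.f^[(M.face x).card] x = x := by
  have hinj : Set.InjOn (fun i => M.f^[i] x)
      (Finset.range (Function.minimalPeriod M.f x) : Set ℕ) := by
    intro i hi j hj h
    rw [Finset.coe_range] at hi hj
    exact Function.iterate_injOn_Iio_minimalPeriod hi hj h
  rw [face_eq_image, Finset.card_image_of_injOn hinj, Finset.card_range]
  exact Function.iterate_minimalPeriod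

theorem mem_face_self (x : D) : x ∈ M.face x := by
  simp only [face, Finset.mem_filter, Finset.mem_univ, true_and]
  exact Equiv.Perm.SameCycle.refl _ _

theorem mem_face_f {x y : D} : M.f y ∈ M.face x ↔ y ∈ M.face x := by
  simp only [face, Finset.mem_filter, Finset.mem_univ, true_and]
  exact Equiv.Perm.sameCycle_apply_right

theorem mem_face_b {x y : D} : M.b y ∈ M.face x ↔ y ∈ M.face x := by
  rw [← M.mem_face_f, M.fb]

theorem face_eq_of_mem {x y : D} (h : y ∈ M.face x) : M.face y = M.face x := by
  simp only [face, Finset.mem_filter, Finset.mem_univ, true_and] at h ⊢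
  ext z
  simp only [Finset.mem_filter, Finset.mem_univ, true_and]
  exact ⟨fun h' => h.trans h', fun h' => h.symm.trans h'⟩

theorem three_le_card_face (x : D) : 3 ≤ (M.face x).card := by
  have h := M.iterate_card_face x
  have h0 : 0 < (M.face x).card := Finset.card_pos.2 ⟨x, M.mem_face_self x⟩
  by_contra! hlt
  interval_cases (M.face x).card
  · exact M.f_ne x h
  · exact M.f_f_ne x h

/-- The number of corners of the face of `x` that are vertices of the drawing. -/
def corners (x : D) : ℕ := ((M.face x).filter fun y => ¬ M.isX y).card

/-- The number of paid sides of the face of `x`. -/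
def paidSides (x : D) : ℕ := ((M.face x).filter M.Paid).card

/-- The face of `x` keeps positive charge. -/
def Pos (x : D) : Prop := 72 + 6 * M.paidSides x < 18 * (M.face x).card + 18 * M.corners x

theorem corners_add_paidSides (x : D) : M.corners x + M.paidSides x ≤ (M.face x).card := by
  rw [corners, paidSides, ← Finset.card_union_of_disjoint]
  · exact Finset.card_le_card (Finset.union_subset (Finset.filter_subset _ _)
      (Finset.filter_subset _ _))
  · exact Finset.disjoint_filter.2 fun y _ h h' => h h'.isX

theorem isX_of_corners {x y : D} (h : M.corners x = 0) (hy : y ∈ M.face x) : M.isX y := by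
  by_contra hc
  rw [corners, Finset.card_eq_zero] at h
  exact absurd (Finset.mem_filter.2 ⟨hy, hc⟩) (h ▸ Finset.notMem_empty y)

theorem corners_eq (x : D) : M.corners x =
    ∑ i ∈ Finset.range (M.face x).card, if M.isX (M.f^[i] x) then 0 else 1 := by
  rw [corners, Finset.card_filter, M.sum_face]
  simp only [ite_not]

theorem paidSides_eq (x : D) : M.paidSides x =
    ∑ i ∈ Finset.range (M.face x).card, if M.Paid (M.f^[i] x) then 1 else 0 := by
  rw [paidSides, Finset.card_filter, M.sum_face]

theorem paidSides_le_two {x : D} (hk : (M.face x).card = 4) (hv : M.corners x = 1) :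
    M.paidSides x ≤ 2 := by
  have h := M.iterate_card_face x
  rw [corners_eq] at hv
  rw [paidSides_eq]
  have hp : ∀ y, M.Paid y → M.isX y := fun y hy => hy.isX
  have hq : ∀ y, M.Paid (M.f y) → M.isX y := fun y hy => by simpa [M.bf] using hy.isX_b
  rw [hk] at hv h ⊢
  simp only [Finset.sum_range_succ, Finset.sum_range_zero, Function.iterate_succ,
    Function.iterate_zero, Function.comp, id] at hv h ⊢
  have h0 := hp x
  have h1 := hp (M.f x)
  have h2 := hp (M.f (M.f x))
  have h3 := hp (M.f (M.f (M.f x)))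
  have g0 := hq x
  have g1 := hq (M.f x)
  have g2 := hq (M.f (M.f x))
  have g3 := hq (M.f (M.f (M.f x)))
  rw [h] at g3
  clear hp hq
  clear h
  have hone : ∀ P Q : Prop, (if P then 1 else 0) + (if Q then 1 else 0) ≤ 2 := fun P Q => by
    by_cases P <;> by_cases Q <;> simp_all
  by_cases a0 : M.isX x <;> by_cases a1 : M.isX (M.f x) <;> by_cases a2 : M.isX (M.f (M.f x)) <;>
    by_cases a3 : M.isX (M.f (M.f (M.f x))) <;>
    simp_all <;> exact hone _ _

/-- The sides `x`, `f x`, `f (f x)` are paid. -/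
def Paid3 (x : D) : Prop := M.Paid x ∧ M.Paid (M.f x) ∧ M.Paid (M.f (M.f x))

/-- The face of `x` is a pentagon of crossings with three consecutive paid sides. -/
def Pent (x : D) : Prop :=
  M.f (M.f (M.f (M.f (M.f x)))) = x ∧ (∀ y ∈ M.face x, M.isX y) ∧
  (M.Paid3 x ∨ M.Paid3 (M.f x) ∨ M.Paid3 (M.f (M.f x)) ∨ M.Paid3 (M.f (M.f (M.f x))) ∨
    M.Paid3 (M.f (M.f (M.f (M.f x)))))

/-- The face of `x` is a hexagon of crossings with all sides paid. -/
def Hex (x : D) : Prop :=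
  M.f (M.f (M.f (M.f (M.f (M.f x))))) = x ∧ ∀ y ∈ M.face x, M.Paid y

/-- The face of `x` is a triangle with exactly one corner a vertex. -/
def Tri1 (x : D) : Prop :=
  M.f (M.f (M.f x)) = x ∧ M.corners x = 1

theorem pent_clique {x : D} (h : M.f (M.f (M.f (M.f (M.f x)))) = x)
    (hX : ∀ y ∈ M.face x, M.isX y) (h0 : M.Paid x) (h2 : M.Paid (M.f (M.f x)))
    (h3 : M.Paid (M.f (M.f (M.f x)))) : False := by
  have hx := M.mem_face_self x
  have hb : M.b x = M.f (M.f (M.f (M.f x))) := by conv_lhs => rw [← h, M.bf]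
  have c0 := h0.cr
  rw [hb] at c0
  have c2 := h2.cr
  have c3 := h3.cr
  rw [M.bf] at c2 c3
  refine M.clique_free (M.e (M.f x)) (M.e (M.f (M.f x))) (M.e (M.f (M.f (M.f x))))
    (M.e (M.f (M.f (M.f (M.f x))))) (M.cr_f _ (hX _ ?_)) c2 (M.cr_symm _ _ c0)
    (M.cr_f _ (hX _ ?_)) c3 (M.cr_f _ (hX _ ?_)) <;> simpa [M.mem_face_f] using hx

theorem pent_paid {x : D} (hk : (M.face x).card = 5) (hX : ∀ y ∈ M.face x, M.isX y) :
    M.paidSides x ≤ 3 ∧ (M.paidSides x = 3 → M.Pent x) := by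
  have h := M.iterate_card_face x
  rw [paidSides_eq]
  rw [hk] at h ⊢
  simp only [Finset.sum_range_succ, Finset.sum_range_zero, Function.iterate_succ,
    Function.iterate_zero, Function.comp, id] at h ⊢
  have key : ∀ y ∈ M.face x, M.f (M.f (M.f (M.f (M.f y)))) = y →
      M.Paid y → M.Paid (M.f (M.f y)) → M.Paid (M.f (M.f (M.f y))) → False := by
    intro y hy h5
    exact M.pent_clique h5 (by rw [M.face_eq_of_mem hy]; exact hX)
  have h0 := M.mem_face_self x
  have h1 := M.mem_face_f.2 h0
  have h2 := M.mem_face_f.2 h1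
  have h3 := M.mem_face_f.2 h2
  have h4 := M.mem_face_f.2 h3
  have k0 := key _ h0
  have k1 := key _ h1
  have k2 := key _ h2
  have k3 := key _ h3
  have k4 := key _ h4
  unfold Pent Paid3
  simp only [h] at k0 k1 k2 k3 k4 ⊢
  simp only [forall_const] at k0 k1 k2 k3 k4
  clear key h0 h1 h2 h3 h4
  clear hk
  by_cases a0 : M.Paid x <;> by_cases a1 : M.Paid (M.f x) <;> by_cases a2 : M.Paid (M.f (M.f x)) <;>
    by_cases a3 : M.Paid (M.f (M.f (M.f x))) <;> by_cases a4 : M.Paid (M.f (M.f (M.f (M.f x)))) <;>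
    simp_all

theorem Tri.of_card {M : CrossMap D V} {x : D} (hk : (M.face x).card = 3)
    (hv : M.corners x = 0) : M.Tri x := by
  have h := M.iterate_card_face x
  rw [hk] at h
  refine ⟨h, ?_, ?_, ?_⟩ <;> apply M.isX_of_corners hv <;> simp [M.mem_face_f, M.mem_face_self]

theorem Quad.of_card {M : CrossMap D V} {x : D} (hk : (M.face x).card = 4)
    (hv : M.corners x = 0) : M.Quad x := by
  have h := M.iterate_card_face x
  rw [hk] at h
  refine ⟨h, ?_, ?_, ?_, ?_⟩ <;> apply M.isX_of_corners hv <;>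
    simp [M.mem_face_f, M.mem_face_self]

theorem cases_of_not_pos {x : D} (h : ¬ M.Pos x) :
    M.Tri x ∨ M.Quad x ∨ M.Tri1 x ∨ M.Pent x ∨ M.Hex x := by
  rw [Pos, not_lt] at h
  have h1 := M.corners_add_paidSides x
  have h2 := M.three_le_card_face x
  have hit := M.iterate_card_face x
  have h3 : (M.face x).card + 2 * M.corners x ≤ 6 := by omega
  by_cases hv : M.corners x = 0
  · have hk : (M.face x).card = 3 ∨ (M.face x).card = 4 ∨ (M.face x).card = 5 ∨
        (M.face x).card = 6 := by omega
    rcases hk with hk | hk | hk | hk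
    · exact Or.inl (Tri.of_card hk hv)
    · exact Or.inr (Or.inl (Quad.of_card hk hv))
    · have h5 := M.pent_paid hk fun y hy => M.isX_of_corners hv hy
      exact Or.inr (Or.inr (Or.inr (Or.inl (h5.2 (by omega)))))
    · have hp : (M.face x).filter M.Paid = M.face x :=
        Finset.eq_of_subset_of_card_le (Finset.filter_subset _ _)
          (show (M.face x).card ≤ M.paidSides x by omega)
      rw [hk] at hit
      exact Or.inr (Or.inr (Or.inr (Or.inr ⟨hit, fun y hy =>
        (Finset.mem_filter.1 (hp.symm ▸ hy)).2⟩)))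
  · have hk : (M.face x).card = 3 ∨ (M.face x).card = 4 := by omega
    rcases hk with hk | hk
    · rw [hk] at hit
      exact Or.inr (Or.inr (Or.inl ⟨hit, by omega⟩))
    · have := M.paidSides_le_two hk (by omega)
      omega

theorem Tri1.cases {M : CrossMap D V} {x : D} (h : M.Tri1 x) :
    (M.isX x ∧ M.isX (M.f x) ∧ ¬ M.isX (M.f (M.f x))) ∨
    (M.isX x ∧ ¬ M.isX (M.f x) ∧ M.isX (M.f (M.f x))) ∨
    (¬ M.isX x ∧ M.isX (M.f x) ∧ M.isX (M.f (M.f x))) := by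
  have hv := h.2
  have hk : (M.face x).card = 3 := by
    refine le_antisymm ?_ (M.three_le_card_face x)
    have hs : M.face x ⊆ {x, M.f x, M.f (M.f x)} := by
      intro y hy
      rw [face_eq_image] at hy
      have hp : Function.IsPeriodicPt M.f 3 x := h.1
      obtain ⟨i, hi, rfl⟩ := Finset.mem_image.1 hy
      have : Function.minimalPeriod M.f x ≤ 3 :=
        hp.minimalPeriod_le (by norm_num)
      rw [Finset.mem_range] at hi
      have : i < 3 := by omega
      interval_cases i <;> simp
    exact (Finset.card_le_card hs).trans Finset.card_le_three
  rw [corners_eq, hk] at hv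
  simp only [Finset.sum_range_succ, Finset.sum_range_zero, Function.iterate_succ,
    Function.iterate_zero, Function.comp, id] at hv
  by_cases a0 : M.isX x <;> by_cases a1 : M.isX (M.f x) <;> by_cases a2 : M.isX (M.f (M.f x)) <;>
    simp_all

end CrossMap

namespace CrossMap

variable {D V : Type*} (M : CrossMap D V) {o ζ : V × V}

theorem reach_rf {d : D} (hd : M.isX d) : M.Reach (M.e d) (M.r (M.f d)) :=
  .base ((M.isX_rf _).2 hd) (M.e_s hd)

theorem reach_r_s {y : D} (hy : M.isX y) (hc : M.cr o (M.e (M.f y))) (hr : M.Reach o (M.r y)) :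
    M.Reach o (M.r (M.s y)) := by
  refine .step (M.isX_r_s hy) ?_ (by rwa [M.s_r_s hy])
  rw [M.e_f_r_s hy]
  exact M.cr_swap _ _ hc

/-- `o` crosses the edges of `x` and `M.f x`, and leaves the latter to the left of its reverse. -/
def Side (o : V × V) (x : D) : Prop :=
  M.isX x ∧ M.cr o (M.e x) ∧ M.cr o (M.e (M.f x)) ∧ M.Reach o (M.r (M.f x))

theorem side_mk {y : D} (hy : M.isX y) (hc : M.cr o (M.e (M.f y))) (hy₀ : M.cr o (M.e y))
    (hr : M.Reach o (M.r y)) : M.Side o (M.r (M.f y)) := by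
  refine ⟨(M.isX_rf _).2 hy, ?_, ?_, M.reach_r_s hy hc hr⟩
  · rw [M.e_r]; exact M.cr_swap _ _ hc
  · rw [M.f_r_rf, M.e_s hy]; exact hy₀

/-- A row of sides along an edge, starting at a paid side adjacent to the edge `ζ`. -/
inductive Col (o ζ : V × V) : D → Prop
  | base {x : D} : M.Side o x → M.Paid (M.r x) → M.e (M.b x) = ζ → Col o ζ x
  | step {y : D} : M.Side o (M.s y) → Col o ζ y → Col o ζ (M.s y)

theorem Col.side {M : CrossMap D V} {x : D} (h : M.Col o ζ x) : M.Side o x := by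
  cases h with
  | base h => exact h
  | step h => exact h

theorem col_mk {y : D} (h : M.Side o (M.r (M.f y))) (hp : M.Paid (M.f y))
    (hz : M.e (M.f (M.f y)) = ζ) : M.Col o ζ (M.r (M.f y)) :=
  .base h (by rwa [M.rr]) (by rw [M.e_r_b_r hp.isX, hz])

theorem Col.turn {M : CrossMap D V} {x : D} (h : M.Col o ζ x) (hp : M.Paid (M.r (M.f x))) :
    M.e (M.f (M.f x)) = ζ := by
  induction h with
  | @base x hs hpx hz =>
    rcases M.paid_cases hp with ht | ⟨hq, hp'⟩
    · rw [M.rr] at ht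
      rw [← ht.prev.b_eq, hz]
    · rw [M.rr] at hq hp'
      have hq' := hq.prev
      exfalso
      have h2 : M.Paid (M.f (M.f x)) := by
        rcases M.paid_cases hpx with ht | ⟨-, h2⟩
        · rw [M.rr] at ht
          exact absurd ht hq'.not_tri
        · rwa [M.rr] at h2
      have c2 := h2.cr
      have c3 := hp'.cr
      rw [M.bf] at c2 c3
      rw [hq'.1] at c3
      have c4 := M.cr_f _ hq'.2.2.2.2
      rw [hq'.1] at c4
      exact M.clique_free _ _ _ _ (M.cr_f _ hq'.2.1) (M.cr_symm _ _ c3) (M.cr_symm _ _ c4)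
        (M.cr_f _ hq'.2.2.1) c2 (M.cr_f _ hq'.2.2.2.1)
  | @step y hs hy ih =>
    obtain ⟨hX, c1, c2, -⟩ := hs
    have hy' := hy.side
    rcases M.paid_cases hp with ht | ⟨hq, hp'⟩
    · rw [M.rr] at ht
      have ht' := ht.prev
      exfalso
      have hb := ht'.b_eq
      rw [M.b_s] at hb
      have c3 : M.cr o (M.e (M.f (M.f (M.s y)))) := by
        rw [← hb, M.e_r]; exact M.cr_swap _ _ hy'.2.2.1
      have c4 := M.cr_f _ ht'.2.2.2
      rw [ht'.1] at c4
      exact M.clique_free _ _ _ _ c1 c2 c3 (M.cr_f _ ht'.2.1) (M.cr_symm _ _ c4)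
        (M.cr_f _ ht'.2.2.1)
    · rw [M.rr] at hq hp'
      have hq' := hq.prev
      have hb := hq'.b_eq
      rw [M.b_s] at hb
      have hfy : M.f y = M.r (M.f (M.f (M.f (M.s y)))) := by rw [← hb, M.rr]
      have := ih (by rw [hb]; exact hp')
      rw [hfy, M.f_r_rf, M.e_s hq'.2.2.2.1] at this
      exact this

/-- First kind of position in the scan along the oriented edge `o`. -/
def Up (ζ : V × V) (d : D) : Prop :=
  M.isX (M.b d) ∧ M.isX (M.b (M.b d)) ∧ M.e (M.b (M.b d)) = ζ

/-- Second kind of position in the scan along the oriented edge `o`. -/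
def Mid (o ζ : V × V) (d : D) : Prop :=
  ∃ x, M.Col o ζ x ∧ M.s x = M.r (M.b (M.b d)) ∧ M.Paid (M.r (M.b d))

/-- Third kind of position in the scan along the oriented edge `o`. -/
def Down (o ζ : V × V) (d : D) : Prop :=
  ∃ x, M.Col o ζ x ∧ M.s x = M.b d ∧ M.Paid (M.b d)

theorem up_mk {d : D} (h0 : M.isX d) (h1 : M.isX (M.f d)) (hz : M.e (M.f (M.f d)) = ζ) :
    M.Up ζ (M.s d) := by
  refine ⟨?_, ?_, ?_⟩
  · rw [M.b_s, M.isX_rf]; exact h0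
  · rw [M.b_s, M.isX_b_r]; exact h1
  · rw [M.b_s, M.e_r_b_r h1, hz]

theorem mid_mk {d : D} (hp : M.Paid (M.f d)) (h : M.Col o ζ (M.r (M.f (M.f d)))) :
    M.Mid o ζ (M.s d) :=
  ⟨_, h, by rw [M.b_s, M.r_b_r hp.isX], by rwa [M.b_s, M.rr]⟩

theorem side_of_paid {d : D} (hd : M.e d = o) (h0 : M.isX d) (hp : M.Paid (M.f d)) :
    M.Side o (M.r (M.f (M.f d))) := by
  have hc := hp.cr
  rw [M.bf, hd] at hc
  refine M.side_mk hp.isX hc (hd ▸ M.cr_f _ h0) (hd ▸ M.reach_rf h0)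

theorem Mid.next {M : CrossMap D V} {d : D} (hd : M.e d = o) (h : M.Mid o ζ d) :
    M.isX d ∧ (M.Mid o ζ (M.s d) ∨ M.Down o ζ (M.s d)) := by
  obtain ⟨x, hx, hs, hp⟩ := h
  rcases M.paid_cases hp with ht | ⟨hq, hp'⟩
  · rw [M.rr] at ht
    have ht' : M.Tri d := by simpa [M.fb] using ht.next
    refine ⟨ht'.2.1, Or.inr ⟨x, hx, ?_, ?_⟩⟩
    · rw [hs, M.b_s, ht'.b_eq, M.bf]
    · rw [M.b_s]
      exact .tri (by rw [M.rr]; exact ht'.next)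
  · rw [M.rr] at hq hp'
    rw [M.fb] at hp'
    have hq' : M.Quad d := by simpa [M.fb] using hq.next
    refine ⟨hq'.2.1, Or.inl (M.mid_mk hp' ?_)⟩
    have hside := M.side_of_paid hd hq'.2.1 hp'
    rw [hq'.b_eq, M.bf] at hs
    rw [← hs] at hside ⊢
    exact .step hside hx

variable [Fintype D]

/-- The dart `x` lies on a face with positive charge that is charged by the oriented edge `o`. -/
structure Key (o : V × V) (x : D) : Prop where
  pos : M.Pos x
  isX : M.isX x
  isX_f : M.isX (M.f x)
  not_paid : ¬ M.Paid x
  not_paid_f : ¬ M.Paid (M.f x)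
  reach : M.Reach o (M.r (M.f x))
  reach_f : M.Reach o (M.r (M.f (M.f x)))
  cr_b : M.cr o (M.e (M.b x))
  cr : M.cr o (M.e x)
  cr_f : M.cr o (M.e (M.f x))
  cr_ff : M.cr o (M.e (M.f (M.f x)))

theorem Key.unique {M : CrossMap D V} {o o' : V × V} {x : D} (h : M.Key o x) (h' : M.Key o' x) :
    o = o' :=
  (h.reach.unique h'.reach).resolve_right fun hc =>
    M.clique_free _ _ _ _ hc h.cr h.cr_f h'.cr h'.cr_f (M.cr_f _ h.isX)

theorem Hex.b_eq {M : CrossMap D V} {x : D} (h : M.Hex x) :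
    M.b x = M.f (M.f (M.f (M.f (M.f x)))) := by
  conv_lhs => rw [← h.1, M.bf]

theorem Pent.b_eq {M : CrossMap D V} {x : D} (h : M.Pent x) :
    M.b x = M.f (M.f (M.f (M.f x))) := by
  conv_lhs => rw [← h.1, M.bf]

theorem Tri1.b_eq {M : CrossMap D V} {x : D} (h : M.Tri1 x) : M.b x = M.f (M.f x) := by
  conv_lhs => rw [← h.1, M.bf]

theorem Tri1.not_all {M : CrossMap D V} {x : D} (h : M.Tri1 x) (h0 : M.isX x)
    (h1 : M.isX (M.f x)) (h2 : M.isX (M.f (M.f x))) : False := by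
  rcases h.cases with h | h | h
  · exact h.2.2 h2
  · exact h.2.1 h1
  · exact h.1 h0

theorem Col.next {M : CrossMap D V} (hk : ∀ x, ¬ M.Key o x) (hz : ¬ M.cr o ζ) {x : D}
    (h : M.Col o ζ x) (hX : M.isX (M.f x)) (hc : M.cr o (M.e (M.f (M.f x))))
    (hr : M.Reach o x) (hr' : M.Reach o (M.r (M.f (M.f x)))) :
    M.Col o ζ (M.r (M.f (M.f x))) := by
  induction h with
  | @base x hs hp hzx =>
    have hside := M.side_mk hX hc hs.2.2.1 hs.2.2.2
    rcases M.paid_cases hp with ht | ⟨hq, h2⟩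
    · rw [M.rr] at ht
      rw [ht.b_eq] at hzx
      exact absurd (hzx ▸ hc) hz
    · rw [M.rr] at hq h2
      rw [hq.b_eq] at hzx
      exact M.col_mk hside h2 hzx
  | @step y hs hy ih =>
    have hside := M.side_mk hX hc hs.2.2.1 hs.2.2.2
    obtain ⟨h0, c0, c1, r1⟩ := hs
    have hy' := hy.side
    have hb := M.b_s y
    set x := M.s y with hx
    have hbX : M.isX (M.b x) := by rw [hb, M.isX_rf]; exact hy'.1
    have cb : M.cr o (M.e (M.b x)) := by
      rw [hb, M.e_r]; exact M.cr_swap _ _ hy'.2.2.1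
    have u0 : ¬ M.Paid x := fun hp =>
      M.clique_free _ _ _ _ cb c0 c1 (M.cr_b hbX) hp.cr (M.cr_f _ h0)
    have u1 : ¬ M.Paid (M.f x) := fun hp => by
      have := hp.cr
      rw [M.bf] at this
      exact M.clique_free _ _ _ _ c0 c1 hc (M.cr_f _ h0) this (M.cr_f _ hX)
    have hnp : ¬ M.Pos x := fun hp =>
      hk x ⟨hp, h0, hX, u0, u1, r1, hr', cb, c0, c1, hc⟩
    have hfy : M.f y = M.r (M.b x) := by rw [hb, M.rr]
    rcases M.cases_of_not_pos hnp with ht | hq | ht | hp | hh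
    · rw [ht.b_eq] at cb
      have c4 := M.cr_f _ ht.2.2.2
      rw [ht.1] at c4
      exact (M.clique_free _ _ _ _ c0 c1 cb (M.cr_f _ h0) (M.cr_symm _ _ c4)
        (M.cr_f _ hX)).elim
    · rw [hq.b_eq] at hfy
      have hffy : M.f (M.f y) = M.s (M.f (M.f x)) := by rw [hfy]; rfl
      have h2 := hq.2.2.2.1
      have c3 : M.cr o (M.e (M.f (M.f (M.f x)))) := by rw [← hq.b_eq]; exact cb
      have hs' := M.s_r_s h2
      have := ih (by rw [hfy, M.isX_rf]; exact h2)
        (by rw [hffy, M.e_s h2]; exact hc)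
        (.step hy'.1 hy'.2.2.1 hr)
        (by rw [hffy]; exact M.reach_r_s h2 c3 hr')
      rw [hffy] at this
      rw [← hs'] at hside ⊢
      exact .step hside this
    · exact (ht.not_all h0 hX (ht.b_eq ▸ hbX)).elim
    · have h234 : M.Paid3 (M.f (M.f x)) := by
        rcases hp.2.2 with h | h | h | h | h
        · exact absurd h.1 u0
        · exact absurd h.1 u1
        · exact h
        · exact absurd (hp.1 ▸ h.2.2) u0
        · exact absurd (hp.1 ▸ h.2.1) u0
      have h4 := h234.2.2
      rw [hp.b_eq] at hb hfy
      have := hy.turn (hb ▸ h4)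
      rw [hfy, M.f_r_rf, M.e_s h234.2.1.isX] at this
      exact M.col_mk hside h234.1 this
    · exact absurd (hh.2 x (M.mem_face_self x)) u0

theorem Up.next {M : CrossMap D V} {d : D} (hd : M.e d = o) (hnp : ¬ M.Pos d)
    (hz : ¬ M.cr o ζ) (hz1 : ζ.2 = o.1) (hz2 : ζ ≠ o.swap) (h : M.Up ζ d) :
    M.isX d ∧ (M.Up ζ (M.s d) ∨ M.Mid o ζ (M.s d)) := by
  obtain ⟨hb, hbb, he⟩ := h
  rcases M.cases_of_not_pos hnp with ht | hq | ht | hp | hh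
  · rw [ht.b_eq, M.bf] at he
    have := M.cr_f _ ht.2.1
    rw [he, hd] at this
    exact absurd this hz
  · rw [hq.b_eq, M.bf] at he
    exact ⟨hq.2.1, Or.inl (M.up_mk hq.2.1 hq.2.2.1 he)⟩
  · rw [ht.b_eq] at hb hbb he
    rw [M.bf] at hbb he
    have h0 : ¬ M.isX d := fun h0 => ht.not_all h0 hbb hb
    have := M.snd_eq_fst _ h0
    rw [he, hd] at this
    exact absurd (Prod.ext this hz1) hz2
  · rw [hp.b_eq, M.bf] at he
    have h0 := hp.2.1 d (M.mem_face_self d)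
    have u4 : ¬ M.Paid (M.f (M.f (M.f (M.f d)))) := fun h4 => by
      have := h4.cr
      rw [M.bf, hp.1, he, hd] at this
      exact hz (M.cr_symm _ _ this)
    have h12 : M.Paid (M.f d) ∧ M.Paid (M.f (M.f d)) := by
      rcases hp.2.2 with h | h | h | h | h
      · exact h.2
      · exact ⟨h.1, h.2.1⟩
      · exact absurd h.2.2 u4
      · exact absurd h.2.1 u4
      · exact absurd h.1 u4
    exact ⟨h0, Or.inr (M.mid_mk h12.1 (M.col_mk (M.side_of_paid hd h0 h12.1) h12.2 he))⟩
  · have := (hh.2 (M.b d) (M.mem_face_b.2 (M.mem_face_self d))).cr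
    rw [M.fb, hd, he] at this
    exact absurd (M.cr_symm _ _ this) hz

theorem Down.next {M : CrossMap D V} (hk : ∀ x, ¬ M.Key o x) {d : D} (hd : M.e d = o)
    (hnp : ¬ M.Pos d) (hz : ¬ M.cr o ζ) (h : M.Down o ζ d) :
    M.isX d ∧ (M.Up ζ (M.s d) ∨ M.Mid o ζ (M.s d) ∨ M.Down o ζ (M.s d)) := by
  obtain ⟨x, hx, hs, hp⟩ := h
  have hb : M.b (M.b d) = M.r (M.f x) := by rw [← hs, M.b_s]
  have hfx : M.f x = M.r (M.b (M.b d)) := by rw [hb, M.rr]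
  have hx' := hx.side
  have hrs : M.Reach o (M.s x) := by
    rw [hs]
    exact .base hp.isX (by rw [M.fb, hd])
  rcases M.cases_of_not_pos hnp with ht | hq | ht | hpe | hh
  · have : M.Tri (M.b d) := by rw [ht.b_eq]; exact ht.next.next
    exact absurd hp this.not_paid
  · rw [hq.b_eq] at hp hs hfx
    rw [M.bf] at hfx
    have hffx : M.f (M.f x) = M.s (M.f d) := by rw [hfx]; rfl
    have h0 := hq.2.1
    have h1 := hq.2.2.1
    have c3 := hp.cr
    rw [M.bf, hq.1, hd] at c3
    have c1 : M.cr o (M.e (M.f d)) := hd ▸ M.cr_f _ h0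
    have hrr := M.reach_r_s h1 (M.cr_symm _ _ c3) (hd ▸ M.reach_rf h0)
    have hn := hx.next hk hz (by rw [hfx, M.isX_rf]; exact h1)
      (by rw [hffx, M.e_s h1]; exact c1)
      (.step hx'.1 hx'.2.2.1 hrs) (by rw [hffx]; exact hrr)
    rw [hffx] at hn
    refine ⟨h0, Or.inr (Or.inr ⟨_, hn, ?_, ?_⟩)⟩
    · rw [M.s_r_s h1, M.b_s]
    · rw [M.b_s]
      exact .quad (by rw [M.rr]; exact hq.next) (by rwa [M.rr])
  · have h0 : ¬ M.isX d := fun h0 =>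
      ht.not_all h0 (by simpa [ht.b_eq, M.bf] using hp.isX_b) (by simpa [ht.b_eq] using hp.isX)
    have := hp.cr
    rw [M.fb, ht.b_eq, M.bf] at this
    exact absurd (M.cr_symm _ _ this) (M.not_cr_f _ h0)
  · have h0 := hpe.2.1 d (M.mem_face_self d)
    have h1 := hpe.2.1 _ (M.mem_face_f.2 (M.mem_face_self d))
    have h2 := hpe.2.1 _ (M.mem_face_f.2 (M.mem_face_f.2 (M.mem_face_self d)))
    rw [hpe.b_eq] at hs hb hfx hp
    rw [M.bf] at hb hfx
    have hffx : M.f (M.f x) = M.s (M.f (M.f d)) := by rw [hfx]; rfl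
    refine ⟨h0, ?_⟩
    by_cases h3 : M.Paid (M.f (M.f (M.f d)))
    · have := hx.turn (by rw [← hb]; exact h3)
      rw [hffx, M.e_s h2] at this
      exact Or.inl (M.up_mk h0 h1 this)
    · have p1 : M.Paid (M.f d) := by
        rcases hpe.2.2 with h | h | h | h | h
        · exact h.2.1
        · exact h.1
        · exact absurd h.2.1 h3
        · exact absurd h.1 h3
        · exact hpe.1 ▸ h.2.2
      have c3 := hp.cr
      rw [M.bf, hpe.1, hd] at c3
      have c2 := p1.cr
      rw [M.bf, hd] at c2
      have hw := p1.reach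
      rw [M.bf, hd] at hw
      have hr2 : M.Reach o (M.r (M.f (M.f d))) := by
        refine .step ((M.isX_rf _).2 h1) ?_ hw
        rw [M.f_r_rf, M.e_s h1]
        exact hd ▸ M.cr_f _ h0
      have hrr := M.reach_r_s h2 (M.cr_symm _ _ c3) hr2
      have hn := hx.next hk hz (by rw [hfx, M.isX_rf]; exact h2)
        (by rw [hffx, M.e_s h2]; exact c2)
        (.step hx'.1 hx'.2.2.1 hrs) (by rw [hffx]; exact hrr)
      rw [hffx] at hn
      have hside := M.side_of_paid hd h0 p1
      refine Or.inr (Or.inl (M.mid_mk p1 ?_))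
      rw [← M.s_r_s h2] at hside ⊢
      exact .step hside hn
  · have hall : ∀ y ∈ M.face d, M.Paid y := hh.2
    have m0 := M.mem_face_self d
    have m1 := M.mem_face_f.2 m0
    have m2 := M.mem_face_f.2 m1
    have m3 := M.mem_face_f.2 m2
    have m4 := M.mem_face_f.2 m3
    rw [hh.b_eq, M.bf] at hb hfx
    have := hx.turn (by rw [← hb]; exact hall _ m4)
    rw [hfx, M.f_r_rf, M.e_s (hall _ m3).isX] at this
    have h0 := (hall _ m0).isX
    exact ⟨h0, Or.inr (Or.inl (M.mid_mk (hall _ m1)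
      (M.col_mk (M.side_of_paid hd h0 (hall _ m1)) (hall _ m2) this)))⟩

theorem scan_false (hk : ∀ x, ¬ M.Key o x) (hnp : ∀ d, M.e d = o → ¬ M.Pos d)
    (hz : ¬ M.cr o ζ) (hz1 : ζ.2 = o.1) (hz2 : ζ ≠ o.swap) (n : ℕ) :
    ∀ d, M.rank d ≤ n → M.e d = o → M.Up ζ d ∨ M.Mid o ζ d ∨ M.Down o ζ d → False := by
  induction n with
  | zero =>
    intro d hn hd h
    have hX : M.isX d := by
      rcases h with h | h | h
      · exact (h.next hd (hnp d hd) hz hz1 hz2).1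
      · exact (h.next hd).1
      · exact (h.next hk hd (hnp d hd) hz).1
    have := M.rank_lt d hX
    omega
  | succ n ih =>
    intro d hn hd h
    have hX : M.isX d ∧ (M.Up ζ (M.s d) ∨ M.Mid o ζ (M.s d) ∨ M.Down o ζ (M.s d)) := by
      rcases h with h | h | h
      · have := h.next hd (hnp d hd) hz hz1 hz2
        tauto
      · have := h.next hd
        tauto
      · exact h.next hk hd (hnp d hd) hz
    have := M.rank_lt d hX.1
    exact ih (M.s d) (by rw [s]; omega) (by rw [M.e_s hX.1, hd]) hX.2

/-- Every oriented edge starting at a vertex has a dart on a face of positive charge, or a key. -/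
theorem exists_pos_or_key {d₀ : D} (h0 : ¬ M.isX (M.b d₀)) :
    (∃ d, M.e d = M.e d₀ ∧ M.Pos d) ∨ ∃ x, M.Key (M.e d₀) x := by
  by_contra! hcon
  obtain ⟨hnp, hk⟩ := hcon
  have hT : M.Tri1 d₀ := by
    rcases M.cases_of_not_pos (hnp d₀ rfl) with ht | hq | ht | hp | hh
    · exact absurd (ht.b_eq ▸ ht.2.2.2) h0
    · exact absurd (hq.b_eq ▸ hq.2.2.2.2) h0
    · exact ht
    · exact absurd (hp.2.1 _ (M.mem_face_b.2 (M.mem_face_self _))) h0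
    · exact absurd (hh.2 _ (M.mem_face_b.2 (M.mem_face_self _))).isX h0
  have h12 : M.isX d₀ ∧ M.isX (M.f d₀) := by
    rw [hT.b_eq] at h0
    rcases hT.cases with h | h | h
    · exact ⟨h.1, h.2.1⟩
    · exact absurd h.2.2 h0
    · exact absurd h.2.2 h0
  have e1 := M.snd_eq_fst _ h0
  have e2 := M.ne_swap _ h0
  have e3 := M.not_cr_f _ h0
  rw [M.fb] at e1 e2 e3
  refine M.scan_false (o := M.e d₀) (ζ := M.e (M.b d₀)) hk hnp (fun h => e3 (M.cr_symm _ _ h))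
    e1.symm ?_ _ (M.s d₀) le_rfl (M.e_s h12.1) (Or.inl (M.up_mk h12.1 h12.2 ?_))
  · intro h
    exact e2 (by rw [h, Prod.swap_swap])
  · rw [hT.b_eq]

end CrossMap

namespace CrossMap

variable {D V : Type*} (M : CrossMap D V) [Fintype D]

/-- The dart `x` is charged by some oriented edge. -/
def IsKey (x : D) : Prop := ∃ o, M.Key o x

/-- The number of sides of the face of `x` that are keys. -/
def keySides (x : D) : ℕ := ((M.face x).filter M.IsKey).card

theorem keySides_eq (x : D) : M.keySides x =
    ∑ i ∈ Finset.range (M.face x).card, if M.IsKey (M.f^[i] x) then 1 else 0 := by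
  rw [keySides, Finset.card_filter, M.sum_face]

theorem keySides_add_paidSides (x : D) : M.keySides x + M.paidSides x ≤ (M.face x).card := by
  rw [keySides, paidSides, ← Finset.card_union_of_disjoint]
  · exact Finset.card_le_card (Finset.union_subset (Finset.filter_subset _ _)
      (Finset.filter_subset _ _))
  · exact Finset.disjoint_filter.2 fun y _ ⟨_, h⟩ h' => h.not_paid h'

theorem paidSides_add_two_le {x : D} (h : 0 < M.keySides x) :
    M.paidSides x + 2 ≤ (M.face x).card := by
  obtain ⟨y, hy⟩ := Finset.card_pos.1 h
  obtain ⟨hy, o, hk⟩ := Finset.mem_filter.1 hy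
  have h2 : ({y, M.f y} : Finset D).card = 2 := Finset.card_pair (M.f_ne y).symm
  rw [paidSides, ← h2, ← Finset.card_union_of_disjoint]
  · refine Finset.card_le_card (Finset.union_subset (Finset.filter_subset _ _) ?_)
    intro z hz
    rw [Finset.mem_insert, Finset.mem_singleton] at hz
    rcases hz with rfl | rfl
    · exact hy
    · exact M.mem_face_f.2 hy
  · rw [Finset.disjoint_left]
    intro z hz hz'
    rw [Finset.mem_insert, Finset.mem_singleton] at hz'
    rcases hz' with rfl | rfl
    · exact hk.not_paid (Finset.mem_filter.1 hz).2
    · exact hk.not_paid_f (Finset.mem_filter.1 hz).2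

theorem not_key_key {x : D} (h : M.f (M.f (M.f (M.f (M.f x)))) = x)
    (hX : ∀ y ∈ M.face x, M.isX y) (h0 : M.IsKey x) (h1 : M.IsKey (M.f x))
    (h3 : M.Paid (M.f (M.f (M.f x)))) : False := by
  obtain ⟨a, h0⟩ := h0
  obtain ⟨a', h1⟩ := h1
  have m2 := M.mem_face_f.2 (M.mem_face_f.2 (M.mem_face_self x))
  have m3 := M.mem_face_f.2 m2
  rcases h0.reach_f.unique h1.reach with he | hc
  · subst he
    have hb : M.b x = M.f (M.f (M.f (M.f x))) := by conv_lhs => rw [← h, M.bf]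
    have c4 := h0.cr_b
    rw [hb] at c4
    have c := h3.cr
    rw [M.bf] at c
    exact M.clique_free _ _ _ _ h1.cr_f h1.cr_ff c4 (M.cr_f _ (hX _ m2)) c (M.cr_f _ (hX _ m3))
  · exact M.clique_free _ _ _ _ hc h0.cr_f h0.cr_ff h1.cr h1.cr_f (M.cr_f _ h1.isX)

theorem keySides_le_one {x : D} (hk : (M.face x).card = 5) (hX : ∀ y ∈ M.face x, M.isX y)
    (hp : M.paidSides x = 2) : M.keySides x ≤ 1 := by
  have h := M.iterate_card_face x
  rw [paidSides_eq] at hp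
  rw [keySides_eq]
  rw [hk] at h hp ⊢
  simp only [Finset.sum_range_succ, Finset.sum_range_zero, Function.iterate_succ,
    Function.iterate_zero, Function.comp, id] at h hp ⊢
  have key : ∀ y ∈ M.face x, M.f (M.f (M.f (M.f (M.f y)))) = y →
      M.IsKey y → M.IsKey (M.f y) → M.Paid (M.f (M.f (M.f y))) → False := by
    intro y hy h5
    exact M.not_key_key h5 (by rw [M.face_eq_of_mem hy]; exact hX)
  have g : ∀ y, M.IsKey y → ¬ M.Paid y ∧ ¬ M.Paid (M.f y) :=
    fun y ⟨_, hy⟩ => ⟨hy.not_paid, hy.not_paid_f⟩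
  have h0 := M.mem_face_self x
  have h1 := M.mem_face_f.2 h0
  have h2 := M.mem_face_f.2 h1
  have h3 := M.mem_face_f.2 h2
  have h4 := M.mem_face_f.2 h3
  have k0 := key _ h0
  have k1 := key _ h1
  have k2 := key _ h2
  have k3 := key _ h3
  have k4 := key _ h4
  have g0 := g x
  have g1 := g (M.f x)
  have g2 := g (M.f (M.f x))
  have g3 := g (M.f (M.f (M.f x)))
  have g4 := g (M.f (M.f (M.f (M.f x))))
  simp only [h] at k0 k1 k2 k3 k4 g4
  simp only [forall_const] at k0 k1 k2 k3 k4
  clear key h0 h1 h2 h3 h4 g hk h hX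
  have hone : ∀ P Q : Prop, (P → ¬ Q) → (if P then 1 else 0) + (if Q then 1 else 0) ≤ 1 := by
    intro P Q hPQ
    by_cases P <;> by_cases Q <;> simp_all
  have hle : ∀ P : Prop, (if P then 1 else 0) ≤ 1 := by
    intro P
    by_cases P <;> simp_all
  by_cases a0 : M.Paid x <;> by_cases a1 : M.Paid (M.f x) <;>
    by_cases a2 : M.Paid (M.f (M.f x)) <;> by_cases a3 : M.Paid (M.f (M.f (M.f x))) <;>
    by_cases a4 : M.Paid (M.f (M.f (M.f (M.f x)))) <;>
    simp only [a0, a1, a2, a3, a4, if_true, if_false, not_true, not_false_eq_true, and_self,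
      and_false, false_and, imp_false, imp_true_iff] at * <;>
    first
    | (exfalso; revert hp; norm_num; done)
    | (simp only [g0, g1, g2, g3, g4, if_false, zero_add, add_zero]; exact hle _)
    | (simp only [g0, g1, g2, g3, g4, if_false, zero_add, add_zero]; apply hone; tauto)

theorem sum_charge_le (x : D) :
    (∑ y ∈ M.face x, ((if M.Pos y then 1 else 0) + (if M.IsKey y then 1 else 0) : ℤ)) + 72 ≤
    ∑ y ∈ M.face x, (18 + (if M.isX y then 0 else 18) - (if M.Paid y ∧ ¬ M.Quad y then 6 else 0) +
      (if M.Tri y then 6 else 0) : ℤ) := by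
  have hposiff : ∀ y ∈ M.face x, (M.Pos y ↔ M.Pos x) := fun y hy => by
    simp only [Pos, corners, paidSides, M.face_eq_of_mem hy]
  have h1 := M.corners_add_paidSides x
  have h2 := M.three_le_card_face x
  have h3 := M.keySides_add_paidSides x
  have h4 := M.paidSides_add_two_le (x := x)
  have h5 : (M.face x).card = 5 → M.corners x = 0 → M.paidSides x ≤ 3 := fun hk hv =>
    (M.pent_paid hk fun y hy => M.isX_of_corners hv hy).1
  have h6 : (M.face x).card = 5 → M.corners x = 0 → M.paidSides x = 2 → M.keySides x ≤ 1 :=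
    fun hk hv => M.keySides_le_one hk fun y hy => M.isX_of_corners hv hy
  have h7 : (M.face x).card = 4 → M.corners x = 1 → M.paidSides x ≤ 2 := fun hk hv =>
    M.paidSides_le_two hk hv
  have e1 : ∑ y ∈ M.face x, (if M.isX y then 0 else 18 : ℤ) = 18 * M.corners x := by
    rw [corners, Finset.card_filter]
    push_cast
    rw [Finset.mul_sum]
    exact Finset.sum_congr rfl fun y _ => by by_cases h : M.isX y <;> simp [h]
  have e2 : ∑ y ∈ M.face x, (if M.Paid y ∧ ¬ M.Quad y then 6 else 0 : ℤ) ≤ 6 * M.paidSides x := by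
    rw [paidSides, Finset.card_filter]
    push_cast
    rw [Finset.mul_sum]
    refine Finset.sum_le_sum fun y _ => ?_
    by_cases h : M.Paid y <;> by_cases h' : M.Quad y <;> simp [h, h']
  have e3 : (0 : ℤ) ≤ ∑ y ∈ M.face x, (if M.Tri y then 6 else 0 : ℤ) :=
    Finset.sum_nonneg fun y _ => by split_ifs <;> norm_num
  have e4 : ∑ y ∈ M.face x, (if M.IsKey y then 1 else 0 : ℤ) = M.keySides x := by
    rw [keySides, Finset.card_filter]
    push_cast
    rfl
  rw [Finset.sum_add_distrib, Finset.sum_add_distrib, Finset.sum_sub_distrib,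
    Finset.sum_add_distrib, e1, e4, Finset.sum_const, nsmul_eq_mul]
  by_cases hp : M.Pos x
  · have e5 : ∑ y ∈ M.face x, (if M.Pos y then 1 else 0 : ℤ) = (M.face x).card := by
      rw [Finset.sum_congr rfl fun y hy => if_pos ((hposiff y hy).2 hp)]
      simp
    rw [e5]
    rw [Pos] at hp
    omega
  · have e5 : ∑ y ∈ M.face x, (if M.Pos y then 1 else 0 : ℤ) = 0 :=
      Finset.sum_eq_zero fun y hy => if_neg fun h => hp ((hposiff y hy).1 h)
    have e6 : M.keySides x = 0 := by
      rw [keySides, Finset.card_eq_zero, Finset.filter_eq_empty_iff]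
      rintro y hy ⟨o, hk⟩
      exact hp ((hposiff y hy).1 hk.pos)
    rw [e5, e6]
    have hcard : ∀ y ∈ M.face x, (M.face y).card = (M.face x).card ∧
        M.corners y = M.corners x := fun y hy => by
      rw [corners, corners, M.face_eq_of_mem hy]
      exact ⟨rfl, rfl⟩
    have h8 : (M.face x).card = 3 → M.corners x = 0 →
        ∑ y ∈ M.face x, (if M.Tri y then 6 else 0 : ℤ) = 18 ∧ M.paidSides x = 0 := fun hk hv => by
      have ht : ∀ y ∈ M.face x, M.Tri y := fun y hy =>
        Tri.of_card ((hcard y hy).1.trans hk) ((hcard y hy).2.trans hv)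
      constructor
      · rw [Finset.sum_congr rfl fun y hy => if_pos (ht y hy), Finset.sum_const, hk]
        norm_num
      · rw [paidSides, Finset.card_eq_zero, Finset.filter_eq_empty_iff]
        exact fun y hy => (ht y hy).not_paid
    have h9 : (M.face x).card = 3 → M.corners x = 1 → M.paidSides x = 0 := fun hk hv => by
      rw [paidSides, Finset.card_eq_zero, Finset.filter_eq_empty_iff]
      intro y hy hpy
      have ht : M.Tri1 y := by
        refine ⟨?_, (hcard y hy).2.trans hv⟩
        have := M.iterate_card_face y
        rwa [(hcard y hy).1, hk] at this
      have hb := hpy.isX_b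
      have hc := hpy.cr
      rw [ht.b_eq] at hb hc
      refine M.not_cr_f (M.f y) (fun h => ht.not_all hpy.isX h hb) (M.cr_symm _ _ hc)
    have h10 : (M.face x).card = 4 → M.corners x = 0 →
        ∑ y ∈ M.face x, (if M.Paid y ∧ ¬ M.Quad y then 6 else 0 : ℤ) = 0 := fun hk hv =>
      Finset.sum_eq_zero fun y hy => if_neg fun h =>
        h.2 (Quad.of_card ((hcard y hy).1.trans hk) ((hcard y hy).2.trans hv))
    rw [Pos] at hp
    push_cast
    omega

theorem card_paid : (Finset.univ.filter fun x => M.Paid x ∧ ¬ M.Quad x).card =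
    (Finset.univ.filter M.Tri).card := by
  let T : D ≃ D := ⟨fun x => M.f (M.f (M.r x)), fun x => M.r (M.b (M.b x)),
    fun x => by simp [M.bf, M.rr], fun x => by simp [M.fb, M.rr]⟩
  let R : D ≃ D := ⟨M.r, M.r, M.rr, M.rr⟩
  have h1 : (Finset.univ.filter M.Paid).card =
      (Finset.univ.filter fun x => M.Tri (M.r x)).card +
      (Finset.univ.filter fun x => M.Quad (M.r x) ∧ M.Paid (M.f (M.f (M.r x)))).card := by
    rw [← Finset.card_union_of_disjoint]
    · congr 1
      ext x
      simp only [Finset.mem_filter, Finset.mem_univ, true_and, Finset.mem_union]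
      exact ⟨M.paid_cases, fun h => h.elim .tri fun h => .quad h.1 h.2⟩
    · exact Finset.disjoint_filter.2 fun x _ ht hq => hq.1.not_tri ht
  have h2 : (Finset.univ.filter fun x => M.Quad (M.r x) ∧ M.Paid (M.f (M.f (M.r x)))).card =
      (Finset.univ.filter fun x => M.Quad x ∧ M.Paid x).card := by
    refine Finset.card_equiv T fun x => ?_
    simp only [Finset.mem_filter, Finset.mem_univ, true_and]
    exact and_congr ⟨fun h => h.next.next, fun h => h.prev.prev⟩ Iff.rfl
  have h3 : (Finset.univ.filter fun x => M.Tri (M.r x)).card = (Finset.univ.filter M.Tri).card := by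
    refine Finset.card_equiv R fun x => ?_
    simp only [Finset.mem_filter, Finset.mem_univ, true_and]
    rfl
  have h4 : (Finset.univ.filter M.Paid).card =
      (Finset.univ.filter fun x => M.Paid x ∧ ¬ M.Quad x).card +
      (Finset.univ.filter fun x => M.Quad x ∧ M.Paid x).card := by
    rw [← Finset.card_union_of_disjoint]
    · congr 1
      ext x
      simp only [Finset.mem_filter, Finset.mem_univ, true_and, Finset.mem_union]
      tauto
    · exact Finset.disjoint_filter.2 fun x _ h h' => h.2 h'.1
  omega

/-- The faces of the map. -/
def faces : Finset (Finset D) := Finset.univ.image M.face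

theorem sum_faces (g : D → ℤ) : ∑ F ∈ M.faces, ∑ y ∈ F, g y = ∑ y, g y := by
  rw [← Finset.sum_fiberwise_of_maps_to (t := M.faces) (g := M.face)
    fun y _ => Finset.mem_image_of_mem _ (Finset.mem_univ y)]
  refine Finset.sum_congr rfl fun F hF => ?_
  obtain ⟨x, -, rfl⟩ := Finset.mem_image.1 hF
  refine Finset.sum_congr ?_ fun _ _ => rfl
  ext y
  simp only [Finset.mem_filter, Finset.mem_univ, true_and]
  exact ⟨fun h => M.face_eq_of_mem h, fun h => h ▸ M.mem_face_self y⟩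

/-- If no four edges cross pairwise, the number of oriented edges is at most `72 n`, where Euler's
formula for a drawing with `n` vertices is assumed. -/
theorem card_le_of_euler (A : Finset (V × V)) (hA : ∀ o ∈ A, ∃ d, ¬ M.isX (M.b d) ∧ M.e d = o)
    (n : ℕ) (hE : Fintype.card D + (Finset.univ.filter fun d => ¬ M.isX d).card ≤
      4 * n + 4 * M.faces.card) : A.card ≤ 72 * n := by
  have h1 : A.card ≤ (Finset.univ.filter M.Pos).card + (Finset.univ.filter M.IsKey).card := by
    have hex : ∀ o : A, ∃ z : {x // M.Pos x} ⊕ {x // M.IsKey x},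
        (∀ d, z = Sum.inl d → M.e d.1 = o.1) ∧ ∀ x, z = Sum.inr x → M.Key o.1 x.1 := by
      rintro ⟨o, ho⟩
      obtain ⟨d, hd, rfl⟩ := hA o ho
      rcases M.exists_pos_or_key hd with ⟨x, hx, hp⟩ | ⟨x, hx⟩
      · exact ⟨Sum.inl ⟨x, hp⟩, fun d h => by cases h; exact hx, fun _ h => by cases h⟩
      · exact ⟨Sum.inr ⟨x, _, hx⟩, fun _ h => (by cases h), fun _ h => by cases h; exact hx⟩
    choose g hg using hex
    have hinj : Function.Injective g := by
      intro o o' h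
      apply Subtype.ext
      rcases hz : g o with d | x
      · rw [← (hg o).1 d hz, ← (hg o').1 d (h ▸ hz)]
      · exact ((hg o).2 x hz).unique ((hg o').2 x (h ▸ hz))
    have := Fintype.card_le_of_injective g hinj
    rw [Fintype.card_coe, Fintype.card_sum, Fintype.card_subtype, Fintype.card_subtype] at this
    exact this
  have h2 : ∑ F ∈ M.faces, ((∑ y ∈ F,
      ((if M.Pos y then 1 else 0) + (if M.IsKey y then 1 else 0) : ℤ)) + 72) ≤
      ∑ F ∈ M.faces, ∑ y ∈ F, (18 + (if M.isX y then 0 else 18) -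
        (if M.Paid y ∧ ¬ M.Quad y then 6 else 0) + (if M.Tri y then 6 else 0) : ℤ) := by
    refine Finset.sum_le_sum fun F hF => ?_
    obtain ⟨x, -, rfl⟩ := Finset.mem_image.1 hF
    exact M.sum_charge_le x
  rw [Finset.sum_add_distrib, M.sum_faces, M.sum_faces, Finset.sum_const, nsmul_eq_mul,
    Finset.sum_add_distrib, Finset.sum_add_distrib, Finset.sum_sub_distrib,
    Finset.sum_add_distrib, Finset.sum_const, nsmul_eq_mul] at h2
  have h3 := M.card_paid
  have c1 : ∑ y, (if M.Pos y then 1 else 0 : ℤ) = (Finset.univ.filter M.Pos).card := by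
    simp
  have c2 : ∑ y, (if M.IsKey y then 1 else 0 : ℤ) = (Finset.univ.filter M.IsKey).card := by
    simp
  have c3 : ∑ y, (if M.isX y then 0 else 18 : ℤ) =
      18 * (Finset.univ.filter fun d => ¬ M.isX d).card := by
    rw [← Finset.sum_congr rfl fun y _ => ite_not (M.isX y) (18 : ℤ) 0, ← Finset.sum_filter,
      Finset.sum_const, nsmul_eq_mul, mul_comm]
  have c4 : ∑ y, (if M.Paid y ∧ ¬ M.Quad y then 6 else 0 : ℤ) =
      6 * (Finset.univ.filter fun x => M.Paid x ∧ ¬ M.Quad x).card := by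
    rw [← Finset.sum_filter, Finset.sum_const, nsmul_eq_mul, mul_comm]
  have c5 : ∑ y, (if M.Tri y then 6 else 0 : ℤ) = 6 * (Finset.univ.filter M.Tri).card := by
    rw [← Finset.sum_filter, Finset.sum_const, nsmul_eq_mul, mul_comm]
  rw [c1, c2, c3, c4, c5, h3, Finset.card_univ] at h2
  omega

end CrossMap

/-- A straight-line drawing with vertices in general position, no two on a vertical line; `A` is
the set of oriented edges. -/
structure Drawing (V : Type*) where
  x : V → ℝ
  y : V → ℝ
  A : Finset (V × V)
  swap_mem : ∀ a ∈ A, a.swap ∈ A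
  ne : ∀ a ∈ A, a.1 ≠ a.2
  x_inj : Function.Injective x
  gen : ∀ i j k, i ≠ j → i ≠ k → j ≠ k → (y k - y i) * (x j - x i) ≠ (y j - y i) * (x k - x i)

namespace Drawing

variable {V : Type*} (G : Drawing V)

/-- The slope of an edge. -/
def m (a : V × V) : ℝ := (G.y a.2 - G.y a.1) / (G.x a.2 - G.x a.1)

/-- The intercept of an edge. -/
def c (a : V × V) : ℝ := G.y a.1 - G.m a * G.x a.1

/-- The line through an edge. -/
def L (a : V × V) (u : ℝ) : ℝ := G.m a * u + G.c a

/-- The number `u` lies strictly between the first coordinates of the end points of `a`. -/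
def Inside (a : V × V) (u : ℝ) : Prop := (u - G.x a.1) * (u - G.x a.2) < 0

/-- The first coordinate of the intersection of two lines. -/
def xc (a b : V × V) : ℝ := (G.c b - G.c a) / (G.m a - G.m b)

/-- Two edges cross. -/
def Cr (a b : V × V) : Prop :=
  a ∈ G.A ∧ b ∈ G.A ∧ G.m a ≠ G.m b ∧ G.Inside a (G.xc a b) ∧ G.Inside b (G.xc a b)

/-- The first coordinates of the vertices and crossings on an edge. -/
def N (a : V × V) : Finset ℝ :=
  insert (G.x a.1) (insert (G.x a.2) ((G.A.filter (G.Cr a)).image (G.xc a)))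

theorem m_swap (a : V × V) : G.m a.swap = G.m a := by
  simp only [m, Prod.fst_swap, Prod.snd_swap]
  rw [← neg_sub (G.y a.2), ← neg_sub (G.x a.2), neg_div_neg_eq]

theorem x_ne {a : V × V} (ha : a ∈ G.A) : G.x a.2 - G.x a.1 ≠ 0 :=
  sub_ne_zero.2 fun h => G.ne a ha (G.x_inj h.symm)

theorem L_fst (a : V × V) : G.L a (G.x a.1) = G.y a.1 := by simp [L, c]

theorem m_mul {a : V × V} (ha : a ∈ G.A) :
    G.m a * (G.x a.2 - G.x a.1) = G.y a.2 - G.y a.1 := by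
  rw [m, div_mul_cancel₀ _ (G.x_ne ha)]

theorem L_snd {a : V × V} (ha : a ∈ G.A) : G.L a (G.x a.2) = G.y a.2 := by
  have := G.m_mul ha
  simp only [L, c]
  linarith

theorem c_swap {a : V × V} (ha : a ∈ G.A) : G.c a.swap = G.c a := by
  have := G.m_mul ha
  simp only [c, m_swap, Prod.fst_swap]
  linarith

theorem L_swap {a : V × V} (ha : a ∈ G.A) (u : ℝ) : G.L a.swap u = G.L a u := by
  rw [L, m_swap, G.c_swap ha, L]

theorem inside_swap (a : V × V) (u : ℝ) : G.Inside a.swap u ↔ G.Inside a u := by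
  rw [Inside, Inside, mul_comm]; rfl

theorem eq_xc {a b : V × V} (h : G.m a ≠ G.m b) {u : ℝ} : G.L a u = G.L b u ↔ u = G.xc a b := by
  rw [xc, eq_div_iff (sub_ne_zero.2 h), L, L]
  constructor <;> intro h <;> linarith

theorem xc_comm (a b : V × V) : G.xc a b = G.xc b a := by
  rw [xc, xc, ← neg_sub (G.c a), ← neg_sub (G.m b), neg_div_neg_eq]

theorem xc_swap_right {a b : V × V} (hb : b ∈ G.A) : G.xc a b.swap = G.xc a b := by
  rw [xc, G.c_swap hb, m_swap, xc]

theorem xc_swap_left {a b : V × V} (ha : a ∈ G.A) : G.xc a.swap b = G.xc a b := by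
  rw [xc, G.c_swap ha, m_swap, xc]

theorem Cr.symm {G : Drawing V} {a b : V × V} (h : G.Cr a b) : G.Cr b a := by
  obtain ⟨h1, h2, h3, h4, h5⟩ := h
  exact ⟨h2, h1, h3.symm, by rwa [xc_comm], by rwa [xc_comm]⟩

theorem Cr.swap_right {G : Drawing V} {a b : V × V} (h : G.Cr a b) : G.Cr a b.swap := by
  obtain ⟨h1, h2, h3, h4, h5⟩ := h
  refine ⟨h1, G.swap_mem _ h2, by rwa [m_swap], ?_, ?_⟩
  · rwa [G.xc_swap_right h2]
  · rwa [G.xc_swap_right h2, inside_swap]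

theorem Cr.swap_left {G : Drawing V} {a b : V × V} (h : G.Cr a b) : G.Cr a.swap b :=
  h.symm.swap_right.symm

theorem cr_swap_left {a b : V × V} : G.Cr a.swap b ↔ G.Cr a b :=
  ⟨fun h => by simpa using h.swap_left, Cr.swap_left⟩

theorem mem_N {a : V × V} {u : ℝ} :
    u ∈ G.N a ↔ u = G.x a.1 ∨ u = G.x a.2 ∨ ∃ b, G.Cr a b ∧ G.xc a b = u := by
  simp only [N, Finset.mem_insert, Finset.mem_image, Finset.mem_filter]
  refine or_congr Iff.rfl (or_congr Iff.rfl (exists_congr fun b => ?_))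
  exact ⟨fun h => ⟨h.1.2, h.2⟩, fun h => ⟨⟨h.1.2.1, h.1⟩, h.2⟩⟩

theorem mem_N_swap {a : V × V} (ha : a ∈ G.A) {u : ℝ} : u ∈ G.N a.swap ↔ u ∈ G.N a := by
  simp only [mem_N, cr_swap_left, G.xc_swap_left ha, Prod.fst_swap, Prod.snd_swap]
  tauto

theorem inside_of_mem_N {a : V × V} {u : ℝ} (h : u ∈ G.N a) :
    u = G.x a.1 ∨ u = G.x a.2 ∨ G.Inside a u := by
  rcases G.mem_N.1 h with h | h | ⟨b, hb, rfl⟩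
  · exact Or.inl h
  · exact Or.inr (Or.inl h)
  · exact Or.inr (Or.inr hb.2.2.2.1)

theorem mem_N_of_cr {a b : V × V} {u : ℝ} (ha : a ∈ G.A) (hb : b ∈ G.A) (hm : G.m a ≠ G.m b)
    (h : G.L a u = G.L b u) (hia : G.Inside a u) (hib : G.Inside b u) :
    G.Cr a b ∧ G.xc a b = u := by
  have := (G.eq_xc hm).1 h
  subst this
  exact ⟨⟨ha, hb, hm, hia, hib⟩, rfl⟩

theorem vertex_on_line {a : V × V} (ha : a ∈ G.A) {v : V} (h : G.L a (G.x v) = G.y v) :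
    v = a.1 ∨ v = a.2 := by
  by_contra! hne
  refine G.gen a.1 a.2 v (G.ne a ha) hne.1.symm hne.2.symm ?_
  rw [← G.m_mul ha, ← h, L, c]
  ring

theorem eq_or_swap {a b : V × V} (ha : a ∈ G.A) (hb : b ∈ G.A) (hm : G.m a = G.m b) {u : ℝ}
    (hu : G.L a u = G.L b u) : b = a ∨ b = a.swap := by
  have hL : ∀ w, G.L a w = G.L b w := fun w => by
    rw [L, L, hm] at hu ⊢
    linarith
  have h1 := G.vertex_on_line ha (v := b.1) (by rw [hL, L_fst])
  have h2 := G.vertex_on_line ha (v := b.2) (by rw [hL, G.L_snd hb])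
  have h3 := G.ne b hb
  rcases h1 with h1 | h1 <;> rcases h2 with h2 | h2
  · exact absurd (h1.trans h2.symm) h3
  · exact Or.inl (Prod.ext h1 h2)
  · exact Or.inr (Prod.ext h1 h2)
  · exact absurd (h1.trans h2.symm) h3

/-- A position on the edge `a`, increasing along `a`. -/
def g (a : V × V) (u : ℝ) : ℝ := (G.x a.2 - G.x a.1) * u

theorem g_swap (a : V × V) (u : ℝ) : G.g a.swap u = - G.g a u := by
  simp only [g, Prod.fst_swap, Prod.snd_swap]; ring

theorem g_inj {a : V × V} (ha : a ∈ G.A) {u w : ℝ} (h : G.g a u = G.g a w) : u = w :=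
  mul_left_cancel₀ (G.x_ne ha) h

theorem g_fst_lt_snd {a : V × V} (ha : a ∈ G.A) : G.g a (G.x a.1) < G.g a (G.x a.2) := by
  have := mul_self_pos.2 (G.x_ne ha)
  simp only [g]
  linarith

theorem g_between {a : V × V} (ha : a ∈ G.A) {u : ℝ} :
    G.Inside a u ↔ G.g a (G.x a.1) < G.g a u ∧ G.g a u < G.g a (G.x a.2) := by
  have h0 := G.x_ne ha
  simp only [Inside, g]
  rcases lt_or_gt_of_ne h0 with h | h
  · rw [mul_lt_mul_left_of_neg h, mul_lt_mul_left_of_neg h, mul_neg_iff]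
    constructor
    · rintro (h | h) <;> constructor <;> linarith
    · rintro ⟨h1, h2⟩
      right; constructor <;> linarith
  · rw [mul_lt_mul_iff_right₀ h, mul_lt_mul_iff_right₀ h, mul_neg_iff]
    constructor
    · rintro (h | h) <;> constructor <;> linarith
    · rintro ⟨h1, h2⟩
      left; constructor <;> linarith

theorem g_le_of_mem_N {a : V × V} (ha : a ∈ G.A) {u : ℝ} (h : u ∈ G.N a) :
    G.g a (G.x a.1) ≤ G.g a u ∧ G.g a u ≤ G.g a (G.x a.2) := by
  have := G.g_fst_lt_snd ha
  rcases G.inside_of_mem_N h with rfl | rfl | h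
  · exact ⟨le_rfl, this.le⟩
  · exact ⟨this.le, le_rfl⟩
  · have := (G.g_between ha).1 h
    exact ⟨this.1.le, this.2.le⟩

theorem exists_next {a : V × V} (ha : a ∈ G.A) {t : ℝ} (ht : t ∈ G.N a) (hne : t ≠ G.x a.2) :
    ∃ u ∈ G.N a, G.g a t < G.g a u ∧ ∀ w ∈ G.N a, G.g a t < G.g a w → G.g a u ≤ G.g a w := by
  have hlt : G.g a t < G.g a (G.x a.2) :=
    lt_of_le_of_ne (G.g_le_of_mem_N ha ht).2 fun h => hne (G.g_inj ha h)
  obtain ⟨u, hu, hmin⟩ := Finset.exists_min_image ((G.N a).filter fun w => G.g a t < G.g a w)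
    (G.g a) ⟨G.x a.2, Finset.mem_filter.2 ⟨G.mem_N.2 (Or.inr (Or.inl rfl)), hlt⟩⟩
  rw [Finset.mem_filter] at hu
  exact ⟨u, hu.1, hu.2, fun w hw hlt => hmin w (Finset.mem_filter.2 ⟨hw, hlt⟩)⟩

/-- The darts of the planarisation: oriented edges together with the first coordinate of the tail
of the dart. -/
def Dart : Type _ := {d : (V × V) × ℝ // d.1 ∈ G.A ∧ d.2 ∈ G.N d.1 ∧ d.2 ≠ G.x d.1.2}

instance : Finite G.Dart := by
  refine Set.Finite.to_subtype (Set.Finite.subset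
    (Finset.finite_toSet (G.A.biUnion fun a => (G.N a).image fun u => (a, u))) ?_)
  rintro ⟨a, t⟩ ⟨h1, h2, -⟩
  simp only [Finset.coe_biUnion, Set.mem_iUnion, Finset.coe_image]
  exact ⟨a, h1, t, h2, rfl⟩

instance : Fintype G.Dart := Fintype.ofFinite _

namespace Dart

variable {G}

/-- The oriented edge containing a dart. -/
def e (d : G.Dart) : V × V := d.1.1

/-- The first coordinate of the tail of a dart. -/
def t (d : G.Dart) : ℝ := d.1.2

theorem e_mem (d : G.Dart) : d.e ∈ G.A := d.2.1

theorem t_mem (d : G.Dart) : d.t ∈ G.N d.e := d.2.2.1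

theorem t_ne (d : G.Dart) : d.t ≠ G.x d.e.2 := d.2.2.2

theorem ext' {d d' : G.Dart} (he : d.e = d'.e) (ht : d.t = d'.t) : d = d' :=
  Subtype.ext (Prod.ext he ht)

/-- The first coordinate of the head of a dart. -/
def hd (d : G.Dart) : ℝ := (G.exists_next d.e_mem d.t_mem d.t_ne).choose

theorem hd_spec (d : G.Dart) : d.hd ∈ G.N d.e ∧ G.g d.e d.t < G.g d.e d.hd ∧
    ∀ w ∈ G.N d.e, G.g d.e d.t < G.g d.e w → G.g d.e d.hd ≤ G.g d.e w :=
  (G.exists_next d.e_mem d.t_mem d.t_ne).choose_spec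

/-- The reversal of a dart. -/
def r (d : G.Dart) : G.Dart := by
  refine ⟨(d.e.swap, d.hd), G.swap_mem _ d.e_mem, (G.mem_N_swap d.e_mem).2 d.hd_spec.1, ?_⟩
  intro h
  have h1 := d.hd_spec.2.1
  have h2 := (G.g_le_of_mem_N d.e_mem d.t_mem).1
  have h3 : d.hd = G.x d.e.1 := h
  rw [h3] at h1
  linarith

theorem e_r (d : G.Dart) : d.r.e = d.e.swap := rfl

theorem t_r (d : G.Dart) : d.r.t = d.hd := rfl

theorem hd_r (d : G.Dart) : d.r.hd = d.t := by
  have h1 := d.hd_spec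
  have h2 := d.r.hd_spec
  simp only [e_r, t_r, G.g_swap, G.mem_N_swap d.e_mem, neg_lt_neg_iff, neg_le_neg_iff] at h2
  apply G.g_inj d.e_mem
  refine le_antisymm ?_ (h2.2.2 d.t d.t_mem h1.2.1)
  by_contra! hlt
  have := h1.2.2 _ h2.1 hlt
  linarith [h2.2.1]

theorem r_r (d : G.Dart) : d.r.r = d :=
  ext' (by rw [e_r, e_r, Prod.swap_swap]) (by rw [t_r, hd_r])

/-- The dart is directed to the right. -/
def Right (d : G.Dart) : Prop := G.x d.e.1 < G.x d.e.2

theorem right_r (d : G.Dart) : d.r.Right ↔ ¬ d.Right := by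
  have := G.x_ne d.e_mem
  rw [Right, Right, e_r, Prod.fst_swap, Prod.snd_swap, not_lt]
  constructor
  · exact le_of_lt
  · intro h
    exact lt_of_le_of_ne h fun h => this (by rw [h, sub_self])

theorem Right.t_lt_hd {d : G.Dart} (h : d.Right) : d.t < d.hd :=
  lt_of_mul_lt_mul_left d.hd_spec.2.1 (sub_pos.2 h).le

theorem Right.le_t {d : G.Dart} (h : d.Right) : G.x d.e.1 ≤ d.t :=
  le_of_mul_le_mul_left (G.g_le_of_mem_N d.e_mem d.t_mem).1 (sub_pos.2 h)

theorem Right.hd_le {d : G.Dart} (h : d.Right) : d.hd ≤ G.x d.e.2 :=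
  le_of_mul_le_mul_left (G.g_le_of_mem_N d.e_mem d.hd_spec.1).2 (sub_pos.2 h)

theorem Right.not_mem_N {d : G.Dart} (h : d.Right) {u : ℝ} (h1 : d.t < u) (h2 : u < d.hd) :
    u ∉ G.N d.e := fun hu => by
  have := d.hd_spec.2.2 u hu (mul_lt_mul_of_pos_left h1 (sub_pos.2 h))
  have := le_of_mul_le_mul_left this (sub_pos.2 h)
  linarith

theorem Right.inside {d : G.Dart} (h : d.Right) {u : ℝ} (h1 : d.t < u) (h2 : u < d.hd) :
    G.Inside d.e u :=
  mul_neg_of_pos_of_neg (by linarith [h.le_t]) (by linarith [h.hd_le])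

/-- The tail of a dart. -/
def pt (d : G.Dart) : ℝ × ℝ := (d.t, G.L d.e d.t)

theorem pt_r (d : G.Dart) : d.r.pt = (d.hd, G.L d.e d.hd) := by
  rw [pt, t_r, e_r, G.L_swap d.e_mem]

end Dart

end Drawing

namespace Drawing

variable {V : Type*} {G : Drawing V}

namespace Dart

theorem eq_of_e_eq {s d : G.Dart} (hs : s.Right) (hd : d.Right) (he : s.e = d.e) {u : ℝ}
    (h1 : s.t < u) (h2 : u < s.hd) (h3 : d.t < u) (h4 : u < d.hd) : s = d := by
  refine ext' he (le_antisymm ?_ ?_) <;> by_contra! hlt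
  · exact hd.not_mem_N hlt (by linarith) (he ▸ s.t_mem)
  · exact hs.not_mem_N hlt (by linarith) (he ▸ d.t_mem)

theorem Right.e_eq {s d : G.Dart} (hs : s.Right) (hd : d.Right)
    (h : d.e = s.e ∨ d.e = s.e.swap) : s.e = d.e := by
  rcases h with h | h
  · exact h.symm
  · exact absurd hs (by rw [Right, ← Prod.fst_swap (p := s.e), ← Prod.snd_swap (p := s.e), ← h]
                        exact not_lt.2 (le_of_lt hd))

theorem eq_of_meet {s d : G.Dart} (hs : s.Right) (hd : d.Right) {u : ℝ}
    (h1 : s.t < u) (h2 : u < s.hd) (h3 : d.t < u) (h4 : u < d.hd)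
    (hL : G.L s.e u = G.L d.e u) : s = d := by
  by_cases hm : G.m s.e = G.m d.e
  · exact eq_of_e_eq hs hd (hs.e_eq hd (G.eq_or_swap s.e_mem d.e_mem hm hL)) h1 h2 h3 h4
  · have := G.mem_N_of_cr s.e_mem d.e_mem hm hL (hs.inside h1 h2) (hd.inside h3 h4)
    exact absurd (G.mem_N.2 (Or.inr (Or.inr ⟨_, this⟩))) (hs.not_mem_N h1 h2)

theorem not_meet_of_mem_N {s d : G.Dart} (hs : s.Right) (hd : d.Right) {w : ℝ}
    (h1 : d.t < w) (h2 : w < d.hd) (hw : w ∈ G.N s.e) : G.L s.e w ≠ G.L d.e w := by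
  intro hL
  have key : ∀ v, w = G.x v → G.L s.e w = G.y v → False := by
    rintro v rfl hv
    apply hd.not_mem_N h1 h2
    rcases G.vertex_on_line d.e_mem (hL ▸ hv) with rfl | rfl
    · exact G.mem_N.2 (Or.inl rfl)
    · exact G.mem_N.2 (Or.inr (Or.inl rfl))
  rcases G.inside_of_mem_N hw with h | h | h
  · exact key _ h (by rw [h, G.L_fst])
  · exact key _ h (by rw [h, G.L_snd s.e_mem])
  · by_cases hm : G.m s.e = G.m d.e
    · have := hs.e_eq hd (G.eq_or_swap s.e_mem d.e_mem hm hL)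
      exact hd.not_mem_N h1 h2 (this ▸ hw)
    · have := G.mem_N_of_cr d.e_mem s.e_mem (Ne.symm hm) hL.symm (hd.inside h1 h2) h
      exact hd.not_mem_N h1 h2 (G.mem_N.2 (Or.inr (Or.inr ⟨_, this⟩)))

/-- The dart `s` lies above the dart `d` somewhere. -/
def Above (s d : G.Dart) : Prop :=
  s ≠ d ∧ ∃ u, s.t < u ∧ u < s.hd ∧ d.t < u ∧ u < d.hd ∧ G.L d.e u < G.L s.e u

theorem above_or_above {s d : G.Dart} (hs : s.Right) (hd : d.Right) (hne : s ≠ d)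
    (h1 : s.t < d.hd) (h2 : d.t < s.hd) : Above s d ∨ Above d s := by
  obtain ⟨u, hu1, hu2⟩ := exists_between
    (max_lt (lt_min hs.t_lt_hd h1) (lt_min h2 hd.t_lt_hd))
  rw [max_lt_iff] at hu1
  rw [lt_min_iff] at hu2
  rcases lt_trichotomy (G.L s.e u) (G.L d.e u) with h | h | h
  · exact Or.inr ⟨hne.symm, u, hu1.2, hu2.2, hu1.1, hu2.1, h⟩
  · exact absurd (eq_of_meet hs hd hu1.1 hu2.1 hu1.2 hu2.2 h) hne
  · exact Or.inl ⟨hne, u, hu1.1, hu2.1, hu1.2, hu2.2, h⟩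

theorem Above.le {s d : G.Dart} (hs : s.Right) (hd : d.Right) (h : Above s d) {w : ℝ}
    (h1 : s.t ≤ w) (h2 : w ≤ s.hd) (h3 : d.t ≤ w) (h4 : w ≤ d.hd) :
    G.L d.e w ≤ G.L s.e w := by
  obtain ⟨hne, u, hu1, hu2, hu3, hu4, hlt⟩ := h
  by_contra! hw
  set p := G.L s.e u - G.L d.e u with hp
  set q := G.L d.e w - G.L s.e w with hq
  have hp0 : 0 < p := by linarith
  have hq0 : 0 < q := by linarith
  have hpq : 0 < p + q := by linarith
  have hv : ∀ k, k ≤ u → k ≤ w → k < u → k < (q * u + p * w) / (p + q) := fun k h1 h2 h3 => by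
    rw [lt_div_iff₀ hpq]; nlinarith
  have hv' : ∀ k, u ≤ k → w ≤ k → u < k → (q * u + p * w) / (p + q) < k := fun k h1 h2 h3 => by
    rw [div_lt_iff₀ hpq]; nlinarith
  refine hne (eq_of_meet hs hd (u := (q * u + p * w) / (p + q)) (hv _ hu1.le h1 hu1)
    (hv' _ hu2.le h2 hu2) (hv _ hu3.le h3 hu3) (hv' _ hu4.le h4 hu4) ?_)
  have hmul : (q * u + p * w) / (p + q) * (p + q) = q * u + p * w :=
    div_mul_cancel₀ _ hpq.ne'
  apply mul_right_cancel₀ hpq.ne'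
  simp only [L] at hp hq ⊢
  linear_combination (G.m s.e - G.m d.e) * hmul + p * hq - q * hp

theorem Above.overlap {s d : G.Dart} (h : Above s d) : s.t < d.hd ∧ d.t < s.hd := by
  obtain ⟨-, u, h1, h2, h3, h4, -⟩ := h
  exact ⟨h1.trans h4, h3.trans h2⟩

/-- Being above is decided at any common abscissa where the two lines differ. -/
theorem above_iff {s d : G.Dart} (hs : s.Right) (hd : d.Right) {w : ℝ}
    (h1 : s.t < d.hd) (h2 : d.t < s.hd)
    (hw1 : s.t ≤ w) (hw2 : w ≤ s.hd) (hw3 : d.t ≤ w) (hw4 : w ≤ d.hd)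
    (hne : G.L s.e w ≠ G.L d.e w) : Above s d ↔ G.L d.e w < G.L s.e w := by
  have hsd : s ≠ d := fun h => hne (by rw [h])
  constructor
  · intro h
    exact lt_of_le_of_ne (h.le hs hd hw1 hw2 hw3 hw4) hne.symm
  · intro h
    rcases above_or_above hs hd hsd h1 h2 with h' | h'
    · exact h'
    · exact absurd (h'.le hd hs hw3 hw4 hw1 hw2) (not_le.2 h)

/-- The open half strip above the dart `d`. -/
def Strip (d : G.Dart) (p : ℝ × ℝ) : Prop := d.t < p.1 ∧ p.1 < d.hd ∧ G.L d.e p.1 < p.2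

theorem strip_balance {s d : G.Dart} (hs : s.Right) (hd : d.Right) :
    (if s.t ≤ d.t ∧ d.t < s.hd ∧ Above s d then (1 : ℝ) else 0) + (if d.Strip s.pt then 1 else 0)
      = (if s.t < d.hd ∧ d.hd ≤ s.hd ∧ Above s d then 1 else 0) +
        (if d.Strip s.r.pt then 1 else 0) := by
  have hs' := hs.t_lt_hd
  have hd' := hd.t_lt_hd
  have ht : ∀ (_ : d.t < s.t) (_ : s.t < d.hd), (Above s d ↔ G.L d.e s.t < G.L s.e s.t) :=
    fun h1 h2 => above_iff hs hd h2 (h1.trans hs') le_rfl hs'.le h1.le h2.le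
      (not_meet_of_mem_N hs hd h1 h2 s.t_mem)
  have hh : ∀ (_ : d.t < s.hd) (_ : s.hd < d.hd), (Above s d ↔ G.L d.e s.hd < G.L s.e s.hd) :=
    fun h1 h2 => above_iff hs hd (hs'.trans h2) h1 hs'.le le_rfl h1.le h2.le
      (not_meet_of_mem_N hs hd h1 h2 s.hd_spec.1)
  have h1 : d.Strip s.pt ↔ d.t < s.t ∧ s.t < d.hd ∧ Above s d := by
    rw [Strip, pt]
    exact and_congr_right fun a => and_congr_right fun b => (ht a b).symm
  have h2 : d.Strip s.r.pt ↔ d.t < s.hd ∧ s.hd < d.hd ∧ Above s d := by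
    rw [Strip, pt_r]
    exact and_congr_right fun a => and_congr_right fun b => (hh a b).symm
  rw [if_congr h1 rfl rfl, if_congr h2 rfl rfl]
  by_cases ha : Above s d
  · obtain ⟨o1, o2⟩ := ha.overlap
    simp only [ha, and_true, o1, o2, true_and]
    have e1 : d.t < s.t ↔ ¬ s.t ≤ d.t := not_le.symm
    have e2 : s.hd < d.hd ↔ ¬ d.hd ≤ s.hd := not_le.symm
    simp only [e1, e2]
    split_ifs <;> first | contradiction | norm_num
  · simp [ha]

/-- The dart `s` covers the abscissa of `p` (including its tail) and lies above `p`. -/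
def Over (s : G.Dart) (p : ℝ × ℝ) : Prop := s.t ≤ p.1 ∧ p.1 < s.hd ∧ p.2 < G.L s.e p.1

/-- The dart `s` covers the abscissa of `p` (including its head) and lies above `p`. -/
def OverL (s : G.Dart) (p : ℝ × ℝ) : Prop := s.t < p.1 ∧ p.1 ≤ s.hd ∧ p.2 < G.L s.e p.1

/-- The open vertical ray above `p`. -/
def Ray (p q : ℝ × ℝ) : Prop := q.1 = p.1 ∧ p.2 < q.2

theorem over_balance {s : G.Dart} (hs : s.Right) (p : ℝ × ℝ) :
    (if s.Over p then (1 : ℝ) else 0) + (if Ray p s.r.pt then 1 else 0)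
      = (if s.OverL p then 1 else 0) + (if Ray p s.pt then 1 else 0) := by
  have hs' := hs.t_lt_hd
  have h1 : Ray p s.pt ↔ s.t = p.1 ∧ p.2 < G.L s.e p.1 := by
    rw [Ray, pt]; exact and_congr_right fun h => by rw [← h]
  have h2 : Ray p s.r.pt ↔ s.hd = p.1 ∧ p.2 < G.L s.e p.1 := by
    rw [Ray, pt_r]; exact and_congr_right fun h => by rw [← h]
  rw [if_congr h1 rfl rfl, if_congr h2 rfl rfl, Over, OverL]
  by_cases ha : p.2 < G.L s.e p.1
  · simp only [ha, and_true]
    grind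
  · simp [ha]

theorem eq_of_pt_eq {s d : G.Dart} (hs : s.Right) (hd : d.Right) (h : s.pt = d.pt)
    (hm : G.m s.e = G.m d.e) : s = d := by
  rw [pt, pt, Prod.mk.injEq] at h
  have : G.L s.e s.t = G.L d.e s.t := by rw [h.2, h.1]
  exact ext' (hs.e_eq hd (G.eq_or_swap s.e_mem d.e_mem hm this)) h.1

theorem eq_of_pt_r_eq {s d : G.Dart} (hs : s.Right) (hd : d.Right) (h : s.r.pt = d.r.pt)
    (hm : G.m s.e = G.m d.e) : s = d := by
  rw [pt_r, pt_r, Prod.mk.injEq] at h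
  have : G.L s.e s.hd = G.L d.e s.hd := by rw [h.2, h.1]
  have he := hs.e_eq hd (G.eq_or_swap s.e_mem d.e_mem hm this)
  have : s.r = d.r := ext' (by rw [e_r, e_r, he]) h.1
  rw [← s.r_r, this, r_r]

theorem tail_balance {s d : G.Dart} (hs : s.Right) (hd : d.Right) :
    (if s.t ≤ d.t ∧ d.t < s.hd ∧ Above s d then (1 : ℝ) else 0)
      = (if s.Over d.pt then 1 else 0) +
        (if s.pt = d.pt ∧ G.m d.e < G.m s.e then 1 else 0) := by
  have hs' := hs.t_lt_hd
  have hd' := hd.t_lt_hd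
  by_cases hpt : s.pt = d.pt
  · have h := hpt
    rw [pt, pt, Prod.mk.injEq] at h
    have hov : ¬ s.Over d.pt := by
      rintro ⟨-, -, h'⟩
      simp only [pt, ← h.1] at h'
      rw [h.2, ← h.1] at h'
      exact lt_irrefl _ h'
    have : (s.t ≤ d.t ∧ d.t < s.hd ∧ Above s d) ↔ G.m d.e < G.m s.e := by
      have hL : ∀ u, G.L s.e u - G.L d.e u = (G.m s.e - G.m d.e) * (u - d.t) := fun u => by
        have := h.2
        simp only [L] at this ⊢
        rw [h.1] at this
        linarith
      constructor
      · rintro ⟨-, -, -, u, h1, h2, h3, h4, h5⟩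
        have := hL u
        by_contra! hm
        nlinarith
      · intro hm
        have hne : s ≠ d := fun h => by rw [h] at hm; exact lt_irrefl _ hm
        refine ⟨h.1.le, h.1 ▸ hs', ?_⟩
        rcases above_or_above hs hd hne (h.1 ▸ hd') (h.1 ▸ hs') with h' | ⟨-, u, h1, h2, h3, h4, h5⟩
        · exact h'
        · have := hL u
          nlinarith
    simp only [this, hov, hpt, true_and, if_false, zero_add]
  · have : (s.t ≤ d.t ∧ d.t < s.hd ∧ Above s d) ↔ s.Over d.pt := by
      rw [Over]
      refine and_congr_right fun h1 => and_congr_right fun h2 => ?_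
      refine above_iff hs hd (lt_of_le_of_lt h1 hd') h2 h1 h2.le le_rfl hd'.le ?_
      rcases h1.eq_or_lt with h1 | h1
      · intro h
        exact hpt (by rw [pt, pt, ← h, h1])
      · exact (not_meet_of_mem_N hd hs h1 h2 d.t_mem).symm
    simp only [this, hpt, false_and, if_false, add_zero]

theorem head_balance {s d : G.Dart} (hs : s.Right) (hd : d.Right) :
    (if s.t < d.hd ∧ d.hd ≤ s.hd ∧ Above s d then (1 : ℝ) else 0)
      = (if s.OverL d.r.pt then 1 else 0) +
        (if s.r.pt = d.r.pt ∧ G.m s.e < G.m d.e then 1 else 0) := by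
  have hs' := hs.t_lt_hd
  have hd' := hd.t_lt_hd
  by_cases hpt : s.r.pt = d.r.pt
  · have h := hpt
    rw [pt_r, pt_r, Prod.mk.injEq] at h
    have hov : ¬ s.OverL d.r.pt := by
      rintro ⟨-, -, h'⟩
      simp only [pt_r, ← h.1] at h'
      rw [h.2, ← h.1] at h'
      exact lt_irrefl _ h'
    have : (s.t < d.hd ∧ d.hd ≤ s.hd ∧ Above s d) ↔ G.m s.e < G.m d.e := by
      have hL : ∀ u, G.L s.e u - G.L d.e u = (G.m s.e - G.m d.e) * (u - d.hd) := fun u => by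
        have := h.2
        simp only [L] at this ⊢
        rw [h.1] at this
        linarith
      constructor
      · rintro ⟨-, -, -, u, h1, h2, h3, h4, h5⟩
        have := hL u
        by_contra! hm
        nlinarith
      · intro hm
        have hne : s ≠ d := fun h => by rw [h] at hm; exact lt_irrefl _ hm
        refine ⟨h.1 ▸ hs', h.1.ge, ?_⟩
        rcases above_or_above hs hd hne (h.1 ▸ hs') (h.1 ▸ hd') with h' | ⟨-, u, h1, h2, h3, h4, h5⟩
        · exact h'
        · have := hL u
          nlinarith
    simp only [this, hov, hpt, true_and, if_false, zero_add]
  · have : (s.t < d.hd ∧ d.hd ≤ s.hd ∧ Above s d) ↔ s.OverL d.r.pt := by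
      rw [OverL, pt_r]
      refine and_congr_right fun h1 => and_congr_right fun h2 => ?_
      refine above_iff hs hd h1 (lt_of_lt_of_le hd' h2) h1.le h2 hd'.le le_rfl ?_
      rcases h2.eq_or_lt with h2 | h2
      · intro h
        exact hpt (by rw [pt_r, pt_r, ← h, ← h2])
      · exact (not_meet_of_mem_N hd hs h1 h2 d.hd_spec.1).symm
    simp only [this, hpt, false_and, if_false, add_zero]

end Dart

end Drawing

section Cyclic

variable {D P : Type*} (pt : D → P) (key : D → ℝ)

/-- `o'` follows `o` in the cyclic order by `key` on the fibre of `pt` through `o`. -/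
def CycSucc (o o' : D) : Prop :=
  pt o' = pt o ∧
    ((key o < key o' ∧ ∀ w, pt w = pt o → key o < key w → key o' ≤ key w) ∨
      ((∀ w, pt w = pt o → key w ≤ key o) ∧ ∀ w, pt w = pt o → key o' ≤ key w))

theorem CycSucc.unique {pt : D → P} {key : D → ℝ}
    (hinj : ∀ a b, pt a = pt b → key a = key b → a = b) {o o₁ o₂ : D}
    (h₁ : CycSucc pt key o o₁) (h₂ : CycSucc pt key o o₂) : o₁ = o₂ := by
  obtain ⟨p₁, h₁⟩ := h₁
  obtain ⟨p₂, h₂⟩ := h₂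
  refine hinj _ _ (p₁.trans p₂.symm) ?_
  rcases h₁ with ⟨a₁, b₁⟩ | ⟨a₁, b₁⟩ <;> rcases h₂ with ⟨a₂, b₂⟩ | ⟨a₂, b₂⟩
  · exact le_antisymm (b₁ _ p₂ a₂) (b₂ _ p₁ a₁)
  · exact absurd (a₂ _ p₁) (not_le.2 a₁)
  · exact absurd (a₁ _ p₂) (not_le.2 a₂)
  · exact le_antisymm (b₁ _ p₂) (b₂ _ p₁)

variable [Fintype D]

theorem exists_cycSucc (o : D) : ∃ o', CycSucc pt key o o' := by
  by_cases h : ∃ w, pt w = pt o ∧ key o < key w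
  · obtain ⟨w, hw⟩ := h
    obtain ⟨o', ho', hmin⟩ := Finset.exists_min_image
      (Finset.univ.filter fun w => pt w = pt o ∧ key o < key w) key ⟨w, by simpa using hw⟩
    simp only [Finset.mem_filter, Finset.mem_univ, true_and] at ho' hmin
    exact ⟨o', ho'.1, Or.inl ⟨ho'.2, fun w h1 h2 => hmin w ⟨h1, h2⟩⟩⟩
  · push Not at h
    obtain ⟨o', ho', hmin⟩ := Finset.exists_min_image
      (Finset.univ.filter fun w => pt w = pt o) key ⟨o, by simp⟩
    simp only [Finset.mem_filter, Finset.mem_univ, true_and] at ho' hmin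
    exact ⟨o', ho', Or.inr ⟨h, hmin⟩⟩

/-- The cyclic successor by `key` within the fibres of `pt`. -/
def cycNext (o : D) : D := (exists_cycSucc pt key o).choose

theorem cycNext_spec (o : D) : CycSucc pt key o (cycNext pt key o) :=
  (exists_cycSucc pt key o).choose_spec

variable {pt key}

theorem cycNext_eq (hinj : ∀ a b, pt a = pt b → key a = key b → a = b) {o o' : D}
    (h : CycSucc pt key o o') : cycNext pt key o = o' :=
  (cycNext_spec pt key o).unique hinj h

theorem cycNext_injective (hinj : ∀ a b, pt a = pt b → key a = key b → a = b) :
    Function.Injective (cycNext pt key) := by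
  intro a b hab
  obtain ⟨p₁, h₁⟩ := cycNext_spec pt key a
  obtain ⟨p₂, h₂⟩ := cycNext_spec pt key b
  rw [← hab] at p₂ h₂
  have hp : pt a = pt b := p₁.symm.trans p₂
  refine hinj _ _ hp ?_
  rcases h₁ with ⟨a₁, b₁⟩ | ⟨a₁, b₁⟩ <;> rcases h₂ with ⟨a₂, b₂⟩ | ⟨a₂, b₂⟩
  · by_contra hne
    rcases lt_or_gt_of_ne hne with h | h
    · exact absurd (b₁ _ hp.symm h) (not_le.2 a₂)
    · exact absurd (b₂ _ hp h) (not_le.2 a₁)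
  · exact absurd (b₂ _ hp) (not_le.2 a₁)
  · exact absurd (b₁ _ hp.symm) (not_le.2 a₂)
  · exact le_antisymm (a₂ _ hp) (a₁ _ hp.symm)

theorem eq_of_cycNext_eq (hinj : ∀ a b, pt a = pt b → key a = key b → a = b) {o w : D}
    (h : cycNext pt key o = o) (hw : pt w = pt o) : w = o := by
  obtain ⟨-, h'⟩ := cycNext_spec pt key o
  rw [h] at h'
  rcases h' with ⟨h', -⟩ | ⟨h1, h2⟩
  · exact absurd h' (lt_irrefl _)
  · exact hinj _ _ hw (le_antisymm (h1 _ hw) (h2 _ hw))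

theorem sum_lt_cycNext (hinj : ∀ a b, pt a = pt b → key a = key b → a = b) (g : D → ℝ) (o : D)
    (h0 : ∑ w with pt w = pt o, g w = 0) :
    (∑ w with pt w = pt o ∧ key w < key (cycNext pt key o), g w) =
      (∑ w with pt w = pt o ∧ key w < key o, g w) + g o := by
  have hins : (insert o (Finset.univ.filter fun w => pt w = pt o ∧ key w < key o)) =
      Finset.univ.filter fun w => pt w = pt o ∧ key w ≤ key o := by
    ext w
    simp only [Finset.mem_insert, Finset.mem_filter, Finset.mem_univ, true_and]
    constructor
    · rintro (rfl | h)
      · exact ⟨rfl, le_rfl⟩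
      · exact ⟨h.1, h.2.le⟩
    · rintro ⟨h1, h2⟩
      rcases h2.eq_or_lt with h2 | h2
      · exact Or.inl (hinj _ _ h1 h2)
      · exact Or.inr ⟨h1, h2⟩
  rw [add_comm, ← Finset.sum_insert (by simp), hins]
  obtain ⟨p, h⟩ := cycNext_spec pt key o
  rcases h with ⟨h1, h2⟩ | ⟨h1, h2⟩
  · refine Finset.sum_congr (Finset.filter_congr fun w _ => and_congr_right fun hw => ?_)
      fun _ _ => rfl
    constructor
    · intro h
      by_contra! hlt
      exact absurd (h2 w hw hlt) (not_le.2 h)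
    · exact fun h => lt_of_le_of_lt h h1
  · have e1 : (Finset.univ.filter fun w => pt w = pt o ∧ key w < key (cycNext pt key o)) = ∅ :=
      Finset.filter_eq_empty_iff.2 fun w _ h => absurd (h2 w h.1) (not_le.2 h.2)
    have e2 : (Finset.univ.filter fun w => pt w = pt o ∧ key w ≤ key o) =
        Finset.univ.filter fun w => pt w = pt o :=
      Finset.filter_congr fun w _ => ⟨fun h => h.1, fun h => ⟨h, h1 w h⟩⟩
    rw [e1, e2, h0, Finset.sum_empty]

end Cyclic

namespace Drawing

variable {V : Type*} {G : Drawing V}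

/-- The edge through a crossing is determined by any edge crossing it there. -/
def NoTriple (G : Drawing V) : Prop :=
  ∀ a b c, G.Cr a b → G.Cr a c → G.xc a b = G.xc a c → c = b ∨ c = b.swap

namespace Dart

/-- Sorts the darts with a common tail in clockwise order, starting from the upward direction. -/
def key (d : G.Dart) : ℝ :=
  if d.Right then - Real.arctan (G.m d.e) else Real.pi - Real.arctan (G.m d.e)

theorem key_right {d : G.Dart} (h : d.Right) : d.key = - Real.arctan (G.m d.e) := if_pos h

theorem key_left {d : G.Dart} (h : ¬ d.Right) : d.key = Real.pi - Real.arctan (G.m d.e) := if_neg h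

theorem key_lt_of_right_left {o d : G.Dart} (ho : o.Right) (hd : ¬ d.Right) : o.key < d.key := by
  rw [key_right ho, key_left hd]
  linarith [Real.neg_pi_div_two_lt_arctan (G.m o.e), Real.arctan_lt_pi_div_two (G.m d.e)]

theorem key_lt_right {o d : G.Dart} (ho : o.Right) (hd : d.Right) :
    o.key < d.key ↔ G.m d.e < G.m o.e := by
  rw [key_right ho, key_right hd, neg_lt_neg_iff, Real.arctan_strictMono.lt_iff_lt]

theorem key_lt_left {o d : G.Dart} (ho : ¬ o.Right) (hd : ¬ d.Right) :
    o.key < d.key ↔ G.m d.e < G.m o.e := by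
  rw [key_left ho, key_left hd, sub_lt_sub_iff_left, Real.arctan_strictMono.lt_iff_lt]

theorem key_inj (o d : G.Dart) (hp : o.pt = d.pt) (hk : o.key = d.key) : o = d := by
  by_cases ho : o.Right <;> by_cases hd : d.Right
  · rw [key_right ho, key_right hd, neg_inj] at hk
    exact eq_of_pt_eq ho hd hp (Real.arctan_injective hk)
  · exact absurd hk (key_lt_of_right_left ho hd).ne
  · exact absurd hk (key_lt_of_right_left hd ho).ne'
  · rw [key_left ho, key_left hd, sub_right_inj] at hk
    rw [← o.r_r, ← d.r_r]
    congr 1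
    refine eq_of_pt_r_eq ((right_r o).2 ho) ((right_r d).2 hd) (by rwa [r_r, r_r]) ?_
    rw [e_r, e_r, m_swap, m_swap]
    exact Real.arctan_injective hk

/-- The next dart in clockwise order around the tail. -/
def cyc (d : G.Dart) : G.Dart := cycNext pt key d

theorem cyc_injective : Function.Injective (cyc (G := G)) := cycNext_injective key_inj

theorem pt_cyc (d : G.Dart) : d.cyc.pt = d.pt := (cycNext_spec pt key d).1

theorem exists_cyc (d : G.Dart) : ∃ o : G.Dart, o.cyc = d :=
  (Finite.injective_iff_surjective.1 cyc_injective) d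

/-- The next dart of the face on the left. -/
def f (d : G.Dart) : G.Dart := d.r.cyc

/-- The previous dart of the face on the left. -/
def b (d : G.Dart) : G.Dart := (exists_cyc d).choose.r

theorem cyc_r_b (d : G.Dart) : d.b.r.cyc = d := by
  rw [b, r_r]
  exact (exists_cyc d).choose_spec

theorem f_b (d : G.Dart) : d.b.f = d := cyc_r_b d

theorem b_f (d : G.Dart) : d.f.b = d := by
  have := cyc_injective (cyc_r_b d.f)
  rw [← r_r d.f.b, this, r_r]

/-- The tail of the dart is a crossing. -/
def TailX (d : G.Dart) : Prop := ∀ v, d.pt ≠ (G.x v, G.y v)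

theorem TailX.inside {d : G.Dart} (h : d.TailX) : G.Inside d.e d.t := by
  rcases G.inside_of_mem_N d.t_mem with h1 | h1 | h1
  · exact absurd (by rw [pt, h1, G.L_fst]) (h d.e.1)
  · exact absurd h1 d.t_ne
  · exact h1

/-- The dart on a given edge starting at a given node in the interior of the edge. -/
def ofInside (a : V × V) (u : ℝ) (ha : a ∈ G.A) (hu : u ∈ G.N a) (hi : G.Inside a u) : G.Dart :=
  ⟨(a, u), ha, hu, fun h => by
    change u = G.x a.2 at h
    rw [Inside, h] at hi
    simp at hi⟩

/-- A dart starting at the first end point of a given edge. -/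
def start (a : V × V) (ha : a ∈ G.A) : G.Dart :=
  ⟨(a, G.x a.1), ha, G.mem_N.2 (Or.inl rfl), fun h => G.ne a ha (G.x_inj h)⟩

theorem pt_start (a : V × V) (ha : a ∈ G.A) : (start a ha).pt = (G.x a.1, G.y a.1) :=
  Prod.ext rfl (G.L_fst a)

theorem exists_right_edge {d : G.Dart} (h : d.TailX) :
    ∃ p q, G.x p.1 < G.x p.2 ∧ G.x q.1 < G.x q.2 ∧ G.m q < G.m p ∧ G.Cr p q ∧ G.xc p q = d.t ∧
      (d.e = p ∨ d.e = q ∨ d.e = p.swap ∨ d.e = q.swap) := by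
  have hr : ∀ a ∈ G.A, ∃ p, G.x p.1 < G.x p.2 ∧ (p = a ∨ p = a.swap) := fun a ha => by
    rcases lt_or_gt_of_ne (sub_ne_zero.1 (G.x_ne ha)) with h | h
    · exact ⟨a.swap, h, Or.inr rfl⟩
    · exact ⟨a, h, Or.inl rfl⟩
  rcases G.mem_N.1 d.t_mem with h1 | h1 | ⟨c, hc, hxc⟩
  · exact absurd (by rw [pt, h1, G.L_fst]) (h d.e.1)
  · exact absurd h1 d.t_ne
  · obtain ⟨p, hp, hp'⟩ := hr _ hc.1
    obtain ⟨q, hq, hq'⟩ := hr _ hc.2.1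
    have hcr : G.Cr p q ∧ G.xc p q = d.t := by
      rcases hp' with rfl | rfl <;> rcases hq' with rfl | rfl
      · exact ⟨hc, hxc⟩
      · exact ⟨hc.swap_right, by rw [G.xc_swap_right hc.2.1, hxc]⟩
      · exact ⟨hc.swap_left, by rw [G.xc_swap_left hc.1, hxc]⟩
      · exact ⟨hc.swap_left.swap_right, by
          rw [G.xc_swap_right hc.2.1, G.xc_swap_left hc.1, hxc]⟩
    have he : d.e = p ∨ d.e = p.swap := by
      rcases hp' with rfl | rfl
      · exact Or.inl rfl
      · exact Or.inr (Prod.swap_swap _).symm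
    rcases lt_or_gt_of_ne hcr.1.2.2.1 with hm | hm
    · refine ⟨q, p, hq, hp, hm, hcr.1.symm, by rw [xc_comm, hcr.2], ?_⟩
      tauto
    · refine ⟨p, q, hp, hq, hm, hcr.1, hcr.2, ?_⟩
      tauto

theorem exists_cross (hG : G.NoTriple) {d : G.Dart} (h : d.TailX) :
    ∃ o₁ o₂ o₃ o₄ : G.Dart, o₁.cyc = o₂ ∧ o₂.cyc = o₃ ∧ o₃.cyc = o₄ ∧ o₄.cyc = o₁ ∧
      o₃.e = o₁.e.swap ∧ o₄.e = o₂.e.swap ∧ G.Cr o₁.e o₂.e ∧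
      [o₁, o₂, o₃, o₄].Nodup ∧ o₁.pt = d.pt ∧ (d = o₁ ∨ d = o₂ ∨ d = o₃ ∨ d = o₄) := by
  obtain ⟨p, q, hp, hq, hm, hcr, hxc, he⟩ := exists_right_edge h
  have hpA := hcr.1
  have hqA := hcr.2.1
  have hip : G.Inside p d.t := hxc ▸ hcr.2.2.2.1
  have hiq : G.Inside q d.t := hxc ▸ hcr.2.2.2.2
  have hLpq : G.L p d.t = G.L q d.t := (G.eq_xc hm.ne').2 hxc.symm
  have hNp : d.t ∈ G.N p := G.mem_N.2 (Or.inr (Or.inr ⟨q, hcr, hxc⟩))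
  have hNq : d.t ∈ G.N q := G.mem_N.2 (Or.inr (Or.inr ⟨p, hcr.symm, by rw [xc_comm, hxc]⟩))
  have hL : G.L d.e d.t = G.L p d.t := by
    rcases he with he | he | he | he <;> rw [he]
    · rw [hLpq]
    · rw [G.L_swap hpA]
    · rw [G.L_swap hqA, hLpq]
  let o₁ : G.Dart := ofInside p d.t hpA hNp hip
  let o₂ : G.Dart := ofInside q d.t hqA hNq hiq
  let o₃ : G.Dart := ofInside p.swap d.t (G.swap_mem _ hpA) ((G.mem_N_swap hpA).2 hNp)
    ((G.inside_swap p _).2 hip)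
  let o₄ : G.Dart := ofInside q.swap d.t (G.swap_mem _ hqA) ((G.mem_N_swap hqA).2 hNq)
    ((G.inside_swap q _).2 hiq)
  have pt₁ : o₁.pt = d.pt := Prod.ext rfl hL.symm
  have pt₂ : o₂.pt = d.pt := Prod.ext rfl (hLpq.symm.trans hL.symm)
  have pt₃ : o₃.pt = d.pt := Prod.ext rfl ((G.L_swap hpA _).trans hL.symm)
  have pt₄ : o₄.pt = d.pt := Prod.ext rfl ((G.L_swap hqA _).trans (hLpq.symm.trans hL.symm))
  have R₁ : o₁.Right := hp
  have R₂ : o₂.Right := hq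
  have R₃ : ¬ o₃.Right := not_lt.2 (le_of_lt hp)
  have R₄ : ¬ o₄.Right := not_lt.2 (le_of_lt hq)
  have k₁₂ : o₁.key < o₂.key := (key_lt_right R₁ R₂).2 hm
  have k₂₃ : o₂.key < o₃.key := key_lt_of_right_left R₂ R₃
  have k₃₄ : o₃.key < o₄.key := (key_lt_left R₃ R₄).2 (by
    change G.m q.swap < G.m p.swap
    rwa [m_swap, m_swap])
  have hall : ∀ w : G.Dart, w.pt = d.pt → w = o₁ ∨ w = o₂ ∨ w = o₃ ∨ w = o₄ := by
    intro w hw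
    have hwX : w.TailX := fun v => hw ▸ h v
    have hwt : w.t = d.t := congrArg Prod.fst hw
    have hwL : G.L w.e d.t = G.L p d.t := by
      have : G.L w.e w.t = G.L d.e d.t := congrArg Prod.snd hw
      rw [← hL, ← this, hwt]
    by_cases hmw : G.m p = G.m w.e
    · rcases G.eq_or_swap hpA w.e_mem hmw hwL.symm with h' | h'
      · exact Or.inl (ext' h' hwt)
      · exact Or.inr (Or.inr (Or.inl (ext' h' hwt)))
    · have h1 := G.mem_N_of_cr hpA w.e_mem hmw hwL.symm hip (hwt ▸ hwX.inside)
      rcases hG p q w.e hcr h1.1 (hxc.trans h1.2.symm) with h' | h'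
      · exact Or.inr (Or.inl (ext' h' hwt))
      · exact Or.inr (Or.inr (Or.inr (ext' h' hwt)))
  have c₁ : o₁.cyc = o₂ := cycNext_eq key_inj ⟨pt₂.trans pt₁.symm, Or.inl ⟨k₁₂, fun w hw hlt => by
    rcases hall w (hw.trans pt₁) with rfl | rfl | rfl | rfl <;> linarith⟩⟩
  have c₂ : o₂.cyc = o₃ := cycNext_eq key_inj ⟨pt₃.trans pt₂.symm, Or.inl ⟨k₂₃, fun w hw hlt => by
    rcases hall w (hw.trans pt₂) with rfl | rfl | rfl | rfl <;> linarith⟩⟩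
  have c₃ : o₃.cyc = o₄ := cycNext_eq key_inj ⟨pt₄.trans pt₃.symm, Or.inl ⟨k₃₄, fun w hw hlt => by
    rcases hall w (hw.trans pt₃) with rfl | rfl | rfl | rfl <;> linarith⟩⟩
  have c₄ : o₄.cyc = o₁ := cycNext_eq key_inj ⟨pt₁.trans pt₄.symm, Or.inr ⟨fun w hw => by
    rcases hall w (hw.trans pt₄) with rfl | rfl | rfl | rfl <;> linarith, fun w hw => by
    rcases hall w (hw.trans pt₄) with rfl | rfl | rfl | rfl <;> linarith⟩⟩
  refine ⟨o₁, o₂, o₃, o₄, c₁, c₂, c₃, c₄, rfl, rfl, hcr, ?_, pt₁, hall d rfl⟩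
  apply List.Nodup.of_map key
  refine List.Pairwise.imp (fun h => ne_of_lt h) (R := (· < ·)) ?_
  simp only [List.map_cons, List.map_nil, List.pairwise_cons, List.mem_cons, List.not_mem_nil,
    or_false, forall_eq_or_imp, forall_eq]
  refine ⟨⟨?_, ?_, ?_⟩, ⟨?_, ?_⟩, ?_, by simp⟩ <;> linarith

theorem cyc_cross (hG : G.NoTriple) {d : G.Dart} (h : d.TailX) :
    G.Cr d.e d.cyc.e ∧ d.cyc.cyc.e = d.e.swap ∧ d.cyc.cyc.cyc.cyc = d := by
  obtain ⟨o₁, o₂, o₃, o₄, c₁, c₂, c₃, c₄, e₃, e₄, hcr, -, -, h⟩ := exists_cross hG h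
  rcases h with rfl | rfl | rfl | rfl
  · rw [c₁, c₂, c₃, c₄]; exact ⟨hcr, e₃, rfl⟩
  · rw [c₂, c₃, c₄, c₁]
    exact ⟨by rw [e₃]; exact hcr.swap_left.symm, e₄, rfl⟩
  · rw [c₃, c₄, c₁, c₂, e₃, e₄]
    exact ⟨hcr.swap_left.swap_right, (Prod.swap_swap _).symm, rfl⟩
  · rw [c₄, c₁, c₂, c₃, e₄]
    exact ⟨hcr.swap_right.symm, (Prod.swap_swap _).symm, rfl⟩

theorem four_le_card_fibre (hG : G.NoTriple) {d : G.Dart} (h : d.TailX) :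
    4 ≤ (Finset.univ.filter fun o : G.Dart => o.pt = d.pt).card := by
  obtain ⟨o₁, o₂, o₃, o₄, c₁, c₂, c₃, c₄, -, -, -, hn, hp, -⟩ := exists_cross hG h
  have h2 : o₂.pt = d.pt := by rw [← c₁, pt_cyc, hp]
  have h3 : o₃.pt = d.pt := by rw [← c₂, pt_cyc, h2]
  have h4 : o₄.pt = d.pt := by rw [← c₃, pt_cyc, h3]
  rw [show 4 = [o₁, o₂, o₃, o₄].toFinset.card from (List.toFinset_card_of_nodup hn).symm]
  refine Finset.card_le_card fun o ho => ?_
  simp only [List.mem_toFinset, List.mem_cons, List.not_mem_nil, or_false] at ho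
  simp only [Finset.mem_filter, Finset.mem_univ, true_and]
  rcases ho with rfl | rfl | rfl | rfl <;> assumption

theorem fst_eq_of_not_tailX {d : G.Dart} {v : V} (h : d.pt = (G.x v, G.y v)) : d.e.1 = v := by
  have h1 : d.t = G.x v := congrArg Prod.fst h
  have h2 : G.L d.e d.t = G.y v := congrArg Prod.snd h
  rcases G.vertex_on_line d.e_mem (h1 ▸ h2) with h3 | h3
  · exact h3.symm
  · exact absurd (h1.trans (congrArg G.x h3)) d.t_ne

theorem not_tailX {d : G.Dart} (h : ¬ d.TailX) : d.pt = (G.x d.e.1, G.y d.e.1) := by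
  rw [TailX] at h
  push Not at h
  obtain ⟨v, hv⟩ := h
  rw [fst_eq_of_not_tailX hv, hv]

theorem tailX_of_pt_eq {o d : G.Dart} (h : o.pt = d.pt) : o.TailX ↔ d.TailX := by
  rw [TailX, TailX, h]

theorem xc_eq_of_pt_eq {o d : G.Dart} (h : o.pt = d.pt) (hcr : G.Cr o.e d.e) :
    G.xc o.e d.e = o.t := by
  have h1 : o.t = d.t := congrArg Prod.fst h
  have h2 : G.L o.e o.t = G.L d.e d.t := congrArg Prod.snd h
  rw [← h1] at h2
  exact ((G.eq_xc hcr.2.2.1).1 h2).symm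

/-- The number of nodes on the edge of a dart after its tail. -/
def rank (d : G.Dart) : ℕ := ((G.N d.e).filter fun u => G.g d.e d.t < G.g d.e u).card

theorem pt_f (d : G.Dart) : d.f.pt = d.r.pt := pt_cyc _

theorem pt_f_r_f (d : G.Dart) : d.f.r.f.pt = d.r.pt := by rw [pt_f, r_r, pt_f]

end Dart

open Dart

/-- The planarisation of a drawing. -/
def crossMap (hG : G.NoTriple)
    (hdeg : ∀ a ∈ G.A, ∃ b ∈ G.A, b.1 = a.2 ∧ b ≠ a.swap)
    (hcl : ∀ a b c d, G.Cr a b → G.Cr a c → G.Cr a d → G.Cr b c → G.Cr b d → G.Cr c d → False) :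
    CrossMap G.Dart V where
  f := f
  b := b
  r := r
  e := e
  cr := G.Cr
  isX d := d.r.TailX
  rank := rank
  fb := f_b
  bf := b_f
  rr := r_r
  e_r := e_r
  e_ne d := G.ne _ d.e_mem
  cr_symm _ _ := Cr.symm
  cr_swap _ _ := Cr.swap_right
  clique_free := hcl
  isX_rf d := tailX_of_pt_eq (by rw [r_r, pt_f])
  cr_f d h := cr_swap_left _ |>.1 (cyc_cross hG h).1
  e_straight d h := by
    have := (cyc_cross hG h).2.1
    rwa [e_r, Prod.swap_swap, ← f, ← r_r d.f, ← f] at this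
  rf_four d h := by
    have := (cyc_cross hG h).2.2
    rw [← f, ← r_r d.f, ← f, ← r_r d.f.r.f, ← f, ← r_r d.f.r.f.r.f, ← f] at this
    rw [this, r_r]
  not_cr_f d h hcr := by
    have h1 := not_tailX h
    have h2 := hcr.swap_left
    have h3 := xc_eq_of_pt_eq (o := d.r) (pt_f d).symm h2
    have h4 := h2.2.2.2.1
    have h5 : d.r.t = G.x d.e.2 := congrArg Prod.fst h1
    rw [← e_r, h3, h5, e_r, Inside] at h4
    simp at h4
  snd_eq_fst d h := by
    have h1 := not_tailX h
    rw [← pt_f] at h1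
    exact fst_eq_of_not_tailX h1
  ne_swap d h he := by
    have h1 := not_tailX h
    have h2 : d.f = d.r := ext' he (congrArg Prod.fst (pt_f d))
    obtain ⟨c, hc, hc1, hc2⟩ := hdeg _ d.e_mem
    have h3 : (start c hc).pt = d.r.pt := by rw [pt_start, h1, e_r, Prod.fst_swap, hc1]
    have h4 := eq_of_cycNext_eq key_inj h2 h3
    exact hc2 (congrArg e h4)
  eq_of_edges d d' h h' he hf := by
    have hx : ∀ d : G.Dart, d.r.TailX → G.Cr d.e d.f.e ∧ G.xc d.e d.f.e = d.hd := fun d h => by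
      have h1 := (cyc_cross hG h).1
      have h2 := xc_eq_of_pt_eq (o := d.r) (pt_f d).symm h1
      have h3 : G.Cr d.e d.f.e := (cr_swap_left _).1 h1
      rw [e_r, G.xc_swap_left d.e_mem] at h2
      exact ⟨h3, h2⟩
    have h1 := hx d h
    have h2 := hx d' h'
    have h3 : d.hd = d'.hd := by
      rw [← h1.2, ← h2.2, he]
      rcases hf with hf | hf <;> rw [hf]
      exact G.xc_swap_right d'.f.e_mem
    rw [← d.r_r, ← d'.r_r]
    congr 1
    exact ext' (by rw [e_r, e_r, he]) h3
  rank_lt d h := by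
    have he : d.f.r.f.e = d.e := by
      have := (cyc_cross hG h).2.1
      rwa [e_r, Prod.swap_swap, ← f, ← r_r d.f, ← f] at this
    have ht : d.f.r.f.t = d.hd := congrArg Prod.fst (pt_f_r_f d)
    have h1 := d.hd_spec
    rw [rank, rank, he, ht]
    refine Finset.card_lt_card (Finset.ssubset_iff.2 ⟨d.hd, by simp, ?_⟩)
    intro u hu
    simp only [Finset.mem_insert, Finset.mem_filter] at hu ⊢
    rcases hu with rfl | hu
    · exact ⟨h1.1, h1.2.1⟩
    · exact ⟨hu.1, h1.2.1.trans hu.2⟩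

end Drawing

namespace CrossMap

variable {D V : Type*} [Fintype D] (M : CrossMap D V)

theorem eq_on_face {α : Type*} {h : D → α} (hf : ∀ x, h (M.f x) = h x) {x y : D}
    (hy : y ∈ M.face x) : h y = h x := by
  rw [M.face_eq_image, Finset.mem_image] at hy
  obtain ⟨i, -, rfl⟩ := hy
  induction i with
  | zero => rfl
  | succ i ih => rw [Function.iterate_succ_apply', hf, ih]

end CrossMap

namespace Drawing

variable {V : Type*} {G : Drawing V}

namespace Dart

theorem right_or_right_r (d : G.Dart) : d.Right ∨ d.r.Right := by
  rw [right_r]; exact em _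

theorem sum_right {z : G.Dart → ℝ} (hz : ∀ s, z s.r = - z s) (ψ : G.Dart → ℝ) :
    ∑ o, z o * ψ o = ∑ s : G.Dart with s.Right, z s * (ψ s - ψ s.r) := by
  rw [← Finset.sum_filter_add_sum_filter_not Finset.univ fun s : G.Dart => s.Right]
  have : ∑ o : G.Dart with ¬ o.Right, z o * ψ o = ∑ s : G.Dart with s.Right, - (z s * ψ s.r) := by
    refine Finset.sum_nbij' r r ?_ ?_ (fun s _ => s.r_r) (fun s _ => s.r_r) ?_
    · intro s hs
      simpa [right_r] using hs
    · intro s hs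
      simpa [right_r] using hs
    · intro s _
      rw [r_r, hz]; ring
  rw [this, ← Finset.sum_add_distrib]
  exact Finset.sum_congr rfl fun s _ => by ring

/-- The flow `z` is conserved at every node. -/
def Conserved (z : G.Dart → ℝ) : Prop := ∀ o : G.Dart, ∑ w with w.pt = o.pt, z w = 0

theorem Conserved.sum_eq_zero {z : G.Dart → ℝ} (hc : Conserved z) (φ : ℝ × ℝ → ℝ) :
    ∑ o, z o * φ o.pt = 0 := by
  rw [← Finset.sum_fiberwise_of_maps_to (t := Finset.univ.image pt) (g := pt)
    fun y _ => Finset.mem_image_of_mem _ (Finset.mem_univ y)]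
  refine Finset.sum_eq_zero fun p hp => ?_
  obtain ⟨o, -, rfl⟩ := Finset.mem_image.1 hp
  rw [← zero_mul (φ o.pt), ← hc o, Finset.sum_mul]
  exact Finset.sum_congr rfl fun w hw => by rw [(Finset.mem_filter.1 hw).2]

/-- The total flow through the vertical ray above a point. -/
def flowOver (z : G.Dart → ℝ) (p : ℝ × ℝ) : ℝ := ∑ s : G.Dart with s.Right ∧ s.Over p, z s

/-- The potential of the face on the left of a dart. -/
def height (z : G.Dart → ℝ) (o : G.Dart) : ℝ :=
  flowOver z o.pt + ∑ w : G.Dart with w.pt = o.pt ∧ w.key < o.key, z w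

theorem height_cyc {z : G.Dart → ℝ} (hc : Conserved z) (o : G.Dart) :
    height z o.cyc = height z o + z o := by
  have := sum_lt_cycNext key_inj z o (by convert hc o)
  rw [height, height, add_assoc, pt_cyc, add_right_inj, show o.cyc = cycNext pt key o from rfl]
  convert this

theorem height_r {z : G.Dart → ℝ} (hz : ∀ s, z s.r = - z s) (hc : Conserved z) {d : G.Dart}
    (hd : d.Right) : height z d.r = height z d + z d := by
  set ψ : ℝ × ℝ → ℝ := fun p => (if d.Strip p then 1 else 0) + (if Ray d.r.pt p then 1 else 0) +
    (if p = d.r.pt then 1 else 0) with hψ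
  have h0 := hc.sum_eq_zero ψ
  have hsum : ∀ (P : G.Dart → Prop) [DecidablePred P], ∑ w with P w, z w =
      ∑ w, z w * (if P w then 1 else 0) := fun P _ => by
    rw [Finset.sum_filter]
    exact Finset.sum_congr rfl fun w _ => by split_ifs <;> simp
  have hover : ∀ p, flowOver z p = ∑ s : G.Dart with s.Right, z s * (if s.Over p then 1 else 0) :=
    fun p => by
      rw [flowOver, ← Finset.filter_filter, Finset.sum_filter]
      exact Finset.sum_congr rfl fun w _ => by split_ifs <;> simp
  have hz1 : z d = ∑ s : G.Dart with s.Right, z s * (if s = d then 1 else 0) := by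
    simp [hd]
  rw [sum_right hz] at h0
  rw [← sub_eq_zero, ← h0, height, height, hover, hover, hsum, hsum, sum_right hz, sum_right hz]
  conv_lhs => rw [hz1]
  rw [← Finset.sum_add_distrib, ← Finset.sum_add_distrib, ← Finset.sum_add_distrib,
    ← Finset.sum_sub_distrib]
  refine Finset.sum_congr rfl fun s hs => ?_
  have hsR : s.Right := (Finset.mem_filter.1 hs).2
  rw [← mul_add, ← mul_add, ← mul_add, ← mul_sub]
  congr 1
  have hdr : ¬ d.r.Right := by rw [right_r]; exact not_not.2 hd
  have hsr : ¬ s.r.Right := by rw [right_r]; exact not_not.2 hsR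
  have k1 : s.key < d.r.key ↔ True := iff_true_intro (key_lt_of_right_left hsR hdr)
  have k2 : s.r.key < d.key ↔ False := iff_false_intro (key_lt_of_right_left hd hsr).not_gt
  have k3 : s.key < d.key ↔ G.m d.e < G.m s.e := key_lt_right hsR hd
  have k4 : s.r.key < d.r.key ↔ G.m d.e < G.m s.e := by
    rw [key_lt_left hsr hdr, e_r, e_r, m_swap, m_swap]
  simp only [hψ, k1, k2, k3, k4, and_true, and_false, if_false]
  have b1 := strip_balance hsR hd
  have b2 := over_balance hsR d.r.pt
  have b3 := tail_balance hsR hd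
  have b4 := head_balance hsR hd
  have b5 : (if s.r.pt = d.r.pt ∧ G.m d.e < G.m s.e then (1 : ℝ) else 0) +
      (if s.r.pt = d.r.pt ∧ G.m s.e < G.m d.e then 1 else 0) + (if s = d then 1 else 0) =
      if s.r.pt = d.r.pt then 1 else 0 := by
    by_cases h : s.r.pt = d.r.pt
    · simp only [h, true_and, if_true]
      by_cases hsd : s = d
      · subst hsd; simp
      · have := fun h' => hsd (eq_of_pt_r_eq hsR hd h h')
        rcases lt_or_gt_of_ne this with h' | h' <;> simp [h', h'.not_gt, hsd]
    · have : s ≠ d := fun h' => h (by rw [h'])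
      simp [h, this]
  linarith

theorem height_reverse {z : G.Dart → ℝ} (hz : ∀ s, z s.r = - z s) (hc : Conserved z)
    (d : G.Dart) :
    height z d.r = height z d + z d := by
  rcases d.right_or_right_r with h | h
  · exact height_r hz hc h
  · have := height_r hz hc h
    rw [r_r, hz] at this
    linarith

theorem height_f {z : G.Dart → ℝ} (hz : ∀ s, z s.r = - z s) (hc : Conserved z)
    (d : G.Dart) :
    height z d.f = height z d := by
  rw [f, height_cyc hc, height_reverse hz hc, hz]
  ring

/-- The potential as a linear function of the flow. -/
def heightₗ (G : Drawing V) : (G.Dart → ℝ) →ₗ[ℝ] (G.Dart → ℝ) where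
  toFun := height
  map_add' z w := by
    ext o
    simp only [height, flowOver, Pi.add_apply, Finset.sum_add_distrib]
    ring
  map_smul' c z := by
    ext o
    simp only [height, flowOver, Pi.smul_apply, smul_eq_mul, RingHom.id_apply, mul_add,
      Finset.mul_sum]

theorem two_mul_card_right :
    2 * (Finset.univ.filter fun d : G.Dart => d.Right).card = Fintype.card G.Dart := by
  rw [← Finset.card_univ,
    ← Finset.card_filter_add_card_filter_not (s := Finset.univ) fun d : G.Dart => d.Right, two_mul]
  congr 1
  refine Finset.card_nbij' r r ?_ ?_ (fun s _ => s.r_r) (fun s _ => s.r_r) <;>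
  · intro s hs
    simpa [right_r] using hs

/-- The nodes of the planarisation. -/
def nodes (G : Drawing V) : Finset (ℝ × ℝ) := Finset.univ.image (pt (G := G))

theorem card_dart_le (M : CrossMap G.Dart V) (hM : M.f = f) :
    Fintype.card G.Dart ≤
      (Finset.univ.filter fun d : G.Dart => d.Right).card + (nodes G).card + M.faces.card := by
  have hrep : ∀ F : M.faces, ∃ x, M.face x = F.1 := fun F => by
    obtain ⟨x, -, hx⟩ := Finset.mem_image.1 F.2
    exact ⟨x, hx⟩
  choose rep hrep using hrep
  let pr : G.Dart → (G.Dart → ℝ) →ₗ[ℝ] ℝ := fun d => LinearMap.proj d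
  let T : (G.Dart → ℝ) →ₗ[ℝ]
      ((Finset.univ.filter fun d : G.Dart => d.Right) → ℝ) × (nodes G → ℝ) × (M.faces → ℝ) :=
    LinearMap.prod (LinearMap.pi fun s => pr s.1.r + pr s.1)
      (LinearMap.prod
        (LinearMap.pi fun p => ∑ w : G.Dart with w.pt = p.1, pr w)
        (LinearMap.pi fun F => pr (rep F) ∘ₗ heightₗ G))
  have hT : Function.Injective T := by
    rw [← LinearMap.ker_eq_bot, LinearMap.ker_eq_bot']
    intro z hzT
    have h1 : ∀ s : G.Dart, s.Right → z s.r + z s = 0 := fun s hs => by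
      have := congrFun (congrArg Prod.fst hzT) ⟨s, by simpa using hs⟩
      simpa [T, pr] using this
    have hz : ∀ s, z s.r = - z s := fun s => by
      rcases s.right_or_right_r with h | h
      · linarith [h1 s h]
      · have := h1 _ h
        rw [r_r] at this
        linarith
    have hc : Conserved z := fun o => by
      have := congrFun (congrArg (fun q => q.2.1) hzT)
        ⟨o.pt, Finset.mem_image_of_mem _ (Finset.mem_univ o)⟩
      simpa [T, pr] using this
    have h3 : ∀ F, height z (rep F) = 0 := fun F => by
      have := congrFun (congrArg (fun q => q.2.2) hzT) F
      simpa [T, pr, heightₗ] using this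
    have h4 : ∀ d, height z d = 0 := fun d => by
      have hF : M.face d ∈ M.faces := Finset.mem_image_of_mem _ (Finset.mem_univ d)
      rw [← h3 ⟨_, hF⟩]
      refine M.eq_on_face (fun x => ?_) ?_
      · rw [hM]; exact height_f hz hc x
      · rw [hrep]; exact M.mem_face_self d
    ext d
    have := height_reverse hz hc d
    rw [h4, h4] at this
    simpa using this.symm
  have := LinearMap.finrank_le_finrank_of_injective hT
  simp only [Module.finrank_prod, Module.finrank_fintype_fun_eq_card, Fintype.card_coe] at this
  omega

theorem card_nodes_le (hG : G.NoTriple) :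
    (Finset.univ.filter fun d : G.Dart => ¬ d.TailX).card + 4 * (nodes G).card ≤
      4 * (G.A.image Prod.fst).card + Fintype.card G.Dart := by
  set X := (nodes G).filter fun p => ∀ v, p ≠ (G.x v, G.y v) with hX
  set Y := (nodes G).filter fun p => ¬ ∀ v, p ≠ (G.x v, G.y v) with hY
  have hXY : X.card + Y.card = (nodes G).card := Finset.card_filter_add_card_filter_not _
  have hYle : Y.card ≤ (G.A.image Prod.fst).card := by
    refine le_trans (Finset.card_le_card ?_)
      (Finset.card_image_le (s := G.A.image Prod.fst) (f := fun v => (G.x v, G.y v)))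
    intro p hp
    obtain ⟨hp1, hp2⟩ := Finset.mem_filter.1 hp
    obtain ⟨o, -, rfl⟩ := Finset.mem_image.1 hp1
    exact Finset.mem_image.2 ⟨o.e.1, Finset.mem_image_of_mem _ o.e_mem, (not_tailX hp2).symm⟩
  have hXle : 4 * X.card ≤ (Finset.univ.filter fun d : G.Dart => d.TailX).card := by
    rw [Finset.card_eq_sum_card_fiberwise (f := pt) (t := X), mul_comm]
    · rw [← smul_eq_mul]
      refine Finset.card_nsmul_le_sum _ _ _ fun p hp => ?_
      obtain ⟨hp1, hp2⟩ := Finset.mem_filter.1 hp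
      obtain ⟨o, -, rfl⟩ := Finset.mem_image.1 hp1
      refine (four_le_card_fibre hG hp2).trans (Finset.card_le_card fun w hw => ?_)
      simp only [Finset.mem_filter, Finset.mem_univ, true_and] at hw ⊢
      exact ⟨(tailX_of_pt_eq hw).2 hp2, hw⟩
    · intro o ho
      simp only [Finset.coe_filter, Finset.mem_univ, true_and, Set.mem_ofPred_eq] at ho
      exact Finset.mem_coe.2 (Finset.mem_filter.2
        ⟨Finset.mem_image_of_mem _ (Finset.mem_univ o), ho⟩)
  have := Finset.card_filter_add_card_filter_not (s := Finset.univ) fun d : G.Dart => d.TailX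
  rw [Finset.card_univ] at this
  omega

end Dart

open Dart

theorem card_le_of_deg (hG : G.NoTriple)
    (hdeg : ∀ a ∈ G.A, ∃ b ∈ G.A, b.1 = a.2 ∧ b ≠ a.swap)
    (hcl : ∀ a b c d, G.Cr a b → G.Cr a c → G.Cr a d → G.Cr b c → G.Cr b d → G.Cr c d → False) :
    G.A.card ≤ 72 * (G.A.image Prod.fst).card := by
  refine (G.crossMap hG hdeg hcl).card_le_of_euler G.A (fun a ha => ⟨start a ha, ?_, rfl⟩) _ ?_
  · intro h
    refine h a.1 ?_
    rw [← pt_start a ha, ← pt_f]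
    exact congrArg pt (f_b _)
  · have h1 := card_dart_le (G.crossMap hG hdeg hcl) rfl
    have h2 := two_mul_card_right (G := G)
    have h3 := card_nodes_le hG
    have h4 : (Finset.univ.filter fun d : G.Dart => ¬ (G.crossMap hG hdeg hcl).isX d).card =
        (Finset.univ.filter fun d : G.Dart => ¬ d.TailX).card := by
      refine Finset.card_nbij' r r ?_ ?_ (fun s _ => s.r_r) (fun s _ => s.r_r) <;>
      · intro s hs
        rw [Finset.mem_coe, Finset.mem_filter] at hs ⊢
        refine ⟨Finset.mem_univ _, ?_⟩
        simpa [crossMap, r_r] using hs.2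
    omega

end Drawing

namespace Drawing

variable {V : Type*}

/-- Deletion of an edge. -/
def erase (G : Drawing V) (a : V × V) : Drawing V where
  x := G.x
  y := G.y
  A := (G.A.erase a).erase a.swap
  swap_mem b hb := by
    simp only [Finset.mem_erase, ne_eq] at hb ⊢
    refine ⟨fun h => hb.2.1 (Prod.swap_injective h), fun h => hb.1 ?_, G.swap_mem _ hb.2.2⟩
    rw [← h, Prod.swap_swap]
  ne b hb := G.ne b (Finset.mem_of_mem_erase (Finset.mem_of_mem_erase hb))
  x_inj := G.x_inj
  gen := G.gen

theorem erase_subset (G : Drawing V) (a : V × V) : (G.erase a).A ⊆ G.A :=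
  (Finset.erase_subset _ _).trans (Finset.erase_subset _ _)

theorem Cr.of_erase {G : Drawing V} {a b c : V × V} (h : (G.erase a).Cr b c) : G.Cr b c :=
  ⟨G.erase_subset a h.1, G.erase_subset a h.2.1, h.2.2⟩

theorem card_le (G : Drawing V) (hG : G.NoTriple)
    (hcl : ∀ a b c d, G.Cr a b → G.Cr a c → G.Cr a d → G.Cr b c → G.Cr b d → G.Cr c d → False) :
    G.A.card ≤ 72 * (G.A.image Prod.fst).card := by
  induction hn : G.A.card using Nat.strong_induction_on generalizing G with
  | _ n ih =>
  by_cases hdeg : ∀ a ∈ G.A, ∃ b ∈ G.A, b.1 = a.2 ∧ b ≠ a.swap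
  · rw [← hn]
    exact card_le_of_deg hG hdeg hcl
  push Not at hdeg
  obtain ⟨a, ha, h⟩ := hdeg
  have hlt : (G.erase a).A.card < n := by
    rw [← hn]
    exact Finset.card_lt_card ((Finset.ssubset_iff_of_subset (G.erase_subset a)).2
      ⟨a, ha, fun h' => (Finset.notMem_erase a _) (Finset.mem_of_mem_erase h')⟩)
  have h1 := ih _ hlt (G.erase a) (fun b c d hbc hbd => hG b c d hbc.of_erase hbd.of_erase)
    (fun b c d e h1 h2 h3 h4 h5 h6 => hcl b c d e h1.of_erase h2.of_erase h3.of_erase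
      h4.of_erase h5.of_erase h6.of_erase) rfl
  have h2 : G.A.card ≤ (G.erase a).A.card + 2 := by
    have h3 := Finset.pred_card_le_card_erase (s := G.A) (a := a)
    have h4 := Finset.pred_card_le_card_erase (s := G.A.erase a) (a := a.swap)
    change _ ≤ ((G.A.erase a).erase a.swap).card + 2
    omega
  have h3 : ((G.erase a).A.image Prod.fst).card + 1 ≤ (G.A.image Prod.fst).card := by
    have hmem : a.2 ∈ G.A.image Prod.fst := Finset.mem_image.2 ⟨a.swap, G.swap_mem a ha, rfl⟩
    rw [← Finset.card_erase_add_one hmem]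
    refine Nat.succ_le_succ (Finset.card_le_card fun v hv => ?_)
    obtain ⟨b, hb, rfl⟩ := Finset.mem_image.1 hv
    have hbA := G.erase_subset a hb
    exact Finset.mem_erase.2 ⟨fun h4 => Finset.ne_of_mem_erase hb (h b hbA h4),
      Finset.mem_image_of_mem _ hbA⟩
  omega

end Drawing

theorem exists_eval_ne_zero {σ ι : Type*} [Finite σ] (s : Finset ι) (P : ι → MvPolynomial σ ℝ)
    (hP : ∀ i ∈ s, P i ≠ 0) {U : Set (σ → ℝ)} (hU : IsOpen U) (hne : U.Nonempty) :
    ∃ q ∈ U, ∀ i ∈ s, MvPolynomial.eval q (P i) ≠ 0 := by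
  have := Fintype.ofFinite σ
  obtain ⟨q₀, hq₀⟩ := hne
  obtain ⟨ε, hε, hball⟩ := Metric.isOpen_iff.1 hU q₀ hq₀
  rw [ball_pi _ hε] at hball
  by_contra! h
  refine Finset.prod_ne_zero_iff.2 hP (MvPolynomial.funext_set
    (fun i => Metric.ball (q₀ i) ε) (fun i => ?_) fun q hq => ?_)
  · rw [Real.ball_eq_Ioo]
    exact Set.Ioo_infinite (by linarith)
  · obtain ⟨i, hi, h0⟩ := h q (hball hq)
    rw [map_prod, map_zero]
    exact Finset.prod_eq_zero hi h0

/-- Twice the signed area of a triangle. -/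
def orient {V R : Type*} [CommRing R] (x y : V → R) (i j k : V) : R :=
  (y k - y i) * (x j - x i) - (y j - y i) * (x k - x i)

/-- The determinant that vanishes when three lines are concurrent. -/
def concurrency {V R : Type*} [CommRing R] (x y : V → R) (i j k l p q : V) : R :=
  (y i - y j) * ((x l - x k) * (x p * y q - x q * y p) - (x q - x p) * (x k * y l - x l * y k)) -
  (x j - x i) * ((y k - y l) * (x p * y q - x q * y p) - (y p - y q) * (x k * y l - x l * y k)) +
  (x i * y j - x j * y i) * ((y k - y l) * (x q - x p) - (y p - y q) * (x l - x k))

theorem map_concurrency {V R T : Type*} [CommRing R] [CommRing T] (f : R →+* T) (x y : V → R)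
    (i j k l p q : V) :
    f (concurrency x y i j k l p q) = concurrency (f ∘ x) (f ∘ y) i j k l p q := by
  simp [concurrency]

theorem concurrency_eq_zero {V : Type*} {x y : V → ℝ} {i j k l p q : V} {u v m₁ m₂ m₃ : ℝ}
    (hi : y i = v + m₁ * (x i - u)) (hj : y j = v + m₁ * (x j - u))
    (hk : y k = v + m₂ * (x k - u)) (hl : y l = v + m₂ * (x l - u))
    (hp : y p = v + m₃ * (x p - u)) (hq : y q = v + m₃ * (x q - u)) :
    concurrency x y i j k l p q = 0 := by
  rw [concurrency, hi, hj, hk, hl, hp, hq]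
  ring

theorem exists_concurrency_ne_zero {V : Type*} {i j k l p q : V}
    (h : [i, j, k, l, p, q].Nodup) : ∃ x y : V → ℝ, concurrency x y i j k l p q ≠ 0 := by
  simp only [List.nodup_cons, List.mem_cons, List.not_mem_nil, or_false, not_or] at h
  obtain ⟨⟨h1, h2, h3, h4, h5⟩, ⟨h6, h7, h8, h9⟩, ⟨h10, h11, h12⟩, ⟨h13, h14⟩, h15, -⟩ := h
  refine ⟨fun v => if v = j then 1 else if v = p then 1 else 0,
    fun v => if v = l then 1 else if v = q then 1 else 0, ?_⟩
  simp [concurrency, *, Ne.symm, eq_comm]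

/-- A finite point set can be perturbed without changing orientations so that no two points lie
on a vertical line and no three disjoint edges are concurrent. -/
theorem exists_perturbation {V : Type*} [Finite V] (x₀ y₀ : V → ℝ)
    (h₀ : ∀ i j k, i ≠ j → i ≠ k → j ≠ k → orient x₀ y₀ i j k ≠ 0) :
    ∃ x y : V → ℝ, Function.Injective x ∧
      (∀ i j k, i ≠ j → i ≠ k → j ≠ k → 0 < orient x y i j k * orient x₀ y₀ i j k) ∧
      ∀ i j k l p q, [i, j, k, l, p, q].Nodup → concurrency x y i j k l p q ≠ 0 := by
  have := Fintype.ofFinite V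
  let U : Set (V ⊕ V → ℝ) := {q | ∀ i j k, i ≠ j → i ≠ k → j ≠ k →
    0 < orient (q ∘ Sum.inl) (q ∘ Sum.inr) i j k * orient x₀ y₀ i j k}
  have hU : IsOpen U := by
    have : U = ⋂ i, ⋂ j, ⋂ k, {q | i ≠ j → i ≠ k → j ≠ k →
        0 < orient (q ∘ Sum.inl) (q ∘ Sum.inr) i j k * orient x₀ y₀ i j k} := by
      ext q; simp [U]
    rw [this]
    refine isOpen_iInter_of_finite fun i => isOpen_iInter_of_finite fun j =>
      isOpen_iInter_of_finite fun k => ?_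
    by_cases h : i ≠ j ∧ i ≠ k ∧ j ≠ k
    · simp only [h.1, h.2.1, h.2.2, ne_eq, not_false_eq_true, true_imp_iff]
      refine isOpen_lt continuous_const ?_
      simp only [orient, Function.comp_apply]
      fun_prop
    · convert isOpen_univ
      ext q
      simp only [Set.mem_ofPred_eq, Set.mem_univ, iff_true]
      exact fun h1 h2 h3 => absurd ⟨h1, h2, h3⟩ h
  have hne : U.Nonempty := ⟨Sum.elim x₀ y₀, fun i j k h1 h2 h3 => by
    rw [Sum.elim_comp_inl, Sum.elim_comp_inr]
    exact mul_self_pos.2 (h₀ i j k h1 h2 h3)⟩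
  let X : V → MvPolynomial (V ⊕ V) ℝ := fun v => MvPolynomial.X (Sum.inl v)
  let Y : V → MvPolynomial (V ⊕ V) ℝ := fun v => MvPolynomial.X (Sum.inr v)
  let P : (V × V) ⊕ (V × V × V × V × V × V) → MvPolynomial (V ⊕ V) ℝ :=
    Sum.elim (fun w => X w.1 - X w.2)
      (fun w => concurrency X Y w.1 w.2.1 w.2.2.1 w.2.2.2.1 w.2.2.2.2.1 w.2.2.2.2.2)
  have hX : ∀ q : V ⊕ V → ℝ, MvPolynomial.eval q ∘ X = q ∘ Sum.inl := fun q => by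
    ext v; simp [X]
  have hY : ∀ q : V ⊕ V → ℝ, MvPolynomial.eval q ∘ Y = q ∘ Sum.inr := fun q => by
    ext v; simp [Y]
  obtain ⟨q, hq, h⟩ := exists_eval_ne_zero (Finset.univ.filter fun w => P w ≠ 0) P
    (fun w hw => (Finset.mem_filter.1 hw).2) hU hne
  refine ⟨q ∘ Sum.inl, q ∘ Sum.inr, fun i j hij => ?_, hq, fun i j k l p r hn => ?_⟩
  · by_contra hne
    refine h (Sum.inl (i, j)) (Finset.mem_filter.2 ⟨Finset.mem_univ _, fun h0 => hne ?_⟩) ?_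
    · exact Sum.inl_injective (MvPolynomial.X_injective (sub_eq_zero.1 h0))
    · simpa [P, X, sub_eq_zero] using hij
  · obtain ⟨x, y, hxy⟩ := exists_concurrency_ne_zero hn
    have := h (Sum.inr (i, j, k, l, p, r)) (Finset.mem_filter.2 ⟨Finset.mem_univ _, fun h0 => ?_⟩)
    · simpa only [P, Sum.elim_inr, map_concurrency, hX, hY] using this
    · have h1 := congrArg (MvPolynomial.eval (Sum.elim x y)) h0
      simp only [P, Sum.elim_inr, map_concurrency, hX, hY, map_zero, Sum.elim_comp_inl,
        Sum.elim_comp_inr] at h1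
      exact hxy h1

namespace Drawing

variable {V : Type*} {G : Drawing V}

theorem orient_mul_neg_of_cr {a b : V × V} (h : G.Cr a b) :
    orient G.x G.y a.1 a.2 b.1 * orient G.x G.y a.1 a.2 b.2 < 0 := by
  obtain ⟨ha, hb, hm, -, hI⟩ := h
  have hu := (G.eq_xc hm).2 rfl
  set u := G.xc a b
  have key : ∀ k, G.y k = G.L b (G.x k) → orient G.x G.y a.1 a.2 k =
      (G.x a.2 - G.x a.1) * ((G.m b - G.m a) * (G.x k - u)) := fun k hk => by
    have h1 : G.L b (G.x k) = G.L b u + G.m b * (G.x k - u) := by simp only [L]; ring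
    rw [orient, hk, h1, ← hu, ← G.m_mul ha, L, c]
    ring
  rw [key b.1 (G.L_fst b).symm, key b.2 (G.L_snd hb).symm]
  have h1 := mul_self_pos.2 (G.x_ne ha)
  have h2 := mul_self_pos.2 (sub_ne_zero.2 hm.symm)
  have h3 : (u - G.x b.1) * (u - G.x b.2) < 0 := hI
  have h4 := mul_neg_of_pos_of_neg (mul_pos h1 h2) h3
  linarith

theorem ne_of_cr {a b : V × V} (h : G.Cr a b) :
    a.1 ≠ b.1 ∧ a.1 ≠ b.2 ∧ a.2 ≠ b.1 ∧ a.2 ≠ b.2 := by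
  have := orient_mul_neg_of_cr h
  refine ⟨?_, ?_, ?_, ?_⟩ <;>
  · intro h
    rw [← h] at this
    simp only [orient] at this
    ring_nf at this
    exact lt_irrefl _ this

theorem noTriple_of_concurrency
    (h : ∀ i j k l p q, [i, j, k, l, p, q].Nodup → concurrency G.x G.y i j k l p q ≠ 0) :
    G.NoTriple := by
  intro a b c hab hac hx
  by_contra! hne
  have hb := (G.eq_xc hab.2.2.1).2 rfl
  have hc := (G.eq_xc hac.2.2.1).2 rfl
  rw [← hx] at hc
  have hm : G.m b ≠ G.m c := fun hm => by
    rcases G.eq_or_swap hab.2.1 hac.2.1 hm (hb.symm.trans hc) with h | h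
    · exact hne.1 h
    · exact hne.2 h
  have hbc := (G.mem_N_of_cr hab.2.1 hac.2.1 hm (hb.symm.trans hc) hab.2.2.2.2
    (by rw [hx]; exact hac.2.2.2.2)).1
  have h1 := ne_of_cr hab
  have h2 := ne_of_cr hac
  have h3 := ne_of_cr hbc
  have key : ∀ (e : V × V) (k : V), G.L e (G.x k) = G.y k → G.L e (G.xc a b) = G.L a (G.xc a b) →
      G.y k = G.L a (G.xc a b) + G.m e * (G.x k - G.xc a b) := fun e k h1 h2 => by
    rw [← h1, ← h2, L, L]; ring
  refine h a.1 a.2 b.1 b.2 c.1 c.2 ?_ (concurrency_eq_zero (key a _ (G.L_fst a) rfl)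
    (key a _ (G.L_snd hab.1) rfl) (key b _ (G.L_fst b) hb.symm)
    (key b _ (G.L_snd hab.2.1) hb.symm) (key c _ (G.L_fst c) hc.symm)
    (key c _ (G.L_snd hac.2.1) hc.symm))
  have := G.ne a hab.1
  have := G.ne b hab.2.1
  have := G.ne c hac.2.1
  simp only [List.nodup_cons, List.mem_cons, List.not_mem_nil, or_false, not_or,
    not_false_eq_true, List.nodup_nil, and_true]
  tauto

end Drawing

theorem openSegment_inter_nonempty {p q r s : Pt}
    (h1 : orient Prod.fst Prod.snd p q r * orient Prod.fst Prod.snd p q s < 0)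
    (h2 : orient Prod.fst Prod.snd r s p * orient Prod.fst Prod.snd r s q < 0) :
    (openSegment ℝ p q ∩ openSegment ℝ r s).Nonempty := by
  have div_bounds : ∀ a b : ℝ, a * b < 0 → a - b ≠ 0 ∧ 0 < a / (a - b) ∧ 0 < 1 - a / (a - b) := by
    intro a b h
    have h0 : a - b ≠ 0 := fun h' => by
      rw [sub_eq_zero.1 h'] at h
      exact absurd h (mul_self_nonneg b).not_gt
    rw [one_sub_div h0]
    rcases mul_neg_iff.1 h with ⟨ha, hb⟩ | ⟨ha, hb⟩
    · exact ⟨h0, div_pos ha (by linarith), div_pos (by linarith) (by linarith)⟩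
    · exact ⟨h0, div_pos_of_neg_of_neg ha (by linarith),
        div_pos_of_neg_of_neg (by linarith) (by linarith)⟩
  obtain ⟨hd, ht, ht'⟩ := div_bounds _ _ h1
  obtain ⟨hd', hs, hs'⟩ := div_bounds _ _ h2
  rw [openSegment_eq_image, openSegment_eq_image]
  refine ⟨_, ⟨_, ⟨hs, by linarith⟩, rfl⟩, ⟨_, ⟨ht, by linarith⟩, ?_⟩⟩
  have hdd : orient Prod.fst Prod.snd r s p - orient Prod.fst Prod.snd r s q =
      -(orient Prod.fst Prod.snd p q r - orient Prod.fst Prod.snd p q s) := by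
    simp only [orient]; ring
  rw [hdd]
  set D := orient Prod.fst Prod.snd p q r - orient Prod.fst Prod.snd p q s with hD
  ext
  · simp only [Prod.fst_add, Prod.smul_fst, smul_eq_mul]
    field_simp
    rw [hD]
    simp only [orient]
    ring
  · simp only [Prod.snd_add, Prod.smul_snd, smul_eq_mul]
    field_simp
    rw [hD]
    simp only [orient]
    ring

theorem collinear_of_orient_eq_zero {p q r : Pt} (hpq : p ≠ q)
    (h : orient Prod.fst Prod.snd p q r = 0) : Collinear ℝ ({p, q, r} : Set Pt) := by
  have hr : ∃ t : ℝ, r = p + t • (q - p) := by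
    simp only [orient] at h
    by_cases hx : q.1 - p.1 = 0
    · have hy : q.2 - p.2 ≠ 0 := fun hy =>
        hpq (Prod.ext (sub_eq_zero.1 hx).symm (sub_eq_zero.1 hy).symm)
      refine ⟨(r.2 - p.2) / (q.2 - p.2), Prod.ext ?_ ?_⟩
      · rw [hx, mul_zero, zero_sub, neg_eq_zero] at h
        have := (mul_eq_zero.1 h).resolve_left hy
        simp [hx]; linarith
      · simp [hy]
    · refine ⟨(r.1 - p.1) / (q.1 - p.1), Prod.ext ?_ ?_⟩
      · simp [hx]
      · simp only [Prod.snd_add, Prod.smul_snd, Prod.snd_sub, smul_eq_mul]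
        field_simp
        linarith
  obtain ⟨t, rfl⟩ := hr
  refine (collinear_iff_of_mem (Set.mem_insert p _)).2 ⟨q - p, ?_⟩
  rintro v (rfl | rfl | rfl)
  · exact ⟨0, by simp⟩
  · exact ⟨1, by simp⟩
  · exact ⟨t, by simp [add_comm]⟩

theorem EdgesCross.symm {e f : Sym2 Pt} (h : EdgesCross e f) : EdgesCross f e := by
  obtain ⟨a, b, c, d, rfl, rfl, h⟩ := h
  exact ⟨c, d, a, b, rfl, rfl, by rwa [Set.inter_comm]⟩

/-- The graph `G`, drawn after a perturbation of the points. -/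
theorem exists_drawing {S : Finset Pt} (hS : GenPos S) {G : Finset (Sym2 Pt)}
    (hG : ∀ e ∈ G, ¬ e.IsDiag) : ∃ D : Drawing S,
      D.A = Finset.univ.filter (fun a : S × S => s(a.1.1, a.2.1) ∈ G) ∧ D.NoTriple ∧
      ∀ a b, D.Cr a b → EdgesCross s(a.1.1, a.2.1) s(b.1.1, b.2.1) := by
  obtain ⟨x, y, hx, ho, hc⟩ := exists_perturbation (V := S) (fun p => p.1.1) (fun p => p.1.2)
    fun i j k h1 h2 h3 h => hS i i.2 j j.2 k k.2 (Subtype.coe_injective.ne h1)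
      (Subtype.coe_injective.ne h2) (Subtype.coe_injective.ne h3)
      (collinear_of_orient_eq_zero (Subtype.coe_injective.ne h1) h)
  let D : Drawing S :=
    { x := x
      y := y
      A := Finset.univ.filter (fun a : S × S => s(a.1.1, a.2.1) ∈ G)
      swap_mem := fun a ha => by
        simpa [Sym2.eq_swap] using ha
      ne := fun a ha h => hG _ (Finset.mem_filter.1 ha).2 (by rw [h]; exact rfl)
      x_inj := hx
      gen := fun i j k h1 h2 h3 h => by
        have := ho i j k h1 h2 h3
        rw [orient, h, sub_self, zero_mul] at this
        exact lt_irrefl _ this }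
  refine ⟨D, rfl, D.noTriple_of_concurrency hc, fun a b h => ?_⟩
  have transfer : ∀ a b : S × S, D.Cr a b →
      orient Prod.fst Prod.snd a.1.1 a.2.1 b.1.1 *
        orient Prod.fst Prod.snd a.1.1 a.2.1 b.2.1 < 0 := fun a b h => by
    have hn := Drawing.ne_of_cr h
    have h0 := D.ne a h.1
    have h1 := ho a.1 a.2 b.1 h0 hn.1 hn.2.2.1
    have h2 := ho a.1 a.2 b.2 h0 hn.2.1 hn.2.2.2
    have h3 : orient x y a.1 a.2 b.1 * orient x y a.1 a.2 b.2 < 0 :=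
      Drawing.orient_mul_neg_of_cr h
    have h4 := mul_pos h1 h2
    rw [mul_mul_mul_comm] at h4
    exact neg_of_mul_pos_right h4 h3.le
  exact ⟨_, _, _, _, rfl, rfl, openSegment_inter_nonempty (transfer a b h) (transfer b a h.symm)⟩

/-- Linear bound on the number of edges of a 4-quasi-plane graph. -/
theorem card_edges_le_of_quasiPlane_four (S : Finset Pt) (hS : GenPos S)
    (G : Finset (Sym2 Pt)) (hG : G ∈ qpGraphs 4 S) : G.card ≤ 36 * S.card := by
  obtain ⟨hE, hQ⟩ := mem_qpGraphs.1 hG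
  obtain ⟨D, hA, hN, hC⟩ := exists_drawing hS fun e he => (hE e he).1
  let e : S × S → Sym2 Pt := fun a => s(a.1.1, a.2.1)
  have hmem : ∀ a, a ∈ D.A ↔ e a ∈ G := fun a => by simp [hA, e]
  have hswap : ∀ a b, e a = e b → a = b ∨ a = b.swap := fun a b h => by
    rcases Sym2.eq_iff.1 h with ⟨h1, h2⟩ | ⟨h1, h2⟩
    · exact Or.inl (Prod.ext (Subtype.ext h1) (Subtype.ext h2))
    · exact Or.inr (Prod.ext (Subtype.ext h1) (Subtype.ext h2))
  have hne : ∀ a b, D.Cr a b → e a ≠ e b := fun a b h h' => by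
    have hn := Drawing.ne_of_cr h
    rcases hswap a b h' with rfl | rfl
    · exact hn.1 rfl
    · exact hn.2.1 rfl
  have hle := D.card_le hN fun a b c d h1 h2 h3 h4 h5 h6 => hQ ⟨{e a, e b, e c, e d}, by
      simp only [Finset.insert_subset_iff, Finset.singleton_subset_iff, ← hmem]
      exact ⟨h1.1, h4.1, h6.1, h6.2.1⟩, by
      have := hne _ _ h1
      have := hne _ _ h2
      have := hne _ _ h3
      have := hne _ _ h4
      have := hne _ _ h5
      have := hne _ _ h6
      rw [Finset.card_insert_of_notMem (by simp [*]), Finset.card_insert_of_notMem (by simp [*]),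
        Finset.card_insert_of_notMem (by simp [*]), Finset.card_singleton], by
      have := hC _ _ h1
      have := hC _ _ h2
      have := hC _ _ h3
      have := hC _ _ h4
      have := hC _ _ h5
      have := hC _ _ h6
      simp only [Finset.mem_insert, Finset.mem_singleton]
      rintro f (rfl | rfl | rfl | rfl) g (rfl | rfl | rfl | rfl) hfg <;>
        first
        | exact absurd rfl hfg
        | assumption
        | exact EdgesCross.symm (by assumption)⟩
  have hfib : G.card * 2 ≤ D.A.card := by
    rw [mul_comm]
    refine Finset.mul_card_image_le_card_of_maps_to (f := e) (fun a ha => (hmem a).1 ha) 2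
      fun f hf => ?_
    induction f with | _ p q
    have hp := (hE _ hf).2 p (Sym2.mem_mk_left p q)
    have hq := (hE _ hf).2 q (Sym2.mem_mk_right p q)
    have hpq : p ≠ q := fun h => (hE _ hf).1 h
    rw [← Finset.card_pair (a := ((⟨p, hp⟩, ⟨q, hq⟩) : S × S)) (b := (⟨q, hq⟩, ⟨p, hp⟩))
      fun h => hpq (congrArg (fun a : S × S => a.1.1) h)]
    refine Finset.card_le_card fun a ha => ?_
    rw [Finset.mem_insert, Finset.mem_singleton] at ha
    rw [Finset.mem_filter, hmem]
    have : e a = s(p, q) := by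
      rcases ha with rfl | rfl
      · rfl
      · exact Sym2.eq_swap
    exact ⟨this ▸ hf, this⟩
  have hle' := hle.trans (Nat.mul_le_mul_left 72 (Finset.card_le_univ _))
  rw [Fintype.card_coe] at hle'
  omega

/-- Theorem 3.4. The number of 4-quasi-plane graphs on any set of
`N ≥ 1` points in general position is at most `2 ^ (145 N)`. -/
theorem stmt19 (N : ℕ) (hN : 1 ≤ N) (S : Finset Pt) (hS : S.card = N)
    (hgp : GenPos S) :
    (qpGraphs 4 S).card ≤ 2 ^ (145 * N) :=
  (card_qpGraphs_le_of_edge_bound card_edges_le_of_quasiPlane_four N S hS hgp).trans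
    (Nat.pow_le_pow_right (by norm_num) (by omega))
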